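/- arXiv:2201.08767 — 2 statements merged into one kernel-verified Lean document; each statement's English description precedes it below -/
import Mathlib

section
/- Let k ≥ 3 and let V and W be infinite disjoint sets with V ∪ W = ℕ. In any k-edge-colouring of the complete bipartite graph K_{V,W}, the supremum of d̄(P) over all monochromatic paths P is at least 1/(2k − 3); equivalently, for every ε > 0 there exists a monochromatic path P with d̄(P) ≥ 1/(2k − 3) − ε. -/
open Filter

/-- Upper density of a set of positive integers:
`limsup_{n→∞} |A ∩ {1,…,n}| / n`. -/
noncomputable def upperDensity (A : Set ℕ+) : ℝ :=
  Filter.limsup (fun n : ℕ => (Nat.card {a : ℕ+ // a ∈ A ∧ (a : ℕ) ≤ n} : ℝ) / n) Filter.atTop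

/-- Adjacency in the complete bipartite graph with parts `V` and `W`. -/
def bipAdj (V W : Set ℕ+) (x y : ℕ+) : Prop :=
  (x ∈ V ∧ y ∈ W) ∨ (x ∈ W ∧ y ∈ V)

/-- Adjacency in the complete graph on the positive integers. -/
def completeAdj (x y : ℕ+) : Prop := x ≠ y

/-- `P` is the vertex set of a (finite or one-way infinite) path of colour `i`
in the graph with adjacency `Adj`, whose edges are coloured by `c`. -/
def IsMonoPath {k : ℕ} (Adj : ℕ+ → ℕ+ → Prop) (c : Sym2 ℕ+ → Fin k) (i : Fin k)
    (P : Set ℕ+) : Prop :=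
  (∃ (n : ℕ) (f : Fin n → ℕ+), Function.Injective f ∧
    (∀ (j : ℕ) (h : j + 1 < n),
      Adj (f ⟨j, Nat.lt_of_succ_lt h⟩) (f ⟨j + 1, h⟩) ∧
      c s(f ⟨j, Nat.lt_of_succ_lt h⟩, f ⟨j + 1, h⟩) = i) ∧
    P = Set.range f) ∨
  (∃ f : ℕ → ℕ+, Function.Injective f ∧
    (∀ j : ℕ, Adj (f j) (f (j + 1)) ∧ c s(f j, f (j + 1)) = i) ∧
    P = Set.range f)


open Classical in
/-- Indicator of a proposition. -/
noncomputable def ind (P : Prop) : ℝ := if P then 1 else 0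

lemma ind_pos {P : Prop} (h : P) : ind P = 1 := if_pos h

lemma ind_neg {P : Prop} (h : ¬ P) : ind P = 0 := if_neg h

lemma ind_nonneg (P : Prop) : 0 ≤ ind P := by
  unfold ind; split_ifs <;> norm_num

/-- Abstract data extracted from a colouring all of whose linked sets have small mean:
`U` are the nonprincipal ultrafilters, `N i u` the vertices whose limit colour along `u` is `i`,
`E i` the equivalence relation of being linked in colour `i`, `L i u` the linked set of `u`. -/
structure Sys (k : ℕ) (V W : Set ℕ+) where
  m : Set ℕ+ → ℝ
  δ : ℝ
  U : Type
  mem : Set ℕ+ → U → Prop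
  col : ℕ+ → U → Fin k
  N : Fin k → U → Set ℕ+
  E : Fin k → U → U → Prop
  L : Fin k → U → Set ℕ+
  hVW : ∀ x, x ∈ V ∨ x ∈ W
  hdis : Disjoint V W
  m_nonneg : ∀ A, 0 ≤ m A
  m_add : ∀ A B, Disjoint A B → m (A ∪ B) = m A + m B
  m_univ : m Set.univ = 1
  hk : 3 ≤ k
  hδ : (2 * (k : ℝ) - 3) * δ = 1
  E_refl : ∀ i u, E i u u
  E_symm : ∀ i u u', E i u u' → E i u' u
  E_trans : ∀ i u u' u'', E i u u' → E i u' u'' → E i u u''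
  N_L : ∀ i u u', E i u u' → N i u ⊆ L i u'
  L_lt : ∀ i u, m (L i u) < δ
  null : ∀ A, (∀ u, ¬ mem A u) → m A = 0
  mem_inter : ∀ A B u, mem A u → mem B u → mem (A ∩ B) u
  mem_sup : ∀ A B u, mem A u → A ⊆ B → mem B u
  mem_em : ∀ A u, mem A u ∨ mem Aᶜ u
  mem_empty : ∀ u, ¬ mem ∅ u
  edge : ∀ i u u', mem (N i u) u' → E i u u'
  NV : ∀ i t, mem V t → N i t = {x | x ∈ W ∧ col x t = i}
  NW : ∀ i t, mem W t → N i t = {x | x ∈ V ∧ col x t = i}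
  splitV : ∀ t u, mem V t → mem W u → ∃ i, mem (N i t) u
  splitW : ∀ t u, mem W t → mem V u → ∃ i, mem (N i t) u
  exV : ∃ u, mem V u
  exW : ∃ u, mem W u

namespace Sys

variable {k : ℕ} {V W : Set ℕ+}

/-- Exchange the two sides. -/
def swap (S : Sys k V W) : Sys k W V where
  m := S.m
  δ := S.δ
  U := S.U
  mem := S.mem
  col := S.col
  N := S.N
  E := S.E
  L := S.L
  hVW := fun x => (S.hVW x).symm
  hdis := S.hdis.symm
  m_nonneg := S.m_nonneg
  m_add := S.m_add
  m_univ := S.m_univ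
  hk := S.hk
  hδ := S.hδ
  E_refl := S.E_refl
  E_symm := S.E_symm
  E_trans := S.E_trans
  N_L := S.N_L
  L_lt := S.L_lt
  null := S.null
  mem_inter := S.mem_inter
  mem_sup := S.mem_sup
  mem_em := S.mem_em
  mem_empty := S.mem_empty
  edge := S.edge
  NV := S.NW
  NW := S.NV
  splitV := S.splitW
  splitW := S.splitV
  exV := S.exW
  exW := S.exV

variable (S : Sys k V W)

lemma δ_pos : 0 < S.δ := by
  have h1 := S.hδ
  have h2 : (3 : ℝ) ≤ k := by exact_mod_cast S.hk
  by_contra h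
  push Not at h
  nlinarith

lemma m_split (X A : Set ℕ+) : S.m X = S.m (X ∩ A) + S.m (X \ A) := by
  rw [← S.m_add _ _ Set.disjoint_sdiff_inter.symm, Set.inter_union_diff]

lemma m_empty : S.m ∅ = 0 := S.null _ S.mem_empty

lemma m_mono {A B : Set ℕ+} (h : A ⊆ B) : S.m A ≤ S.m B := by
  have := S.m_split B A
  rw [Set.inter_eq_right.2 h] at this
  have := S.m_nonneg (B \ A)
  linarith

lemma m_ae {A B : Set ℕ+} (h : ∀ u, S.mem A u → S.mem B u) : S.m A ≤ S.m B := by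
  have h1 := S.m_split A B
  have h2 : S.m (A \ B) = 0 := by
    apply S.null
    intro u hu
    have h3 := h u (S.mem_sup _ _ u hu Set.diff_subset)
    have h4 := S.mem_inter _ _ u hu h3
    exact S.mem_empty u (S.mem_sup _ _ u h4 (by rintro x ⟨⟨_, h⟩, h'⟩; exact h h'))
  have h3 := S.m_mono (Set.inter_subset_right : A ∩ B ⊆ B)
  linarith

lemma m_fiber {Φ : Type} [Fintype Φ] (f : ℕ+ → Φ) (X : Set ℕ+) :
    S.m X = ∑ φ, S.m (X ∩ {x | f x = φ}) := by
  classical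
  have key : ∀ F : Finset Φ, S.m (X ∩ {x | f x ∈ F}) = ∑ φ ∈ F, S.m (X ∩ {x | f x = φ}) := by
    intro F
    induction F using Finset.induction_on with
    | empty => simp [S.m_empty]
    | insert a F ha ih =>
      rw [Finset.sum_insert ha, ← ih, ← S.m_add]
      · congr 1
        ext x
        simp only [Finset.mem_insert, Set.mem_inter_iff, Set.mem_setOf_eq, Set.mem_union]
        tauto
      · rw [Set.disjoint_left]
        rintro x ⟨_, hx⟩ ⟨_, hx'⟩
        simp only [Set.mem_setOf_eq] at hx hx'
        exact ha (hx ▸ hx')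
  have := key Finset.univ
  simpa using this

lemma sumV {s : S.U} (hs : S.mem V s) : ∑ i, S.m (S.N i s) = S.m W := by
  rw [S.m_fiber (fun x => S.col x s) W]
  refine Finset.sum_congr rfl fun i _ => ?_
  rw [S.NV i s hs]; rfl

lemma sumW {s : S.U} (hs : S.mem W s) : ∑ i, S.m (S.N i s) = S.m V := S.swap.sumV hs

lemma mVW : S.m V + S.m W = 1 := by
  rw [← S.m_add _ _ S.hdis, ← S.m_univ]
  congr 1
  ext x
  simp [S.hVW x]

lemma side (u : S.U) : S.mem V u ∨ S.mem W u := by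
  rcases S.mem_em V u with h | h
  · exact Or.inl h
  · exact Or.inr (S.mem_sup _ _ u h fun x hx => (S.hVW x).resolve_left hx)

lemma memV_of_N {i : Fin k} {t u : S.U} (ht : S.mem W t) (hu : S.mem (S.N i t) u) : S.mem V u :=
  S.mem_sup _ _ u hu (by rw [S.NW i t ht]; exact fun x hx => hx.1)

lemma memW_of_N {i : Fin k} {t u : S.U} (ht : S.mem V t) (hu : S.mem (S.N i t) u) : S.mem W u :=
  S.swap.memV_of_N ht hu

/-- Two equivalent ultrafilters on opposite sides. -/
lemma d_lt {i : Fin k} {s t : S.U} (hs : S.mem V s) (ht : S.mem W t) (h : S.E i s t) :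
    S.m (S.N i s) + S.m (S.N i t) < S.δ := by
  rw [← S.m_add]
  · refine lt_of_le_of_lt (S.m_mono ?_) (S.L_lt i t)
    exact Set.union_subset (S.N_L i s t h) (S.N_L i t t (S.E_refl i t))
  · rw [S.NV i s hs, S.NW i t ht, Set.disjoint_left]
    rintro x ⟨h1, _⟩ ⟨h2, _⟩
    exact Set.disjoint_left.1 S.hdis h2 h1

lemma d_lt1 (i : Fin k) (s : S.U) : S.m (S.N i s) < S.δ :=
  lt_of_le_of_lt (S.m_mono (S.N_L i s s (S.E_refl i s))) (S.L_lt i s)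

lemma sum_one {s t : S.U} (hs : S.mem V s) (ht : S.mem W t) :
    ∑ i, (S.m (S.N i s) + S.m (S.N i t)) = 1 := by
  rw [Finset.sum_add_distrib, S.sumV hs, S.sumW ht, add_comm, S.mVW]

/-- Weighted sum bound: three special colours. -/
lemma three_bound {s t : S.U} (hs : S.mem V s) (ht : S.mem W t) {p q r : Fin k}
    (hpq : p ≠ q) (hpr : p ≠ r) (hqr : q ≠ r) :
    3 * S.δ ≤ (S.m (S.N p s) + S.m (S.N p t)) + (S.m (S.N q s) + S.m (S.N q t))
      + (S.m (S.N r s) + S.m (S.N r t)) := by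
  classical
  have h1 := S.sum_one hs ht
  have h2 : ∑ i ∈ ({p, q, r} : Finset (Fin k)), (S.m (S.N i s) + S.m (S.N i t)) +
      ∑ i ∈ ({p, q, r} : Finset (Fin k))ᶜ, (S.m (S.N i s) + S.m (S.N i t)) = 1 := by
    rw [Finset.sum_add_sum_compl, h1]
  have hc : ({p, q, r} : Finset (Fin k)).card = 3 := by
    rw [Finset.card_eq_three]; exact ⟨p, q, r, hpq, hpr, hqr, rfl⟩
  have h3 : ∑ i ∈ ({p, q, r} : Finset (Fin k))ᶜ, (S.m (S.N i s) + S.m (S.N i t)) ≤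
      (k - 3 : ℝ) * (2 * S.δ) := by
    have : ∑ i ∈ ({p, q, r} : Finset (Fin k))ᶜ, (S.m (S.N i s) + S.m (S.N i t)) ≤
      ∑ i ∈ ({p, q, r} : Finset (Fin k))ᶜ, (2 * S.δ) := by
      refine Finset.sum_le_sum fun i _ => ?_
      have := S.d_lt1 i s
      have := S.d_lt1 i t
      linarith
    rw [Finset.sum_const, Finset.card_compl, hc, Fintype.card_fin, nsmul_eq_mul,
      Nat.cast_sub S.hk] at this
    simpa using this
  rw [Finset.sum_insert (by simp [hpq, hpr]), Finset.sum_insert (by simp [hqr]),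
    Finset.sum_singleton] at h2
  have := S.hδ
  linarith

lemma cover_aux (n : ℕ) : ∀ (A : Fin n → Set ℕ+) (z : Fin n → ℝ) (l : ℝ) (X : Set ℕ+),
    (∀ u, S.mem X u → l ≤ ∑ j, z j * ind (S.mem (A j) u)) →
    l * S.m X ≤ ∑ j, z j * S.m (X ∩ A j) := by
  induction n with
  | zero =>
    intro A z l X h
    simp only [Finset.univ_eq_empty, Finset.sum_empty] at h ⊢
    by_cases hl : l ≤ 0
    · exact mul_nonpos_of_nonpos_of_nonneg hl (S.m_nonneg X)
    · rw [S.null X fun u hu => hl (h u hu)]; simp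
  | succ n ih =>
    intro A z l X h
    have h1 := ih (fun j => A j.succ) (fun j => z j.succ) (l - z 0) (X ∩ A 0) (by
      intro u hu
      have h2 := h u (S.mem_sup _ _ u hu Set.inter_subset_left)
      have h3 : S.mem (A 0) u := S.mem_sup _ _ u hu Set.inter_subset_right
      rw [Fin.sum_univ_succ, ind_pos h3] at h2
      linarith)
    have h1' := ih (fun j => A j.succ) (fun j => z j.succ) l (X \ A 0) (by
      intro u hu
      have h2 := h u (S.mem_sup _ _ u hu Set.diff_subset)
      have h3 : ¬ S.mem (A 0) u := fun h4 =>
        S.mem_empty u (S.mem_sup _ _ u (S.mem_inter _ _ u hu h4)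
          (by rintro x ⟨⟨_, h⟩, h'⟩; exact h h'))
      rw [Fin.sum_univ_succ, ind_neg h3] at h2
      linarith)
    rw [Fin.sum_univ_succ, S.m_split X (A 0)]
    have h4 : ∑ j : Fin n, z j.succ * S.m (X ∩ A j.succ) =
        ∑ j : Fin n, z j.succ * S.m (X ∩ A 0 ∩ A j.succ) +
        ∑ j : Fin n, z j.succ * S.m (X \ A 0 ∩ A j.succ) := by
      rw [← Finset.sum_add_distrib]
      refine Finset.sum_congr rfl fun j _ => ?_
      rw [S.m_split (X ∩ A j.succ) (A 0), ← mul_add]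
      congr 3
      · ext x; simp only [Set.mem_inter_iff]; tauto
      · ext x; simp only [Set.mem_inter_iff, Set.mem_diff]; tauto
    rw [h4]
    linarith

/-- Fractional covers by linked sets have weight more than `2k-3`. -/
lemma cover {n : ℕ} (i : Fin n → Fin k) (w : Fin n → S.U) (z : Fin n → ℝ) (l : ℝ)
    (hl : 0 < l) (hz : ∀ j, 0 ≤ z j) (hsum : ∑ j, z j ≤ (2 * (k : ℝ) - 3) * l)
    (h : ∀ u, l ≤ ∑ j, z j * ind (S.mem (S.L (i j) (w j)) u)) :
    False := by
  have h1 := S.cover_aux n (fun j => S.L (i j) (w j)) z l Set.univ (fun u _ => h u)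
  rw [S.m_univ, mul_one] at h1
  simp only [Set.univ_inter] at h1
  by_cases h0 : ∃ j, 0 < z j
  · obtain ⟨j0, hj0⟩ := h0
    have h2 : ∑ j, z j * S.m (S.L (i j) (w j)) < ∑ j, z j * S.δ := by
      refine Finset.sum_lt_sum (fun j _ => ?_) ⟨j0, Finset.mem_univ _, ?_⟩
      · exact mul_le_mul_of_nonneg_left (S.L_lt _ _).le (hz j)
      · exact mul_lt_mul_of_pos_left (S.L_lt _ _) hj0
    rw [← Finset.sum_mul] at h2
    have h3 := mul_le_mul_of_nonneg_right hsum S.δ_pos.le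
    have := S.hδ
    nlinarith
  · push Not at h0
    have : ∑ j, z j * S.m (S.L (i j) (w j)) ≤ 0 :=
      Finset.sum_nonpos fun j _ => mul_nonpos_of_nonpos_of_nonneg (h0 j) (S.m_nonneg _)
    linarith

lemma memL {i : Fin k} {t u w : S.U} (hu : S.mem (S.N i t) u) (h : S.E i t w) :
    S.mem (S.L i w) u := S.mem_sup _ _ u hu (S.N_L i t w h)

lemma disjN {i j : Fin k} (hij : i ≠ j) {t u : S.U} (h1 : S.mem (S.N i t) u)
    (h2 : S.mem (S.N j t) u) : False := by
  refine S.mem_empty u (S.mem_sup _ _ u (S.mem_inter _ _ u h1 h2) ?_)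
  rintro x ⟨hx, hx'⟩
  rcases S.side t with ht | ht
  · rw [S.NV _ _ ht] at hx hx'
    exact hij (hx.2.symm.trans hx'.2)
  · rw [S.NW _ _ ht] at hx hx'
    exact hij (hx.2.symm.trans hx'.2)

lemma link {i : Fin k} {t t' u : S.U} (h1 : S.mem (S.N i t) u) (h2 : S.mem (S.N i t') u) :
    S.E i t t' := S.E_trans _ _ _ _ (S.edge _ _ _ h1) (S.E_symm _ _ _ (S.edge _ _ _ h2))

lemma exE {s t : S.U} (hs : S.mem V s) (ht : S.mem W t) : ∃ i, S.E i s t := by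
  obtain ⟨i, hi⟩ := S.splitV s t hs ht
  exact ⟨i, S.edge _ _ _ hi⟩

lemma ex_of_pos {A : Set ℕ+} (h : 0 < S.m A) : ∃ u, S.mem A u := by
  by_contra h'
  push Not at h'
  rw [S.null A h'] at h
  exact lt_irrefl _ h

lemma no_three {s t : S.U} (hs : S.mem V s) (ht : S.mem W t) {p q r : Fin k}
    (hpq : p ≠ q) (hpr : p ≠ r) (hqr : q ≠ r) (hp : S.E p s t) (hq : S.E q s t)
    (hr : S.E r s t) : False := by
  have := S.three_bound hs ht hpq hpr hqr
  have := S.d_lt hs ht hp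
  have := S.d_lt hs ht hq
  have := S.d_lt hs ht hr
  linarith

end Sys
namespace Sys

variable {k : ℕ} {V W : Set ℕ+} (S : Sys k V W)

/-- Data: `s₀, t₀` linked in two colours `p, q`; a further colour `r`. -/
lemma deficit {s0 t0 : S.U} (hs0 : S.mem V s0) (ht0 : S.mem W t0) {p q r : Fin k}
    (hpq : p ≠ q) (hpr : p ≠ r) (hqr : q ≠ r) (hp : S.E p s0 t0) (hq : S.E q s0 t0) :
    S.δ < S.m (S.N r s0) + S.m (S.N r t0) := by
  have := S.three_bound hs0 ht0 hpq hpr hqr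
  have := S.d_lt hs0 ht0 hp
  have := S.d_lt hs0 ht0 hq
  linarith

/-- Half of the argument for `k ≥ 4`. -/
lemma four_half {s0 t0 : S.U} (hs0 : S.mem V s0) (ht0 : S.mem W t0) {r : Fin k}
    (hr : ¬ S.E r s0 t0) (hD : 3 * S.δ / 2 ≤ S.m (S.N r s0) + S.m (S.N r t0))
    {s t : S.U} (hs : S.mem (S.N r t0) s) (ht : S.mem (S.N r s0) t) {j : Fin k}
    (hj : S.E j s t) (hjt : S.m (S.N j t) ≤ S.δ / 2) : False := by
  have htW : S.mem W t := S.memW_of_N hs0 ht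
  have hts0 : S.E r s0 t := S.edge _ _ _ ht
  have h1 := S.d_lt1 r s0
  have h2 := S.d_lt1 r t0
  have hlt : S.m (S.N j t) < S.m (S.N r t0) := by linarith
  have : ∃ s', S.mem (S.N r t0) s' ∧ ¬ S.mem (S.N j t) s' := by
    by_contra h
    push Not at h
    have := S.m_ae h
    linarith
  obtain ⟨s', hs', hns'⟩ := this
  have hsV : S.mem V s' := S.memV_of_N ht0 hs'
  obtain ⟨j', hj'⟩ := S.splitW t s' htW hsV
  have hjj : j' ≠ j := by rintro rfl; exact hns' hj'
  have hE' : S.E j' s' t := S.E_symm _ _ _ (S.edge _ _ _ hj')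
  have nr : ∀ x, S.mem (S.N r t0) x → ¬ S.E r x t := by
    intro x hx hxt
    apply hr
    exact S.E_trans _ _ _ _ hts0 (S.E_trans _ _ _ _ (S.E_symm _ _ _ hxt)
      (S.E_symm _ _ _ (S.edge _ _ _ hx)))
  have hjr2 : j' ≠ r := by rintro rfl; exact nr s' hs' hE'
  have hjr : j ≠ r := by rintro rfl; exact nr s hs hj
  have h3 := S.three_bound hsV htW hjj hjr2 hjr
  have h4 := S.d_lt hsV htW hE'
  have h5 := S.d_lt hs0 htW hts0
  have h6 := S.d_lt hsV ht0 (S.E_symm _ _ _ (S.edge _ _ _ hs'))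
  have h7 := S.d_lt1 j s'
  linarith

lemma four_one {s0 t0 : S.U} (hs0 : S.mem V s0) (ht0 : S.mem W t0) {r : Fin k}
    (hr : ¬ S.E r s0 t0) (hD : 3 * S.δ / 2 ≤ S.m (S.N r s0) + S.m (S.N r t0)) : False := by
  have h1 := S.d_lt1 r s0
  have h2 := S.d_lt1 r t0
  have h3 := S.δ_pos
  obtain ⟨s, hs⟩ := S.ex_of_pos (A := S.N r t0) (by linarith)
  obtain ⟨t, ht⟩ := S.ex_of_pos (A := S.N r s0) (by linarith)
  have hsV := S.memV_of_N ht0 hs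
  have htW := S.memW_of_N hs0 ht
  obtain ⟨j, hj⟩ := S.exE hsV htW
  have h4 := S.d_lt hsV htW hj
  rcases le_or_gt (S.m (S.N j t)) (S.δ / 2) with h | h
  · exact S.four_half hs0 ht0 hr hD hs ht hj h
  · refine S.swap.four_half ht0 hs0 (r := r) (j := j) (fun h => hr (S.E_symm _ _ _ h)) ?_ ht hs
      (S.E_symm _ _ _ hj) ?_
    · change 3 * S.δ / 2 ≤ S.m (S.N r t0) + S.m (S.N r s0)
      linarith
    · change S.m (S.N j s) ≤ S.δ / 2
      linarith

lemma caseA_four (hk4 : 4 ≤ k) {s0 t0 : S.U} (hs0 : S.mem V s0) (ht0 : S.mem W t0) {p q : Fin k}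
    (hpq : p ≠ q) (hp : S.E p s0 t0) (hq : S.E q s0 t0) : False := by
  classical
  have hc : 1 < (({p, q} : Finset (Fin k))ᶜ).card := by
    rw [Finset.card_compl, Finset.card_pair hpq, Fintype.card_fin]; omega
  obtain ⟨r, hr, r', hr', hrr⟩ := Finset.one_lt_card.1 hc
  simp only [Finset.mem_compl, Finset.mem_insert, Finset.mem_singleton, not_or] at hr hr'
  have nE : ¬ S.E r s0 t0 := fun h =>
    S.no_three hs0 ht0 hpq (Ne.symm hr.1) (Ne.symm hr.2) hp hq h
  have nE' : ¬ S.E r' s0 t0 := fun h =>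
    S.no_three hs0 ht0 hpq (Ne.symm hr'.1) (Ne.symm hr'.2) hp hq h
  have key : 3 * S.δ ≤ S.m (S.N r s0) + S.m (S.N r t0) + (S.m (S.N r' s0) + S.m (S.N r' t0)) := by
    have h1 := S.sum_one hs0 ht0
    have hcard : ({p, q, r, r'} : Finset (Fin k)).card = 4 := by
      rw [Finset.card_insert_of_notMem, Finset.card_insert_of_notMem, Finset.card_pair hrr]
      · simp [Ne.symm hr.2, Ne.symm hr'.2]
      · simp [hpq, Ne.symm hr.1, Ne.symm hr'.1]
    have h2 : ∑ i ∈ ({p, q, r, r'} : Finset (Fin k)), (S.m (S.N i s0) + S.m (S.N i t0)) +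
        ∑ i ∈ ({p, q, r, r'} : Finset (Fin k))ᶜ, (S.m (S.N i s0) + S.m (S.N i t0)) = 1 := by
      rw [Finset.sum_add_sum_compl, h1]
    have h3 : ∑ i ∈ ({p, q, r, r'} : Finset (Fin k))ᶜ, (S.m (S.N i s0) + S.m (S.N i t0)) ≤
        (k - 4 : ℝ) * (2 * S.δ) := by
      have : ∑ i ∈ ({p, q, r, r'} : Finset (Fin k))ᶜ, (S.m (S.N i s0) + S.m (S.N i t0)) ≤
        ∑ i ∈ ({p, q, r, r'} : Finset (Fin k))ᶜ, (2 * S.δ) := by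
        refine Finset.sum_le_sum fun i _ => ?_
        have := S.d_lt1 i s0
        have := S.d_lt1 i t0
        linarith
      rw [Finset.sum_const, Finset.card_compl, hcard, Fintype.card_fin, nsmul_eq_mul,
        Nat.cast_sub hk4] at this
      simpa using this
    rw [Finset.sum_insert (by simp [hpq, Ne.symm hr.1, Ne.symm hr'.1]),
      Finset.sum_insert (by simp [Ne.symm hr.2, Ne.symm hr'.2]),
      Finset.sum_insert (by simp [hrr]), Finset.sum_singleton] at h2
    have := S.hδ
    have := S.d_lt hs0 ht0 hp
    have := S.d_lt hs0 ht0 hq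
    linarith
  rcases le_or_gt (3 * S.δ / 2) (S.m (S.N r s0) + S.m (S.N r t0)) with h | h
  · exact S.four_one hs0 ht0 nE h
  · exact S.four_one hs0 ht0 nE' (by linarith)

end Sys
namespace Sys

variable {k : ℕ} {V W : Set ℕ+} (S : Sys k V W)

lemma cover3 (hk3 : k = 3) {i1 i2 i3 : Fin k} {w1 w2 w3 : S.U}
    (h : ∀ u, S.mem (S.L i1 w1) u ∨ S.mem (S.L i2 w2) u ∨ S.mem (S.L i3 w3) u) : False := by
  refine S.cover ![i1, i2, i3] ![w1, w2, w3] ![1, 1, 1] 1 one_pos ?_ ?_ ?_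
  · intro j; fin_cases j <;> simp
  · subst hk3; simp [Fin.sum_univ_succ]; norm_num
  · intro u
    simp only [Fin.sum_univ_succ, Fin.sum_univ_zero, Matrix.cons_val_zero, Matrix.cons_val_succ]
    have n1 := ind_nonneg (S.mem (S.L i1 w1) u)
    have n2 := ind_nonneg (S.mem (S.L i2 w2) u)
    have n3 := ind_nonneg (S.mem (S.L i3 w3) u)
    rcases h u with h | h | h <;> have := ind_pos h <;> linarith

lemma cover6 (hk3 : k = 3) {i1 i2 i3 i4 i5 i6 : Fin k} {w1 w2 w3 w4 w5 w6 : S.U}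
    (h : ∀ u, (2 : ℝ) ≤ ind (S.mem (S.L i1 w1) u) +
      ind (S.mem (S.L i2 w2) u) + ind (S.mem (S.L i3 w3) u) +
      ind (S.mem (S.L i4 w4) u) + ind (S.mem (S.L i5 w5) u) +
      ind (S.mem (S.L i6 w6) u)) : False := by
  refine S.cover ![i1, i2, i3, i4, i5, i6] ![w1, w2, w3, w4, w5, w6] ![1, 1, 1, 1, 1, 1] 2
    two_pos ?_ ?_ ?_
  · intro j; fin_cases j <;> simp
  · subst hk3; simp [Fin.sum_univ_succ]; norm_num
  · intro u
    refine (h u).trans (le_of_eq ?_)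
    simp only [Fin.sum_univ_succ, Fin.sum_univ_zero, Matrix.cons_val_zero, Matrix.cons_val_succ]
    ring

lemma cover8 (hk3 : k = 3) {i1 i2 i3 i4 i5 i6 i7 i8 : Fin k} {w1 w2 w3 w4 w5 w6 w7 w8 : S.U}
    (h : ∀ u, (4 : ℝ) ≤ 2 * ind (S.mem (S.L i1 w1) u) +
      2 * ind (S.mem (S.L i2 w2) u) + 2 * ind (S.mem (S.L i3 w3) u) +
      2 * ind (S.mem (S.L i4 w4) u) + ind (S.mem (S.L i5 w5) u) +
      ind (S.mem (S.L i6 w6) u) + ind (S.mem (S.L i7 w7) u) +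
      ind (S.mem (S.L i8 w8) u)) : False := by
  refine S.cover ![i1, i2, i3, i4, i5, i6, i7, i8] ![w1, w2, w3, w4, w5, w6, w7, w8]
    ![2, 2, 2, 2, 1, 1, 1, 1] 4 (by norm_num) ?_ ?_ ?_
  · intro j; fin_cases j <;> simp
  · subst hk3; simp [Fin.sum_univ_succ]; norm_num
  · intro u
    refine (h u).trans (le_of_eq ?_)
    simp only [Fin.sum_univ_succ, Fin.sum_univ_zero, Matrix.cons_val_zero, Matrix.cons_val_succ]
    ring

/-- Three colours, base pair `s₀,t₀` linked in colours `p, q` but not in `r`. -/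
structure Base (p q r : Fin k) (s0 t0 : S.U) : Prop where
  hk3 : k = 3
  pq : p ≠ q
  pr : p ≠ r
  qr : q ≠ r
  all : ∀ i, i = p ∨ i = q ∨ i = r
  hs0 : S.mem V s0
  ht0 : S.mem W t0
  Ep : S.E p s0 t0
  Eq : S.E q s0 t0
  nEr : ¬ S.E r s0 t0

variable {S} {p q r : Fin k} {s0 t0 : S.U}

lemma Base.flip (B : S.Base p q r s0 t0) : S.Base q p r s0 t0 :=
  ⟨B.hk3, B.pq.symm, B.qr, B.pr, fun i => by have := B.all i; tauto, B.hs0, B.ht0, B.Eq, B.Ep, B.nEr⟩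

lemma Base.swap (B : S.Base p q r s0 t0) : S.swap.Base p q r t0 s0 :=
  ⟨B.hk3, B.pq, B.pr, B.qr, B.all, B.ht0, B.hs0, S.E_symm _ _ _ B.Ep, S.E_symm _ _ _ B.Eq,
    fun h => B.nEr (S.E_symm _ _ _ h)⟩

lemma Base.viaV (B : S.Base p q r s0 t0) {s u : S.U} (hs : S.mem V s) (hu : S.mem W u) :
    S.mem (S.N p s) u ∨ S.mem (S.N q s) u ∨ S.mem (S.N r s) u := by
  obtain ⟨i, hi⟩ := S.splitV s u hs hu
  rcases B.all i with rfl | rfl | rfl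
  · exact Or.inl hi
  · exact Or.inr (Or.inl hi)
  · exact Or.inr (Or.inr hi)

lemma Base.viaW (B : S.Base p q r s0 t0) {s u : S.U} (hs : S.mem W s) (hu : S.mem V u) :
    S.mem (S.N p s) u ∨ S.mem (S.N q s) u ∨ S.mem (S.N r s) u := B.swap.viaV hs hu

/-- `s` is in the `V`-part of the `r`-class of `t₀`. -/
def InS (S : Sys k V W) (r : Fin k) (t0 s : S.U) : Prop := S.mem V s ∧ S.E r s t0

/-- `t` is in the `W`-part of the `r`-class of `s₀`. -/
def InT (S : Sys k V W) (r : Fin k) (s0 t : S.U) : Prop := S.mem W t ∧ S.E r t s0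

lemma Base.pqE (B : S.Base p q r s0 t0) {s t : S.U} (hs : S.InS r t0 s) (ht : S.InT r s0 t) :
    S.E p s t ∨ S.E q s t := by
  obtain ⟨i, hi⟩ := S.exE hs.1 ht.1
  rcases B.all i with rfl | rfl | rfl
  · exact Or.inl hi
  · exact Or.inr hi
  · exact (B.nEr (S.E_trans _ _ _ _ (S.E_symm _ _ _ ht.2)
      (S.E_trans _ _ _ _ (S.E_symm _ _ _ hi) hs.2))).elim

lemma Base.case_i (B : S.Base p q r s0 t0) {s t : S.U} (hs : S.InS r t0 s) (ht : S.InT r s0 t)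
    (hp : S.E p s t) (hq : S.E q s t) : False := by
  refine S.cover6 B.hk3 (i1 := p) (i2 := q) (i3 := r) (i4 := r) (i5 := p) (i6 := q)
    (w1 := s0) (w2 := s0) (w3 := s0) (w4 := t0) (w5 := t) (w6 := t) ?_
  intro u
  have n1 := ind_nonneg (S.mem (S.L p s0) u)
  have n2 := ind_nonneg (S.mem (S.L q s0) u)
  have n3 := ind_nonneg (S.mem (S.L r s0) u)
  have n4 := ind_nonneg (S.mem (S.L r t0) u)
  have n5 := ind_nonneg (S.mem (S.L p t) u)
  have n6 := ind_nonneg (S.mem (S.L q t) u)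
  rcases S.side u with hu | hu
  · rcases B.viaW B.ht0 hu with h | h | h <;>
    rcases B.viaW ht.1 hu with h' | h' | h' <;>
    first
    | replace h := S.memL h (S.E_symm _ _ _ B.Ep)
    | replace h := S.memL h (S.E_symm _ _ _ B.Eq)
    | replace h := S.memL h (S.E_refl _ _)
    all_goals
      first
      | replace h' := S.memL h' ht.2
      | replace h' := S.memL h' (S.E_refl _ _)
    all_goals have := ind_pos h <;> have := ind_pos h' <;> linarith
  · rcases B.viaV B.hs0 hu with h | h | h <;>
    rcases B.viaV hs.1 hu with h' | h' | h' <;>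
    replace h := S.memL h (S.E_refl _ _)
    all_goals
      first
      | replace h' := S.memL h' hs.2
      | replace h' := S.memL h' hp
      | replace h' := S.memL h' hq
    all_goals have := ind_pos h <;> have := ind_pos h' <;> linarith

lemma Base.case_ii (B : S.Base p q r s0 t0) {a b t t' : S.U} (ha : S.InS r t0 a)
    (hb : S.InS r t0 b) (ht : S.InT r s0 t) (ht' : S.InT r s0 t')
    (hat : S.E p a t) (hbt : S.E q b t) (hat' : S.E q a t') (hbt' : S.E p b t') : False := by
  refine S.cover8 B.hk3 (i1 := p) (i2 := q) (i3 := r) (i4 := r) (i5 := p) (i6 := q)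
    (i7 := p) (i8 := q)
    (w1 := s0) (w2 := s0) (w3 := s0) (w4 := t0) (w5 := t) (w6 := t) (w7 := t') (w8 := t') ?_
  intro u
  have n1 := ind_nonneg (S.mem (S.L p s0) u)
  have n2 := ind_nonneg (S.mem (S.L q s0) u)
  have n3 := ind_nonneg (S.mem (S.L r s0) u)
  have n4 := ind_nonneg (S.mem (S.L r t0) u)
  have n5 := ind_nonneg (S.mem (S.L p t) u)
  have n6 := ind_nonneg (S.mem (S.L q t) u)
  have n7 := ind_nonneg (S.mem (S.L p t') u)
  have n8 := ind_nonneg (S.mem (S.L q t') u)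
  rcases S.side u with hu | hu
  · have g1 : S.mem (S.L p s0) u ∨ S.mem (S.L q s0) u ∨ S.mem (S.L r t0) u := by
      rcases B.viaW B.ht0 hu with h | h | h
      · exact Or.inl (S.memL h (S.E_symm _ _ _ B.Ep))
      · exact Or.inr (Or.inl (S.memL h (S.E_symm _ _ _ B.Eq)))
      · exact Or.inr (Or.inr (S.memL h (S.E_refl _ _)))
    have g2 : S.mem (S.L p t) u ∨ S.mem (S.L q t) u ∨ S.mem (S.L r s0) u := by
      rcases B.viaW ht.1 hu with h | h | h
      · exact Or.inl (S.memL h (S.E_refl _ _))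
      · exact Or.inr (Or.inl (S.memL h (S.E_refl _ _)))
      · exact Or.inr (Or.inr (S.memL h ht.2))
    have g3 : S.mem (S.L p t') u ∨ S.mem (S.L q t') u ∨ S.mem (S.L r s0) u := by
      rcases B.viaW ht'.1 hu with h | h | h
      · exact Or.inl (S.memL h (S.E_refl _ _))
      · exact Or.inr (Or.inl (S.memL h (S.E_refl _ _)))
      · exact Or.inr (Or.inr (S.memL h ht'.2))
    rcases g1 with h | h | h <;> rcases g2 with h' | h' | h' <;> rcases g3 with h'' | h'' | h'' <;>
      have := ind_pos h <;> have := ind_pos h' <;> have := ind_pos h'' <;> linarith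
  · have g1 : S.mem (S.L p s0) u ∨ S.mem (S.L q s0) u ∨ S.mem (S.L r s0) u := by
      rcases B.viaV B.hs0 hu with h | h | h
      · exact Or.inl (S.memL h (S.E_refl _ _))
      · exact Or.inr (Or.inl (S.memL h (S.E_refl _ _)))
      · exact Or.inr (Or.inr (S.memL h (S.E_refl _ _)))
    have g2 : S.mem (S.L p t) u ∨ S.mem (S.L q t') u ∨ S.mem (S.L r t0) u := by
      rcases B.viaV ha.1 hu with h | h | h
      · exact Or.inl (S.memL h hat)
      · exact Or.inr (Or.inl (S.memL h hat'))
      · exact Or.inr (Or.inr (S.memL h ha.2))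
    have g3 : S.mem (S.L p t') u ∨ S.mem (S.L q t) u ∨ S.mem (S.L r t0) u := by
      rcases B.viaV hb.1 hu with h | h | h
      · exact Or.inl (S.memL h hbt')
      · exact Or.inr (Or.inl (S.memL h hbt))
      · exact Or.inr (Or.inr (S.memL h hb.2))
    rcases g1 with h | h | h <;> rcases g2 with h' | h' | h' <;> rcases g3 with h'' | h'' | h'' <;>
      have := ind_pos h <;> have := ind_pos h' <;> have := ind_pos h'' <;> linarith

/-- The star configuration. -/
structure Star (S : Sys k V W) (p q r : Fin k) (s0 t0 a b t : S.U) : Prop where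
  B : S.Base p q r s0 t0
  ha : S.InS r t0 a
  hb : S.InS r t0 b
  ht : S.InT r s0 t
  hat : ∀ t', S.InT r s0 t' → S.E p a t'
  hbt : ∀ t', S.InT r s0 t' → S.E q b t'

variable {a b t : S.U}

lemma Star.flip (H : S.Star p q r s0 t0 a b t) : S.Star q p r s0 t0 b a t :=
  ⟨H.B.flip, H.hb, H.ha, H.ht, H.hbt, H.hat⟩

/-- An ultrafilter on `W_r` lies in `N p a`. -/
lemma Star.W3 (H : S.Star p q r s0 t0 a b t) {u : S.U} (h : S.mem (S.N r s0) u) :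
    S.mem (S.N p a) u := by
  have hW : S.mem W u := S.memW_of_N H.B.hs0 h
  have hT : S.InT r s0 u := ⟨hW, S.E_symm _ _ _ (S.edge _ _ _ h)⟩
  rcases H.B.viaV H.ha.1 hW with h' | h' | h'
  · exact h'
  · exact (H.B.case_i H.ha hT (H.hat _ hT) (S.edge _ _ _ h')).elim
  · exact (H.B.nEr (S.E_trans _ _ _ _ (S.link h h') H.ha.2)).elim

lemma Star.nC1 (H : S.Star p q r s0 t0 a b t) : ¬ S.E p s0 t := by
  intro hE
  have B := H.B
  refine S.cover3 B.hk3 (i1 := p) (i2 := q) (i3 := q) (w1 := s0) (w2 := s0) (w3 := t) ?_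
  intro u
  rcases S.side u with hu | hu
  · rcases B.viaW B.ht0 hu with h | h | h
    · exact Or.inl (S.memL h (S.E_symm _ _ _ B.Ep))
    · exact Or.inr (Or.inl (S.memL h (S.E_symm _ _ _ B.Eq)))
    · rcases B.viaW H.ht.1 hu with h' | h' | h'
      · exact Or.inl (S.memL h' (S.E_symm _ _ _ hE))
      · exact Or.inr (Or.inr (S.memL h' (S.E_refl _ _)))
      · exact (B.nEr (S.E_symm _ _ _ (S.E_trans _ _ _ _ (S.link h h') H.ht.2))).elim
  · rcases B.viaV B.hs0 hu with h | h | h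
    · exact Or.inl (S.memL h (S.E_refl _ _))
    · exact Or.inr (Or.inl (S.memL h (S.E_refl _ _)))
    · exact Or.inl (S.memL (H.W3 h) (S.E_trans _ _ _ _ (H.hat _ H.ht) (S.E_symm _ _ _ hE)))

lemma Star.tri (H : S.Star p q r s0 t0 a b t) {w : S.U} (h1 : S.mem (S.N p s0) w)
    (h2 : S.mem (S.N q a) w) (h3 : S.mem (S.N p b) w) (hn : ¬ S.E q a s0) : False := by
  have B := H.B
  have hbs : S.E p b s0 := S.link h3 h1
  have hwW : S.mem W w := S.memW_of_N B.hs0 h1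
  refine S.cover3 B.hk3 (i1 := p) (i2 := p) (i3 := r) (w1 := s0) (w2 := t) (w3 := t0) ?_
  intro u
  rcases S.side u with hu | hu
  · rcases B.viaW B.ht0 hu with h | h | h
    · exact Or.inl (S.memL h (S.E_symm _ _ _ B.Ep))
    · rcases B.viaW H.ht.1 hu with h' | h' | h'
      · exact Or.inr (Or.inl (S.memL h' (S.E_refl _ _)))
      · exact (H.flip.nC1 (S.E_trans _ _ _ _ B.Eq (S.link h h'))).elim
      · rcases B.viaW hwW hu with h'' | h'' | h''
        · exact Or.inl (S.memL h'' (S.E_symm _ _ _ (S.edge _ _ _ h1)))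
        · refine (hn ?_).elim
          exact S.E_trans _ _ _ _ (S.edge _ _ _ h2) (S.E_trans _ _ _ _ (S.link h'' h)
            (S.E_symm _ _ _ B.Eq))
        · have hT : S.InT r s0 w := ⟨hwW, S.E_trans _ _ _ _ (S.link h'' h') H.ht.2⟩
          exact (B.case_i H.ha hT (H.hat _ hT) (S.edge _ _ _ h2)).elim
    · exact Or.inr (Or.inr (S.memL h (S.E_refl _ _)))
  · rcases B.viaV B.hs0 hu with h | h | h
    · exact Or.inl (S.memL h (S.E_refl _ _))
    · rcases B.viaV H.hb.1 hu with h' | h' | h'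
      · exact Or.inl (S.memL h' hbs)
      · exact (H.flip.nC1 (S.E_trans _ _ _ _ (S.link h h') (H.hbt _ H.ht))).elim
      · exact Or.inr (Or.inr (S.memL h' H.hb.2))
    · exact Or.inr (Or.inl (S.memL (H.W3 h) (H.hat _ H.ht)))

lemma Star.w1 (H : S.Star p q r s0 t0 a b t) {u : S.U} (h : S.mem (S.N p s0) u) :
    S.mem (S.L p t) u ∨ S.mem (S.L r t0) u ∨ S.mem (S.L q s0) u := by
  have B := H.B
  have hu : S.mem W u := S.memW_of_N B.hs0 h
  rcases B.viaV H.ha.1 hu with h' | h' | h'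
  · exact Or.inl (S.memL h' (H.hat _ H.ht))
  · rcases B.viaV H.hb.1 hu with h'' | h'' | h''
    · by_cases hE : S.E q a s0
      · exact Or.inr (Or.inr (S.memL h' hE))
      · exact (H.tri h h' h'' hE).elim
    · exact (B.case_i H.ha H.ht (H.hat _ H.ht)
        (S.E_trans _ _ _ _ (S.link h' h'') (H.hbt _ H.ht))).elim
    · exact Or.inr (Or.inl (S.memL h'' H.hb.2))
  · exact Or.inr (Or.inl (S.memL h' H.ha.2))

lemma Star.false (H : S.Star p q r s0 t0 a b t) : False := by
  have B := H.B
  refine S.cover6 B.hk3 (i1 := p) (i2 := q) (i3 := r) (i4 := r) (i5 := p) (i6 := q)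
    (w1 := s0) (w2 := s0) (w3 := s0) (w4 := t0) (w5 := t) (w6 := t) ?_
  intro u
  have n1 := ind_nonneg (S.mem (S.L p s0) u)
  have n2 := ind_nonneg (S.mem (S.L q s0) u)
  have n3 := ind_nonneg (S.mem (S.L r s0) u)
  have n4 := ind_nonneg (S.mem (S.L r t0) u)
  have n5 := ind_nonneg (S.mem (S.L p t) u)
  have n6 := ind_nonneg (S.mem (S.L q t) u)
  rcases S.side u with hu | hu
  · have g1 : S.mem (S.L p s0) u ∨ S.mem (S.L q s0) u ∨ S.mem (S.L r t0) u := by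
      rcases B.viaW B.ht0 hu with h | h | h
      · exact Or.inl (S.memL h (S.E_symm _ _ _ B.Ep))
      · exact Or.inr (Or.inl (S.memL h (S.E_symm _ _ _ B.Eq)))
      · exact Or.inr (Or.inr (S.memL h (S.E_refl _ _)))
    have g2 : S.mem (S.L p t) u ∨ S.mem (S.L q t) u ∨ S.mem (S.L r s0) u := by
      rcases B.viaW H.ht.1 hu with h | h | h
      · exact Or.inl (S.memL h (S.E_refl _ _))
      · exact Or.inr (Or.inl (S.memL h (S.E_refl _ _)))
      · exact Or.inr (Or.inr (S.memL h H.ht.2))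
    rcases g1 with h | h | h <;> rcases g2 with h' | h' | h' <;>
      have := ind_pos h <;> have := ind_pos h' <;> linarith
  · rcases B.viaV B.hs0 hu with h | h | h
    · have g := S.memL h (S.E_refl _ _)
      rcases H.w1 h with h' | h' | h' <;> have := ind_pos g <;> have := ind_pos h' <;> linarith
    · have g := S.memL h (S.E_refl _ _)
      rcases H.flip.w1 h with h' | h' | h' <;> have := ind_pos g <;> have := ind_pos h' <;> linarith
    · have g := S.memL h (S.E_refl _ _)
      have h' := S.memL (H.W3 h) (H.hat _ H.ht)
      have := ind_pos g <;> have := ind_pos h' <;> linarith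

/-- Two colours at a vertex of the `W` side give a star. -/
lemma Base.two_at (B : S.Base p q r s0 t0) {a b t : S.U} (ha : S.InS r t0 a) (hb : S.InS r t0 b)
    (ht : S.InT r s0 t) (hat : S.E p a t) (hbt : S.E q b t) : False := by
  have key : ∀ t', S.InT r s0 t' → S.E p a t' ∧ S.E q b t' := by
    intro t' ht'
    rcases B.pqE ha ht' with h1 | h1 <;> rcases B.pqE hb ht' with h2 | h2
    · exact (B.case_i hb ht (S.E_trans _ _ _ _ h2 (S.E_trans _ _ _ _ (S.E_symm _ _ _ h1) hat))
        hbt).elim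
    · exact ⟨h1, h2⟩
    · exact (B.case_ii ha hb ht ht' hat hbt h1 h2).elim
    · exact (B.case_i ha ht hat
        (S.E_trans _ _ _ _ h1 (S.E_trans _ _ _ _ (S.E_symm _ _ _ h2) hbt))).elim
  exact Star.false (S := S) ⟨B, ha, hb, ht, fun t' h => (key t' h).1, fun t' h => (key t' h).2⟩

lemma Base.two_at' (B : S.Base p q r s0 t0) {a t t' : S.U} (ha : S.InS r t0 a)
    (ht : S.InT r s0 t) (ht' : S.InT r s0 t') (hat : S.E p a t) (hat' : S.E q a t') : False :=
  Base.two_at (S := S.swap) B.swap (a := t) (b := t') (t := a) ht ht' ha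
    (S.E_symm _ _ _ hat) (S.E_symm _ _ _ hat')

lemma Base.mono (B : S.Base p q r s0 t0) {a t : S.U} (ha : S.InS r t0 a)
    (ht : S.InT r s0 t) (hat : S.E p a t) : False := by
  have h1 : ∀ u, S.mem (S.N r t0) u → S.mem (S.N p t) u := by
    intro u hu
    have hV := S.memV_of_N B.ht0 hu
    have hS : S.InS r t0 u := ⟨hV, S.E_symm _ _ _ (S.edge _ _ _ hu)⟩
    rcases B.viaW ht.1 hV with h | h | h
    · exact h
    · exact (B.two_at ha hS ht hat (S.E_symm _ _ _ (S.edge _ _ _ h))).elim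
    · exact (B.nEr (S.E_symm _ _ _ (S.E_trans _ _ _ _ (S.link hu h) ht.2))).elim
  have h2 : ∀ u, S.mem (S.N r s0) u → S.mem (S.N p a) u := by
    intro u hu
    have hW := S.memW_of_N B.hs0 hu
    have hT : S.InT r s0 u := ⟨hW, S.E_symm _ _ _ (S.edge _ _ _ hu)⟩
    rcases B.viaV ha.1 hW with h | h | h
    · exact h
    · exact (B.two_at' ha ht hT hat (S.edge _ _ _ h)).elim
    · exact (B.nEr (S.E_trans _ _ _ _ (S.link hu h) ha.2)).elim
  have := S.m_ae h1
  have := S.m_ae h2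
  have := S.d_lt ha.1 ht.1 hat
  have := S.deficit B.hs0 B.ht0 B.pq B.pr B.qr B.Ep B.Eq
  linarith

lemma Base.false (B : S.Base p q r s0 t0) : False := by
  have h0 := S.deficit B.hs0 B.ht0 B.pq B.pr B.qr B.Ep B.Eq
  have h1 := S.d_lt1 r s0
  have h2 := S.d_lt1 r t0
  obtain ⟨s, hs⟩ := S.ex_of_pos (A := S.N r t0) (by linarith)
  obtain ⟨t, ht⟩ := S.ex_of_pos (A := S.N r s0) (by linarith)
  have hS : S.InS r t0 s := ⟨S.memV_of_N B.ht0 hs, S.E_symm _ _ _ (S.edge _ _ _ hs)⟩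
  have hT : S.InT r s0 t := ⟨S.memW_of_N B.hs0 ht, S.E_symm _ _ _ (S.edge _ _ _ ht)⟩
  rcases B.pqE hS hT with h | h
  · exact B.mono hS hT h
  · exact B.flip.mono hS hT h

lemma caseA (S : Sys k V W) {s0 t0 : S.U} (hs0 : S.mem V s0) (ht0 : S.mem W t0) {p q : Fin k}
    (hpq : p ≠ q) (hp : S.E p s0 t0) (hq : S.E q s0 t0) : False := by
  rcases Nat.lt_or_ge 3 k with h4 | h3
  · exact S.caseA_four h4 hs0 ht0 hpq hp hq
  · have hk3 : k = 3 := le_antisymm h3 S.hk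
    have : ∃ r, p ≠ r ∧ q ≠ r ∧ ∀ i, i = p ∨ i = q ∨ i = r := by
      clear hp hq
      revert p q
      clear h3 ht0 hs0 t0 s0 S
      subst hk3
      decide
    obtain ⟨r, hpr, hqr, hall⟩ := this
    exact Base.false (S := S) ⟨hk3, hpq, hpr, hqr, hall, hs0, ht0, hp, hq,
      fun h => S.no_three hs0 ht0 hpq hpr hqr hp hq h⟩

end Sys
lemma finTypes_aux {X Y : Type} {k : ℕ} (cc : X → Y → Fin k)
    (hcc : ∀ x x' y y' i, cc x y = i → cc x' y = i → cc x y' = i → cc x' y' = i)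
    (I : Finset (Fin k)) : ∀ (X' : Set X) (Y' : Set Y), (∀ x ∈ X', ∀ y ∈ Y', cc x y ∈ I) →
    (Set.image (open Classical in fun y x => if x ∈ X' then some (cc x y) else none) Y').Finite := by
  classical
  induction I using Finset.strongInduction with
  | H I ih =>
    intro X' Y' hI
    rcases Y'.eq_empty_or_nonempty with rfl | ⟨y0, hy0⟩
    · simp
    let A : Fin k → Set X := fun i => {x | x ∈ X' ∧ cc x y0 = i}
    have hA : ∀ i, (Set.image (fun y x => if x ∈ A i then some (cc x y) else none) Y').Finite := by
      intro i
      by_cases hi : i ∈ I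
      · have h2 := ih (I.erase i) (Finset.erase_ssubset hi) (A i)
          {y | y ∈ Y' ∧ ∀ x ∈ A i, cc x y ≠ i} (by
            intro x hx y hy
            exact Finset.mem_erase.2 ⟨hy.2 x hx, hI x hx.1 y hy.1⟩)
        refine (h2.union (Set.finite_singleton
          (fun x => if x ∈ A i then some i else none))).subset ?_
        rintro _ ⟨y, hy, rfl⟩
        by_cases h : ∀ x ∈ A i, cc x y ≠ i
        · exact Or.inl ⟨y, ⟨hy, h⟩, by ext; simp⟩
        · push Not at h
          obtain ⟨x0, hx0, hx0y⟩ := h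
          refine Or.inr ?_
          rw [Set.mem_singleton_iff]
          funext x
          by_cases hx : x ∈ A i
          · simp only [hx, if_true]
            rw [hcc x0 x y0 y i hx0.2 hx.2 hx0y]
          · simp only [hx, if_false]
      · refine (Set.finite_singleton (fun _ => none)).subset ?_
        rintro _ ⟨y, hy, rfl⟩
        rw [Set.mem_singleton_iff]
        funext x
        have : x ∉ A i := fun h => hi (h.2 ▸ hI x h.1 y0 hy0)
        simp only [this, if_false]
    refine ((Set.Finite.pi' hA).image
      (fun (h : Fin k → X → Option (Fin k)) x => h (cc x y0) x)).subset ?_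
    rintro _ ⟨y, hy, rfl⟩
    refine ⟨fun i x => if x ∈ A i then some (cc x y) else none, ?_, ?_⟩
    · intro i
      exact ⟨y, hy, by ext; simp⟩
    · funext x
      by_cases hx : x ∈ X' <;> simp [A, hx]

lemma finTypes {X Y : Type} {k : ℕ} (cc : X → Y → Fin k)
    (hcc : ∀ x x' y y' i, cc x y = i → cc x' y = i → cc x y' = i → cc x' y' = i) :
    (Set.range fun y => fun x => cc x y).Finite := by
  classical
  have h := finTypes_aux cc hcc Finset.univ Set.univ Set.univ (by simp)
  have h2 : (Set.range fun y => fun x => some (cc x y)).Finite := by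
    refine h.subset ?_
    rintro _ ⟨y, rfl⟩
    exact ⟨y, trivial, by ext; simp⟩
  refine Set.Finite.of_finite_image (f := fun (g : X → Fin k) x => some (g x)) ?_ ?_
  · rw [← Set.range_comp]; exact h2
  · intro a _ b _ hab
    funext x
    exact Option.some_injective _ (congrFun hab x)

namespace Sys

variable {k : ℕ} {V W : Set ℕ+} (S : Sys k V W)

lemma uniq {s t : S.U} (hs : S.mem V s) (ht : S.mem W t) {i j : Fin k}
    (hi : S.E i s t) (hj : S.E j s t) : i = j := by
  by_contra h
  exact S.caseA hs ht h hi hj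

/-- Finitely many types on the `W` side. -/
lemma types : ∃ (ι : Type) (_ : Fintype ι) (τ : ι → S.U), (∀ j, S.mem W (τ j)) ∧
    ∀ t, S.mem W t → ∃ j, ∀ s, S.mem V s → ∀ i, S.E i s t ↔ S.E i s (τ j) := by
  classical
  have hex : ∀ (s : {s : S.U // S.mem V s}) (t : {t : S.U // S.mem W t}),
    ∃ i, S.E i s.1 t.1 := fun s t => S.exE s.2 t.2
  choose cc hc using hex
  have hcE : ∀ s t i, cc s t = i ↔ S.E i s.1 t.1 := fun s t i =>
    ⟨fun h => h ▸ hc s t, fun h => S.uniq s.2 t.2 (hc s t) h⟩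
  have hfin := finTypes cc (by
    intro x x' y y' i h1 h2 h3
    rw [hcE] at *
    exact S.E_trans _ _ _ _ h2 (S.E_trans _ _ _ _ (S.E_symm _ _ _ h1) h3))
  refine ⟨_, hfin.fintype, fun f => f.2.choose.1, fun f => f.2.choose.2, ?_⟩
  intro t ht
  refine ⟨⟨_, ⟨t, ht⟩, rfl⟩, ?_⟩
  intro s hs i
  have h2 := (⟨fun x => cc x ⟨t, ht⟩, ⟨t, ht⟩, rfl⟩ :
    Set.range fun y => fun x => cc x y).2.choose_spec
  have h3 := congrFun h2 ⟨s, hs⟩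
  simp only at h3
  rw [← hcE ⟨s, hs⟩ ⟨t, ht⟩, ← h3, hcE]

lemma repr {ι : Type} [Fintype ι] (τ : ι → S.U) (hτ : ∀ j, S.mem W (τ j)) :
    ∃ (Φ : Type) (_ : Fintype Φ) (α : Φ → ℝ) (σ : Φ → S.U), (∀ φ, 0 ≤ α φ) ∧
      (∀ φ, S.mem V (σ φ)) ∧ ∑ φ, α φ = S.m V ∧
      ∀ j i, S.m (S.N i (τ j)) = ∑ φ, α φ * ind (S.E i (σ φ) (τ j)) := by
  classical
  let f : ℕ+ → (ι → Fin k) := fun x j => S.col x (τ j)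
  let A : (ι → Fin k) → Set ℕ+ := fun φ => V ∩ {x | f x = φ}
  have hσ : ∀ φ, ∃ u, S.mem V u ∧ (S.m (A φ) ≠ 0 → S.mem (A φ) u) := by
    intro φ
    by_cases h : S.m (A φ) = 0
    · obtain ⟨u, hu⟩ := S.exV
      exact ⟨u, hu, fun h' => (h' h).elim⟩
    · obtain ⟨u, hu⟩ := S.ex_of_pos (lt_of_le_of_ne (S.m_nonneg (A φ)) (Ne.symm h))
      exact ⟨u, S.mem_sup _ _ u hu Set.inter_subset_left, fun _ => hu⟩
  choose σ hσV hσA using hσ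
  refine ⟨ι → Fin k, inferInstance, fun φ => S.m (A φ), σ, fun φ => S.m_nonneg _, hσV,
    (S.m_fiber f V).symm, ?_⟩
  intro j i
  rw [S.m_fiber f]
  refine Finset.sum_congr rfl fun φ _ => ?_
  change S.m (S.N i (τ j) ∩ {x | f x = φ}) = S.m (A φ) * ind (S.E i (σ φ) (τ j))
  by_cases h0 : S.m (A φ) = 0
  · rw [h0, zero_mul]
    refine le_antisymm (h0 ▸ S.m_mono ?_) (S.m_nonneg _)
    rw [S.NW i _ (hτ j)]
    rintro x ⟨⟨h1, _⟩, h2⟩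
    exact ⟨h1, h2⟩
  have hE : S.E (φ j) (σ φ) (τ j) := by
    refine S.E_symm _ _ _ (S.edge _ _ _ (S.mem_sup _ _ _ (hσA φ h0) ?_))
    rw [S.NW _ _ (hτ j)]
    rintro x ⟨h1, h2⟩
    exact ⟨h1, congrFun h2 j⟩
  by_cases hi : φ j = i
  · rw [← hi, ind_pos hE, mul_one]
    congr 1
    rw [S.NW _ _ (hτ j)]
    ext x
    constructor
    · rintro ⟨⟨h1, _⟩, h2⟩
      exact ⟨h1, h2⟩
    · rintro ⟨h1, h2⟩
      exact ⟨⟨h1, congrFun h2 j⟩, h2⟩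
  · rw [ind_neg fun h => hi (S.uniq (hσV φ) (hτ j) hE h), mul_zero]
    convert S.m_empty
    rw [Set.eq_empty_iff_forall_notMem, S.NW _ _ (hτ j)]
    rintro x ⟨⟨_, h1⟩, h2⟩
    exact hi ((congrFun h2 j).symm.trans h1)

lemma mW_pos : 0 < S.m W := by
  by_contra h
  have h0 : S.m W = 0 := le_antisymm (not_lt.1 h) (S.m_nonneg W)
  obtain ⟨t, ht⟩ := S.exW
  have h1 := S.sumW ht
  have h2 := S.mVW
  have : Nonempty (Fin k) := ⟨⟨0, by have := S.hk; omega⟩⟩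
  have h3 : ∑ i, S.m (S.N i t) < ∑ _i : Fin k, S.δ :=
    Finset.sum_lt_sum_of_nonempty Finset.univ_nonempty fun i _ => S.d_lt1 i t
  rw [Finset.sum_const, Finset.card_univ, Fintype.card_fin, nsmul_eq_mul] at h3
  have := S.hδ
  have := S.δ_pos
  have h4 : (3 : ℝ) ≤ k := by exact_mod_cast S.hk
  nlinarith

lemma mV_pos : 0 < S.m V := S.swap.mW_pos

lemma sq_bound {k : ℕ} (hk : 3 ≤ k) (d : Fin k → ℝ) : (∑ i, d i) ^ 2 / k ≤ ∑ i, d i * d i := by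
  have := sq_sum_le_card_mul_sum_sq (s := Finset.univ) (f := d)
  have hk' : (0 : ℝ) < k := by exact_mod_cast (by omega : 0 < k)
  rw [div_le_iff₀ hk']
  simp only [Finset.card_univ, Fintype.card_fin, pow_two] at this ⊢
  linarith

lemma ex_pos {Φ : Type} [Fintype Φ] (α : Φ → ℝ) (h : 0 < ∑ φ, α φ) : ∃ φ, 0 < α φ := by
  by_contra h'
  push Not at h'
  exact absurd (Finset.sum_nonpos fun i _ => h' i) (not_le.2 h)

theorem contra (S : Sys k V W) : False := by
  classical
  obtain ⟨ι, _, τ, hτ, hty⟩ := S.types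
  obtain ⟨Φ, _, α, σ, hα, hσ, hαs, hαr⟩ := S.repr τ hτ
  obtain ⟨Ψ, _, β, ρ, hβ, hρ, hβs, hβr⟩ := S.swap.repr σ hσ
  have hj : ∀ ψ, ∃ j, ∀ s, S.mem V s → ∀ i, S.E i s (ρ ψ) ↔ S.E i s (τ j) :=
    fun ψ => hty (ρ ψ) (hρ ψ)
  choose J hJ using hj
  let e : Fin k → Φ → Ψ → ℝ := fun i φ ψ => ind (S.E i (σ φ) (τ (J ψ)))
  let C : Fin k → Φ → ℝ := fun i φ => S.m (S.N i (σ φ))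
  let D : Fin k → Ψ → ℝ := fun i ψ => S.m (S.N i (τ (J ψ)))
  have hD : ∀ i ψ, D i ψ = ∑ φ, α φ * e i φ ψ := fun i ψ => hαr (J ψ) i
  have hC : ∀ i φ, C i φ = ∑ ψ, β ψ * e i φ ψ := by
    intro i φ
    refine (hβr φ i).trans (Finset.sum_congr rfl fun ψ _ => ?_)
    have : S.swap.E i (ρ ψ) (σ φ) = S.E i (σ φ) (τ (J ψ)) := by
      rw [← hJ ψ (σ φ) (hσ φ) i]
      exact propext ⟨S.E_symm _ _ _, S.E_symm _ _ _⟩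
    rw [this]
  have hbound : ∀ φ ψ, ∑ i, e i φ ψ * (C i φ + D i ψ) < S.δ := by
    intro φ ψ
    obtain ⟨i0, hi0⟩ := S.exE (hσ φ) (hτ (J ψ))
    rw [Finset.sum_eq_single i0]
    · simp only [e, ind_pos hi0, one_mul]
      exact S.d_lt (hσ φ) (hτ (J ψ)) hi0
    · intro b _ hb
      simp only [e]
      rw [ind_neg fun h => hb (S.uniq (hσ φ) (hτ (J ψ)) h hi0), zero_mul]
    · simp
  have hup : ∑ φ, ∑ ψ, α φ * β ψ * ∑ i, e i φ ψ * (C i φ + D i ψ) <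
      ∑ φ, ∑ ψ, α φ * β ψ * S.δ := by
    obtain ⟨φ0, hφ0⟩ := ex_pos α (hαs ▸ S.mV_pos)
    obtain ⟨ψ0, hψ0⟩ := ex_pos β (hβs ▸ S.mW_pos)
    have hle : ∀ φ ψ, α φ * β ψ * ∑ i, e i φ ψ * (C i φ + D i ψ) ≤ α φ * β ψ * S.δ :=
      fun φ ψ => mul_le_mul_of_nonneg_left (hbound φ ψ).le (mul_nonneg (hα φ) (hβ ψ))
    refine Finset.sum_lt_sum (fun φ _ => Finset.sum_le_sum fun ψ _ => hle φ ψ)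
      ⟨φ0, Finset.mem_univ _, Finset.sum_lt_sum (fun ψ _ => hle φ0 ψ) ⟨ψ0, Finset.mem_univ _, ?_⟩⟩
    exact mul_lt_mul_of_pos_left (hbound φ0 ψ0) (mul_pos hφ0 hψ0)
  have hR : ∑ φ, ∑ ψ, α φ * β ψ * S.δ = S.m V * S.m W * S.δ := by
    rw [← hαs, show S.m W = ∑ ψ, β ψ from hβs.symm, Finset.sum_mul_sum, Finset.sum_mul]
    refine Finset.sum_congr rfl fun φ _ => ?_
    rw [Finset.sum_mul]
  have hL : ∑ φ, ∑ ψ, α φ * β ψ * ∑ i, e i φ ψ * (C i φ + D i ψ) =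
      ∑ φ, α φ * ∑ i, C i φ * C i φ + ∑ ψ, β ψ * ∑ i, D i ψ * D i ψ := by
    have e1 : ∑ φ, α φ * ∑ i, C i φ * C i φ =
        ∑ φ, ∑ ψ, α φ * β ψ * ∑ i, e i φ ψ * C i φ := by
      refine Finset.sum_congr rfl fun φ _ => ?_
      have : ∀ i, C i φ * C i φ = ∑ ψ, β ψ * (e i φ ψ * C i φ) := by
        intro i
        nth_rewrite 1 [hC i φ]
        rw [Finset.sum_mul]
        exact Finset.sum_congr rfl fun ψ _ => by ring
      simp only [this]
      rw [Finset.sum_comm, Finset.mul_sum]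
      refine Finset.sum_congr rfl fun ψ _ => ?_
      rw [← Finset.mul_sum]; ring
    have e2 : ∑ ψ, β ψ * ∑ i, D i ψ * D i ψ =
        ∑ φ, ∑ ψ, α φ * β ψ * ∑ i, e i φ ψ * D i ψ := by
      rw [Finset.sum_comm]
      refine Finset.sum_congr rfl fun ψ _ => ?_
      have : ∀ i, D i ψ * D i ψ = ∑ φ, α φ * (e i φ ψ * D i ψ) := by
        intro i
        nth_rewrite 1 [hD i ψ]
        rw [Finset.sum_mul]
        exact Finset.sum_congr rfl fun φ _ => by ring
      simp only [this]
      rw [Finset.sum_comm, Finset.mul_sum]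
      refine Finset.sum_congr rfl fun φ _ => ?_
      rw [← Finset.mul_sum]; ring
    rw [e1, e2, ← Finset.sum_add_distrib]
    refine Finset.sum_congr rfl fun φ _ => ?_
    rw [← Finset.sum_add_distrib]
    refine Finset.sum_congr rfl fun ψ _ => ?_
    rw [← mul_add, ← Finset.sum_add_distrib]
    simp only [mul_add]
  have l1 : S.m V * (S.m W ^ 2 / k) ≤ ∑ φ, α φ * ∑ i, C i φ * C i φ := by
    rw [← hαs, Finset.sum_mul]
    refine Finset.sum_le_sum fun φ _ => mul_le_mul_of_nonneg_left ?_ (hα φ)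
    have := sq_bound S.hk fun i => C i φ
    rwa [S.sumV (hσ φ)] at this
  have l2 : S.m W * (S.m V ^ 2 / k) ≤ ∑ ψ, β ψ * ∑ i, D i ψ * D i ψ := by
    rw [show S.m W = ∑ ψ, β ψ from hβs.symm, Finset.sum_mul]
    refine Finset.sum_le_sum fun ψ _ => mul_le_mul_of_nonneg_left ?_ (hβ ψ)
    have := sq_bound S.hk fun i => D i ψ
    rwa [S.sumW (hτ (J ψ))] at this
  have h4 : (3 : ℝ) ≤ k := by exact_mod_cast S.hk
  have hk0 : (0 : ℝ) < k := by linarith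
  have l3 : S.m V * (S.m W ^ 2 / k) + S.m W * (S.m V ^ 2 / k) = S.m V * S.m W * (1 / k) := by
    have h : S.m V * (S.m W ^ 2 / k) + S.m W * (S.m V ^ 2 / k) =
        S.m V * S.m W * ((S.m V + S.m W) / k) := by ring
    rw [h, S.mVW]
  have hpos := mul_pos S.mV_pos S.mW_pos
  have l4 : S.m V * S.m W * (1 / k) < S.m V * S.m W * S.δ := by linarith
  have l5 := lt_of_mul_lt_mul_left l4 hpos.le
  rw [div_lt_iff₀ hk0] at l5
  have := S.hδ
  have := S.δ_pos
  nlinarith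

end Sys
/-- Counting ratio. -/
noncomputable def rat (A : Set ℕ+) (n : ℕ) : ℝ :=
  (Nat.card {a : ℕ+ // a ∈ A ∧ (a : ℕ) ≤ n} : ℝ) / n

lemma rat_eq (A : Set ℕ+) (n : ℕ) : rat A n = (Set.ncard {a : ℕ+ | a ∈ A ∧ (a : ℕ) ≤ n} : ℝ) / n := rfl

lemma fin_le (A : Set ℕ+) (n : ℕ) : {a : ℕ+ | a ∈ A ∧ (a : ℕ) ≤ n}.Finite := by
  refine Set.Finite.of_finite_image (f := fun a : ℕ+ => (a : ℕ)) ?_ PNat.coe_injective.injOn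
  refine (Set.finite_Icc 1 n).subset ?_
  rintro _ ⟨a, ha, rfl⟩
  exact ⟨a.2, ha.2⟩

lemma rat_nonneg (A : Set ℕ+) (n : ℕ) : 0 ≤ rat A n := by unfold rat; positivity

lemma ncard_univ_le (n : ℕ) : Set.ncard {a : ℕ+ | a ∈ (Set.univ : Set ℕ+) ∧ (a : ℕ) ≤ n} = n := by
  rw [← Set.ncard_image_of_injective _ PNat.coe_injective]
  have : (Set.image (fun a : ℕ+ => (a : ℕ)) {a : ℕ+ | a ∈ (Set.univ : Set ℕ+) ∧ (a : ℕ) ≤ n}) =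
      (Finset.Icc 1 n : Finset ℕ) := by
    ext x
    simp only [Set.mem_image, Finset.coe_Icc, Set.mem_Icc]
    constructor
    · rintro ⟨a, ha, rfl⟩
      exact ⟨a.2, ha.2⟩
    · rintro ⟨h1, h2⟩
      exact ⟨⟨x, h1⟩, ⟨trivial, h2⟩, rfl⟩
  rw [this, Set.ncard_coe_finset]; simp

lemma rat_le_one (A : Set ℕ+) (n : ℕ) : rat A n ≤ 1 := by
  rw [rat_eq]
  refine div_le_one_of_le₀ ?_ (by positivity)
  have := Set.ncard_le_ncard (s := {a : ℕ+ | a ∈ A ∧ (a : ℕ) ≤ n})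
    (t := {a : ℕ+ | a ∈ (Set.univ : Set ℕ+) ∧ (a : ℕ) ≤ n}) (fun a ha => ⟨trivial, ha.2⟩) (fin_le _ _)
  rw [ncard_univ_le] at this
  exact_mod_cast this

lemma rat_add (A B : Set ℕ+) (h : Disjoint A B) (n : ℕ) : rat (A ∪ B) n = rat A n + rat B n := by
  simp only [rat_eq]
  rw [← add_div]
  congr 1
  rw [← Nat.cast_add, ← Set.ncard_union_eq _ (fin_le A n) (fin_le B n)]
  · congr 2
    ext x
    simp only [Set.mem_union, Set.mem_setOf_eq]
    tauto
  · rw [Set.disjoint_left] at h ⊢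
    exact fun x hx hx' => h hx.1 hx'.1

lemma exMean : ∃ m : Set ℕ+ → ℝ, (∀ A, 0 ≤ m A) ∧
    (∀ A B, Disjoint A B → m (A ∪ B) = m A + m B) ∧ (∀ A : Set ℕ+, A.Finite → m A = 0) ∧
    m Set.univ = 1 ∧ ∀ A, m A ≤ upperDensity A := by
  have hle : (hyperfilter ℕ : Filter ℕ) ≤ atTop := by
    rw [← Nat.cofinite_eq_atTop]; exact hyperfilter_le_cofinite
  have hex : ∀ A, ∃ x : ℝ, 0 ≤ x ∧ Tendsto (rat A) (hyperfilter ℕ : Filter ℕ) (nhds x) := by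
    intro A
    obtain ⟨x, hx, hlim⟩ := (isCompact_Icc (a := (0 : ℝ)) (b := 1)).ultrafilter_le_nhds
      ((hyperfilter ℕ).map (rat A)) (by
        rw [le_principal_iff, Ultrafilter.coe_map, Filter.mem_map]
        exact Filter.univ_mem' fun n => ⟨rat_nonneg A n, rat_le_one A n⟩)
    exact ⟨x, hx.1, hlim⟩
  choose m hm0 hm using hex
  refine ⟨m, hm0, ?_, ?_, ?_, ?_⟩
  · intro A B h
    refine tendsto_nhds_unique (hm _) ?_
    exact ((hm A).add (hm B)).congr fun n => (rat_add A B h n).symm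
  · intro A hA
    refine tendsto_nhds_unique (hm A) (Tendsto.mono_left ?_ hle)
    refine squeeze_zero (rat_nonneg A) (g := fun n : ℕ => (A.ncard : ℝ) / n) ?_ ?_
    · intro n
      rw [rat_eq]
      gcongr
      exact fun a (ha : a ∈ A ∧ (a : ℕ) ≤ n) => ha.1
    · exact tendsto_const_div_atTop_nhds_zero_nat _
  · refine tendsto_nhds_unique (hm _) (Tendsto.mono_left ?_ hle)
    refine tendsto_const_nhds.congr' ?_
    filter_upwards [eventually_ge_atTop 1] with n hn
    rw [rat_eq, ncard_univ_le, div_self]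
    exact_mod_cast (by omega : n ≠ 0)
  · intro A
    refine le_of_forall_lt fun a ha => ?_
    obtain ⟨b, hab, hb⟩ := exists_between ha
    refine lt_of_lt_of_le hab ?_
    refine le_limsup_of_frequently_le ?_ ?_
    · have h1 : ∀ᶠ n in (hyperfilter ℕ : Filter ℕ), b < rat A n := (hm A).eventually_const_lt hb
      exact (h1.frequently.filter_mono hle).mono fun n hn => hn.le
    · exact ⟨1, by
        rw [eventually_map]
        exact Eventually.of_forall fun n => rat_le_one A n⟩
/-- Delete the vertices in `F`. -/
def delG (G : SimpleGraph ℕ+) (F : Set ℕ+) : SimpleGraph ℕ+ where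
  Adj x y := x ∉ F ∧ y ∉ F ∧ G.Adj x y
  symm := ⟨fun _ _ h => ⟨h.2.1, h.1, h.2.2.symm⟩⟩
  loopless := ⟨fun _ h => G.loopless.irrefl _ h.2.2⟩

lemma support_avoid {G : SimpleGraph ℕ+} {F : Set ℕ+} {a b : ℕ+} (p : (delG G F).Walk a b)
    (ha : a ∉ F) : ∀ x ∈ p.support, x ∉ F := by
  induction p with
  | nil => simpa using ha
  | cons h p ih =>
    intro x hx
    rw [SimpleGraph.Walk.support_cons, List.mem_cons] at hx
    rcases hx with rfl | hx
    · exact ha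
    · exact ih h.2.1 x hx

/-- `L` stays connected after deleting finitely many vertices. -/
def Robust (G : SimpleGraph ℕ+) (L : Set ℕ+) : Prop :=
  ∀ F : Set ℕ+, F.Finite → ∀ x ∈ L, x ∉ F → ∀ y ∈ L, y ∉ F → (delG G F).Reachable x y

/-- Finite path ending in `L`. -/
structure Good (G : SimpleGraph ℕ+) (L : Set ℕ+) (K : List ℕ+) : Prop where
  ne : K ≠ []
  nd : K.Nodup
  ch : K.IsChain G.Adj
  last : ∀ a ∈ K.getLast?, a ∈ L

lemma good_step0 {G : SimpleGraph ℕ+} {L : Set ℕ+} (hR : Robust G L) {K : List ℕ+}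
    (hK : Good G L K) {z : ℕ+} (hz : z ∈ L) (hzK : z ∉ K) :
    ∃ K2, Good G L K2 ∧ K <+: K2 ∧ z ∈ K2 ∧ K.length < K2.length := by
  classical
  obtain ⟨hne, hnd, hch, hlast⟩ := hK
  set a := K.getLast hne with ha
  have hgl : K.getLast? = some a := List.getLast?_eq_some_getLast hne
  have haK : a ∈ K := List.getLast_mem hne
  have haL : a ∈ L := hlast a (by rw [hgl]; rfl)
  have hza : a ≠ z := fun h => hzK (h ▸ haK)
  let F : Set ℕ+ := {x | x ∈ K ∧ x ≠ a}
  have hF : F.Finite := K.finite_toSet.subset fun x hx => hx.1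
  have haF : a ∉ F := fun h => h.2 rfl
  obtain ⟨p, hp⟩ := (hR F hF a haL haF z hz (fun h => hzK h.1)).exists_isPath
  have hav := support_avoid p haF
  have hsup := p.cons_tail_support.symm
  set T := p.support.tail with hT
  have hchS : List.IsChain G.Adj (a :: T) := by
    rw [← hsup]
    exact p.isChain_adj_support.imp fun x y h => h.2.2
  have hndS : (a :: T).Nodup := by rw [← hsup]; exact hp.support_nodup
  have hzT : z ∈ T := p.end_mem_tail_support_of_ne hza
  have hTne : T ≠ [] := List.ne_nil_of_mem hzT
  have hTl : T.getLast? = some z := by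
    have h1 : (a :: T).getLast? = some z := by
      rw [← hsup, List.getLast?_eq_some_getLast p.support_ne_nil, p.getLast_support]
    rwa [List.getLast?_cons, List.getLast?_eq_some_getLast hTne, Option.getD_some,
      ← List.getLast?_eq_some_getLast hTne] at h1
  rw [List.isChain_cons] at hchS
  rw [List.nodup_cons] at hndS
  refine ⟨K ++ T, ⟨by simp [hne], ?_, ?_, ?_⟩, List.prefix_append _ _,
    List.mem_append_right _ hzT, ?_⟩
  · rw [List.nodup_append]
    refine ⟨hnd, hndS.2, ?_⟩
    rintro x hx y hy rfl
    have hxa : x ≠ a := fun h => hndS.1 (h ▸ hy)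
    exact hav x (by rw [hsup]; exact List.mem_cons_of_mem _ hy) ⟨hx, hxa⟩
  · rw [List.isChain_append]
    refine ⟨hch, hchS.2, ?_⟩
    intro x hx y hy
    rw [hgl] at hx
    cases hx
    exact hchS.1 y hy
  · intro b hb
    rw [List.getLast?_append, hTl] at hb
    cases hb
    exact hz
  · rw [List.length_append]
    have := List.length_pos_of_ne_nil hTne
    omega

lemma good_step {G : SimpleGraph ℕ+} {L : Set ℕ+} (hR : Robust G L) (hL : L.Infinite)
    (K : List ℕ+) (hK : Good G L K) (z : ℕ+) :
    ∃ K2, Good G L K2 ∧ K <+: K2 ∧ (z ∈ L → z ∈ K2) ∧ K.length < K2.length := by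
  by_cases hz : z ∈ L ∧ z ∉ K
  · obtain ⟨K2, h1, h2, h3, h4⟩ := good_step0 hR hK hz.1 hz.2
    exact ⟨K2, h1, h2, fun _ => h3, h4⟩
  · obtain ⟨y, hy, hyK⟩ := hL.exists_notMem_finite K.finite_toSet
    obtain ⟨K2, h1, h2, h3, h4⟩ := good_step0 hR hK hy hyK
    refine ⟨K2, h1, h2, fun hzL => ?_, h4⟩
    have : z ∈ K := by tauto
    exact h2.subset this

lemma exists_path {G : SimpleGraph ℕ+} {L : Set ℕ+} (hR : Robust G L) (hL : L.Infinite) :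
    ∃ f : ℕ → ℕ+, Function.Injective f ∧ (∀ j, G.Adj (f j) (f (j + 1))) ∧ L ⊆ Set.range f := by
  classical
  obtain ⟨a0, ha0⟩ := hL.nonempty
  choose! nx hx1 hx2 hx3 hx4 using good_step hR hL
  let K : ℕ → List ℕ+ := fun n => Nat.rec [a0] (fun n l => nx l n.succPNat) n
  have hKs : ∀ n, K (n + 1) = nx (K n) n.succPNat := fun n => rfl
  have hg : ∀ n, Good G L (K n) := by
    intro n
    induction n with
    | zero =>
      refine ⟨by simp [K], by simp [K], by simp [K], ?_⟩
      intro a ha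
      have h : some a0 = some a := ha
      cases h
      exact ha0
    | succ n ih => rw [hKs]; exact hx1 _ ih _
  have hlen : ∀ n, n < (K n).length := by
    intro n
    induction n with
    | zero => simp [K]
    | succ n ih =>
      have := hx4 _ (hg n) n.succPNat
      rw [hKs]; omega
  have hpre : ∀ n m, n ≤ m → K n <+: K m := by
    intro n m h
    induction m, h using Nat.le_induction with
    | base => exact List.prefix_rfl
    | succ m _ ih => rw [hKs]; exact ih.trans (hx2 _ (hg m) _)
  let f : ℕ → ℕ+ := fun n => (K n)[n]'(hlen n)
  have hf : ∀ n m (h : n ≤ m), f n = (K m)[n]'(lt_of_le_of_lt h (hlen m)) := by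
    intro n m h
    exact (hpre n m h).getElem (hlen n)
  refine ⟨f, ?_, ?_, ?_⟩
  · intro n m h
    rw [hf n (max n m) (le_max_left _ _), hf m (max n m) (le_max_right _ _)] at h
    exact ((hg (max n m)).nd.getElem_inj_iff).1 h
  · intro j
    rw [hf j (j + 1) (Nat.le_succ j)]
    exact List.isChain_iff_getElem.1 (hg (j + 1)).ch j (hlen (j + 1))
  · intro z hz
    obtain ⟨n, hn⟩ : ∃ n : ℕ, n.succPNat = z := ⟨z.natPred, PNat.succPNat_natPred z⟩
    have hzK : z ∈ K (n + 1) := by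
      rw [hKs, hn]; exact hx3 _ (hg n) z hz
    obtain ⟨j, hj, hjz⟩ := List.getElem_of_mem hzK
    refine ⟨j, ?_⟩
    rw [hf j (max j (n + 1)) (le_max_left _ _), ← hjz]
    exact ((hpre (n + 1) (max j (n + 1)) (le_max_right _ _)).getElem hj).symm

/-- Vertices joined to most vertices along `u`. -/
def nb (G : SimpleGraph ℕ+) (u : Ultrafilter ℕ+) : Set ℕ+ := {x | {y | G.Adj x y} ∈ u}

/-- Two ultrafilters lie in the same component after any finite deletion. -/
def EqU (G : SimpleGraph ℕ+) (u v : Ultrafilter ℕ+) : Prop :=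
  u = v ∨ ∀ F : Set ℕ+, F.Finite → ∃ x0, {y | (delG G F).Reachable x0 y} ∈ u ∧
    {y | (delG G F).Reachable x0 y} ∈ v

/-- Nonprincipal ultrafilters. -/
abbrev NP : Type := {u : Ultrafilter ℕ+ // ∀ F : Set ℕ+, F.Finite → Fᶜ ∈ u}

lemma EqU.symm {G : SimpleGraph ℕ+} {u u' : Ultrafilter ℕ+} (h : EqU G u u') : EqU G u' u := by
  rcases h with h | h
  · exact Or.inl h.symm
  · refine Or.inr fun F hF => ?_
    obtain ⟨x, h1, h2⟩ := h F hF
    exact ⟨x, h2, h1⟩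

lemma EqU.trans {G : SimpleGraph ℕ+} {u u' u'' : Ultrafilter ℕ+} (h : EqU G u u')
    (h' : EqU G u' u'') : EqU G u u'' := by
  rcases h with rfl | h
  · exact h'
  rcases h' with rfl | h'
  · exact Or.inr h
  refine Or.inr fun F hF => ?_
  obtain ⟨x, h1, h2⟩ := h F hF
  obtain ⟨x', h3, h4⟩ := h' F hF
  obtain ⟨y, hy, hy'⟩ := Ultrafilter.nonempty_of_mem (inter_mem h2 h3)
  refine ⟨x, h1, mem_of_superset h4 fun z hz => ?_⟩
  exact SimpleGraph.Reachable.trans hy (SimpleGraph.Reachable.trans (SimpleGraph.Reachable.symm hy') hz)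

lemma EqU.reach {G : SimpleGraph ℕ+} {u u' : NP} (h : EqU G u.1 u'.1) {F : Set ℕ+}
    (hF : F.Finite) {x y : ℕ+} (hx : x ∈ nb G u.1) (hxF : x ∉ F) (hy : y ∈ nb G u'.1)
    (hyF : y ∉ F) : (delG G F).Reachable x y := by
  have adj : ∀ {x z : ℕ+}, x ∉ F → z ∈ Fᶜ → G.Adj x z → (delG G F).Reachable x z :=
    fun h1 h2 h3 => SimpleGraph.Adj.reachable (show (delG G F).Adj _ _ from ⟨h1, h2, h3⟩)
  rcases h with h | h
  · rw [← h] at hy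
    obtain ⟨z, ⟨h1, h2⟩, h3⟩ := Ultrafilter.nonempty_of_mem
      (inter_mem (inter_mem hx hy) (u.2 F hF))
    exact (adj hxF h3 h1).trans (adj hyF h3 h2).symm
  · obtain ⟨x0, h1, h2⟩ := h F hF
    obtain ⟨z, ⟨g1, g2⟩, g3⟩ := Ultrafilter.nonempty_of_mem (inter_mem (inter_mem hx h1) (u.2 F hF))
    obtain ⟨z', ⟨g1', g2'⟩, g3'⟩ := Ultrafilter.nonempty_of_mem
      (inter_mem (inter_mem hy h2) (u'.2 F hF))
    exact (adj hxF g3 g1).trans ((SimpleGraph.Reachable.symm g2).trans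
      (SimpleGraph.Reachable.trans g2' (adj hyF g3' g1').symm))

lemma EqU.edge {G : SimpleGraph ℕ+} {u u' : NP} (h : nb G u.1 ∈ u'.1) : EqU G u.1 u'.1 := by
  refine Or.inr fun F hF => ?_
  have h1 := inter_mem h (u'.2 F hF)
  obtain ⟨x, hx, hxF⟩ := Ultrafilter.nonempty_of_mem h1
  refine ⟨x, ?_, ?_⟩
  · refine mem_of_superset (inter_mem hx (u.2 F hF)) ?_
    rintro y ⟨hy, hyF⟩
    exact SimpleGraph.Adj.reachable (show (delG G F).Adj _ _ from ⟨hxF, hyF, hy⟩)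
  · refine mem_of_superset h1 ?_
    rintro y ⟨hy, hyF⟩
    exact EqU.reach (Or.inl rfl : EqU G u.1 u.1) hF hx hxF hy hyF

/-- The linked set of `u`. -/
def Lk (G : SimpleGraph ℕ+) (u : NP) : Set ℕ+ := {x | ∃ u' : NP, EqU G u'.1 u.1 ∧ x ∈ nb G u'.1}

lemma Lk_robust (G : SimpleGraph ℕ+) (u : NP) : Robust G (Lk G u) := by
  rintro F hF x ⟨v, hv, hx⟩ hxF y ⟨w, hw, hy⟩ hyF
  exact (hv.trans hw.symm).reach hF hx hxF hy hyF

/-- The graph of colour `i`. -/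
def colG {k : ℕ} (V W : Set ℕ+) (hd : Disjoint V W) (c : Sym2 ℕ+ → Fin k) (i : Fin k) :
    SimpleGraph ℕ+ where
  Adj x y := bipAdj V W x y ∧ c s(x, y) = i
  symm := ⟨fun x y h => ⟨Or.symm (by unfold bipAdj at h; tauto), by rw [Sym2.eq_swap]; exact h.2⟩⟩
  loopless := ⟨fun x h => by
    rcases h.1 with h | h
    · exact Set.disjoint_left.1 hd h.1 h.2
    · exact Set.disjoint_left.1 hd h.2 h.1⟩

lemma exNP {A : Set ℕ+} (hA : A.Infinite) : ∃ u : NP, A ∈ u.1 := by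
  have : (cofinite ⊓ 𝓟 A).NeBot := by
    rw [inf_principal_neBot_iff]
    intro s hs
    by_contra h
    rw [Set.not_nonempty_iff_eq_empty] at h
    refine hA (Set.Finite.subset (mem_cofinite.1 hs) fun x hx hxs => ?_)
    exact (h ▸ (⟨hxs, hx⟩ : x ∈ s ∩ A) : x ∈ (∅ : Set ℕ+))
  let u := Ultrafilter.of (cofinite ⊓ 𝓟 A)
  have hu : (u : Filter ℕ+) ≤ cofinite ⊓ 𝓟 A := Ultrafilter.of_le _
  refine ⟨⟨u, fun F hF => hu (mem_inf_of_left hF.compl_mem_cofinite)⟩, ?_⟩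
  exact hu (mem_inf_of_right (mem_principal_self A))

lemma exCol {k : ℕ} (u : Ultrafilter ℕ+) (g : ℕ+ → Fin k) : ∃ i, {y | g y = i} ∈ u := by
  have h : (⋃ i ∈ (Set.univ : Set (Fin k)), {y | g y = i}) ∈ u := by
    refine mem_of_superset univ_mem fun y _ => ?_
    simp
  rw [Ultrafilter.finite_biUnion_mem_iff Set.finite_univ] at h
  obtain ⟨i, _, hi⟩ := h
  exact ⟨i, hi⟩
/-- Limit colour. -/
noncomputable def limCol {k : ℕ} (c : Sym2 ℕ+ → Fin k) (x : ℕ+) (u : NP) : Fin k :=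
  (exCol u.1 fun y => c s(x, y)).choose

lemma limCol_spec {k : ℕ} (c : Sym2 ℕ+ → Fin k) (x : ℕ+) (u : NP) :
    {y | c s(x, y) = limCol c x u} ∈ u.1 := (exCol u.1 fun y => c s(x, y)).choose_spec

lemma nb_col {k : ℕ} {V W : Set ℕ+} (hd : Disjoint V W) (c : Sym2 ℕ+ → Fin k) (i : Fin k) (t : NP)
    (ht : V ∈ t.1) : nb (colG V W hd c i) t.1 = {x | x ∈ W ∧ limCol c x t = i} := by
  ext x
  constructor
  · intro hx
    have hx' : {y | (colG V W hd c i).Adj x y} ∈ t.1 := hx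
    obtain ⟨y, ⟨h1, h2⟩, h3⟩ := Ultrafilter.nonempty_of_mem
      (inter_mem (inter_mem hx' ht) (limCol_spec c x t))
    have h1' : bipAdj V W x y ∧ c s(x, y) = i := h1
    have h3' : c s(x, y) = limCol c x t := h3
    refine ⟨?_, h3'.symm.trans h1'.2⟩
    rcases h1'.1 with h | h
    · exact (Set.disjoint_left.1 hd h2 h.2).elim
    · exact h.1
  · rintro ⟨hx, hi⟩
    have : {y | (colG V W hd c i).Adj x y} ∈ t.1 := by
      refine mem_of_superset (inter_mem ht (limCol_spec c x t)) ?_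
      rintro y ⟨hy, hc⟩
      exact ⟨Or.inr ⟨hx, hy⟩, hi ▸ hc⟩
    exact this

lemma colG_swap {k : ℕ} {V W : Set ℕ+} (hd : Disjoint V W) (c : Sym2 ℕ+ → Fin k) (i : Fin k) :
    colG V W hd c i = colG W V hd.symm c i := by
  ext x y
  change bipAdj V W x y ∧ _ ↔ bipAdj W V x y ∧ _
  unfold bipAdj
  tauto

lemma nb_col' {k : ℕ} {V W : Set ℕ+} (hd : Disjoint V W) (c : Sym2 ℕ+ → Fin k) (i : Fin k) (t : NP)
    (ht : W ∈ t.1) : nb (colG V W hd c i) t.1 = {x | x ∈ V ∧ limCol c x t = i} := by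
  rw [colG_swap]; exact nb_col hd.symm c i t ht

lemma split_col {k : ℕ} {V W : Set ℕ+} (hd : Disjoint V W) (c : Sym2 ℕ+ → Fin k) (t u : NP)
    (ht : V ∈ t.1) (hu : W ∈ u.1) : ∃ i, nb (colG V W hd c i) t.1 ∈ u.1 := by
  obtain ⟨i, hi⟩ := exCol u.1 fun x => limCol c x t
  refine ⟨i, ?_⟩
  rw [nb_col hd c i t ht]
  exact inter_mem hu hi

lemma split_col' {k : ℕ} {V W : Set ℕ+} (hd : Disjoint V W) (c : Sym2 ℕ+ → Fin k) (t u : NP)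
    (ht : W ∈ t.1) (hu : V ∈ u.1) : ∃ i, nb (colG V W hd c i) t.1 ∈ u.1 := by
  obtain ⟨i, hi⟩ := split_col hd.symm c t u ht hu
  exact ⟨i, by rw [colG_swap]; exact hi⟩

/-- In any `k`-edge-colouring of `K_{V,W}` with `k ≥ 3`, for every `ε > 0`
there is a monochromatic path of upper density at least `1/(2k-3) - ε`. -/
theorem stmt_5 (k : ℕ) (hk : 3 ≤ k) (V W : Set ℕ+) (hV : V.Infinite)
    (hW : W.Infinite) (hdisj : Disjoint V W) (hunion : V ∪ W = Set.univ)
    (c : Sym2 ℕ+ → Fin k) (ε : ℝ) (hε : 0 < ε) :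
    ∃ (i : Fin k) (P : Set ℕ+),
      IsMonoPath (bipAdj V W) c i P ∧ 1 / (2 * (k : ℝ) - 3) - ε ≤ upperDensity P := by
  by_contra hcon
  push Not at hcon
  obtain ⟨m, m0, madd, mfin, muniv, mle⟩ := exMean
  have hk' : (3 : ℝ) ≤ k := by exact_mod_cast hk
  have hpos : (0 : ℝ) < 2 * (k : ℝ) - 3 := by linarith
  have hmono : ∀ A B, A ⊆ B → m A ≤ m B := by
    intro A B h
    have h1 := madd A (B \ A) Set.disjoint_sdiff_right
    rw [Set.union_diff_cancel h] at h1
    have := m0 (B \ A)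
    linarith
  have hL : ∀ i u, m (Lk (colG V W hdisj c i) u) < 1 / (2 * (k : ℝ) - 3) := by
    intro i u
    by_cases hfin : (Lk (colG V W hdisj c i) u).Finite
    · rw [mfin _ hfin]; positivity
    · obtain ⟨f, hf1, hf2, hf3⟩ := exists_path (Lk_robust (colG V W hdisj c i) u) hfin
      have h1 := hcon i (Set.range f) (Or.inr ⟨f, hf1, hf2, rfl⟩)
      have h2 := hmono _ _ hf3
      have h3 := mle (Set.range f)
      linarith
  refine Sys.contra (k := k) (V := V) (W := W)
    { m := m
      δ := 1 / (2 * (k : ℝ) - 3)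
      U := NP
      mem := fun A u => A ∈ u.1
      col := limCol c
      N := fun i u => nb (colG V W hdisj c i) u.1
      E := fun i u u' => EqU (colG V W hdisj c i) u.1 u'.1
      L := fun i u => Lk (colG V W hdisj c i) u
      hVW := fun x => (hunion ▸ Set.mem_univ x : x ∈ V ∪ W)
      hdis := hdisj
      m_nonneg := m0
      m_add := madd
      m_univ := muniv
      hk := hk
      hδ := mul_one_div_cancel hpos.ne'
      E_refl := fun i u => Or.inl rfl
      E_symm := fun i u u' h => h.symm
      E_trans := fun i u u' u'' h h' => EqU.trans h h'
      N_L := fun i u u' h x hx => ⟨u, h, hx⟩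
      L_lt := hL
      null := ?_
      mem_inter := fun A B u h h' => inter_mem h h'
      mem_sup := fun A B u h h' => mem_of_superset h h'
      mem_em := fun A u => Ultrafilter.em u.1 A
      mem_empty := fun u => Ultrafilter.empty_notMem
      edge := fun i u u' h => EqU.edge h
      NV := fun i t ht => nb_col hdisj c i t ht
      NW := fun i t ht => nb_col' hdisj c i t ht
      splitV := fun t u ht hu => split_col hdisj c t u ht hu
      splitW := fun t u ht hu => split_col' hdisj c t u ht hu
      exV := exNP hV
      exW := exNP hW }
  intro A hA
  refine mfin A ?_
  by_contra hinf
  obtain ⟨u, hu⟩ := exNP hinf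
  exact hA u hu
end

section
/- Let k ≥ 3 and let φ be a real number such that for every pair of infinite disjoint sets V, W with V ∪ W = ℕ and every (k−1)-edge-colouring of the complete bipartite graph K_{V,W}, there exists a monochromatic path P with d̄(P) ≥ φ. Then in any k-edge-colouring of the complete graph K_ℕ, there exists a monochromatic path P with d̄(P) ≥ φ. -/
open Filter

open scoped Classical in
theorem konig_aux {α : Type*} (X Y : Finset α) (H : α → α → Prop) :
    ∃ M : Finset (α × α), (∀ p ∈ M, p.1 ∈ X ∧ p.2 ∈ Y ∧ H p.1 p.2) ∧
      (∀ p ∈ M, ∀ q ∈ M, p.1 = q.1 → p = q) ∧ (∀ p ∈ M, ∀ q ∈ M, p.2 = q.2 → p = q) ∧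
      ∃ C : Finset α × Finset α, C.1 ⊆ X ∧ C.2 ⊆ Y ∧ C.1.card + C.2.card ≤ M.card ∧
        ∀ x ∈ X, ∀ y ∈ Y, H x y → x ∈ C.1 ∨ y ∈ C.2 := by
  let N : Finset α → Finset α := fun S => Y.filter (fun y => ∃ x ∈ S, H x y)
  obtain ⟨S, hS, hmax⟩ := Finset.exists_max_image X.powerset
    (fun S => ((S.card : ℤ) - (N S).card)) ⟨∅, by simp⟩
  have hSX : S ⊆ X := Finset.mem_powerset.1 hS
  have h0 := hmax ∅ (by simp)
  have hN0 : N ∅ = ∅ := by simp [N]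
  obtain ⟨d, hd⟩ : ∃ d : ℕ, (d : ℤ) = (S.card : ℤ) - (N S).card := by
    refine ⟨S.card - (N S).card, ?_⟩
    simp only [hN0, Finset.card_empty] at h0
    omega
  let t : X → Finset (α ⊕ Fin d) := fun x => (N {x.1}).disjSum Finset.univ
  have hall : ∀ s : Finset X, s.card ≤ (s.biUnion t).card := by
    intro s
    rcases s.eq_empty_or_nonempty with rfl | ⟨x0, hx0⟩
    · simp
    have e : s.biUnion t = (N (s.map (Function.Embedding.subtype _))).disjSum Finset.univ := by
      ext z
      rcases z with z | z
      · simp [t, N]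
        constructor
        · rintro ⟨a, ⟨h1, h2⟩, h3, h4⟩; exact ⟨h3, a, ⟨h1, h2⟩, h4⟩
        · rintro ⟨h3, a, ⟨h1, h2⟩, h4⟩; exact ⟨a, ⟨h1, h2⟩, h3, h4⟩
      · simp [t]
        exact ⟨_, _, hx0⟩
    rw [e, Finset.card_disjSum]
    have := hmax (s.map (Function.Embedding.subtype _)) (by
      rw [Finset.mem_powerset]; intro a ha; simp at ha; exact ha.1)
    simp only [Finset.card_map, Finset.card_univ, Fintype.card_fin] at this ⊢
    omega
  obtain ⟨f, hf, hft⟩ := (Finset.all_card_le_biUnion_card_iff_exists_injective t).1 hall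
  let M : Finset (α × α) := (X ×ˢ Y).filter (fun p => ∃ h : p.1 ∈ X, f ⟨p.1, h⟩ = Sum.inl p.2)
  refine ⟨M, ?_, ?_, ?_, (X \ S, N S), Finset.sdiff_subset, Finset.filter_subset _ _, ?_, ?_⟩
  · intro p hp
    simp only [M, Finset.mem_filter, Finset.mem_product] at hp
    obtain ⟨⟨h1, h2⟩, h3, h4⟩ := hp
    have := hft ⟨p.1, h1⟩
    rw [h4] at this
    simp [t, N] at this
    exact ⟨h1, h2, this.2⟩
  · intro p hp q hq h
    simp only [M, Finset.mem_filter, Finset.mem_product] at hp hq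
    obtain ⟨_, h3, h4⟩ := hp
    obtain ⟨_, h5, h6⟩ := hq
    have : f ⟨p.1, h3⟩ = f ⟨q.1, h5⟩ := by congr 1; exact Subtype.ext h
    rw [h4, h6] at this
    exact Prod.ext h (Sum.inl_injective this)
  · intro p hp q hq h
    simp only [M, Finset.mem_filter, Finset.mem_product] at hp hq
    obtain ⟨_, h3, h4⟩ := hp
    obtain ⟨_, h5, h6⟩ := hq
    have : f ⟨p.1, h3⟩ = f ⟨q.1, h5⟩ := by rw [h4, h6, h]
    have := hf this
    exact Prod.ext (congrArg Subtype.val this) h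
  · -- card
    have hX : X.card ≤ M.card + d := by
      have : (Finset.univ : Finset X).image f ⊆ (M.image Prod.snd).disjSum Finset.univ := by
        intro z hz
        simp only [Finset.mem_image, Finset.mem_univ, true_and] at hz
        obtain ⟨x, rfl⟩ := hz
        have h1 := hft x
        rcases h : f x with y | y
        · rw [h] at h1
          simp [t, N] at h1
          simp only [Finset.inl_mem_disjSum, Finset.mem_image]
          refine ⟨(x.1, y), ?_, rfl⟩
          simp only [M, Finset.mem_filter, Finset.mem_product]
          exact ⟨⟨x.2, h1.1⟩, x.2, h⟩
        · simp
      have h2 := Finset.card_le_card this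
      rw [Finset.card_image_of_injective _ hf, Finset.card_disjSum] at h2
      have h3 := Finset.card_image_le (s := M) (f := Prod.snd)
      simp at h2
      omega
    have := Finset.card_sdiff_add_card_eq_card hSX
    simp only
    omega
  · intro x hx y hy hxy
    by_cases h : x ∈ S
    · right; simp [N]; exact ⟨hy, x, h, hxy⟩
    · left; simp [hx, h]

open scoped Classical in
inductive PP {α : Type*} (r : α → α → Prop) : Finset α → Finset α → Prop
  | empty : PP r ∅ ∅
  | new {V T : Finset α} (b : α) : b ∉ V → PP r V T → PP r (insert b V) (insert b T)
  | ext {V T : Finset α} (a b : α) : b ∉ V → a ∈ T → r a b → PP r V T →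
      PP r (insert b V) (insert b (T.erase a))

theorem PP.sub {α : Type*} {r : α → α → Prop} {V T : Finset α} (h : PP r V T) : T ⊆ V := by
  classical
  induction h with
  | empty => simp
  | new b hb _ ih => grind
  | ext a b hb ha hab _ ih => grind

open scoped Classical in
theorem PP.ext' {α : Type*} {r : α → α → Prop} {V T V' T' : Finset α} (a b : α) (h : PP r V T)
   (hb : b ∉ V) (ha : a ∈ T) (hab : r a b) (hV : V' = insert b V) (hT : T' = insert b (T.erase a)) :
   PP r V' T' := by subst hV hT; exact PP.ext a b hb ha hab h

open scoped Classical in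
theorem PP.new' {α : Type*} {r : α → α → Prop} {V T V' T' : Finset α} (b : α) (h : PP r V T)
   (hb : b ∉ V) (hV : V' = insert b V) (hT : T' = insert b T) :
   PP r V' T' := by subst hV hT; exact PP.new b hb h

open scoped Classical in
theorem PP.removal {α : Type*} {r : α → α → Prop} {V T : Finset α} (h : PP r V T) :
    ∀ b ∈ T, PP r (V.erase b) (T.erase b) ∨
      ∃ v ∈ V, v ∉ T ∧ r v b ∧ PP r (V.erase b) (insert v (T.erase b)) := by
  induction h with
  | empty => simp
  | @new V T b' hb' hP ih =>
    intro b hb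
    have hsub := hP.sub
    by_cases e : b = b'
    · subst e
      left
      have h1 : (insert b V).erase b = V := by grind
      have h2 : (insert b T).erase b = T := by grind
      rw [h1, h2]; exact hP
    · have hbT : b ∈ T := by grind
      rcases ih b hbT with h | ⟨v, hv, hvT, hr, h⟩
      · left
        exact h.new' b' (by grind) (by grind) (by grind)
      · right
        refine ⟨v, by grind, by grind, hr, h.new' b' (by grind) (by grind) (by grind)⟩
  | @ext V T a b' hb' ha hab hP ih =>
    intro b hb
    have hsub := hP.sub
    by_cases e : b = b'
    · subst e
      right
      have h1 : (insert b V).erase b = V := by grind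
      have h2 : insert a ((insert b (T.erase a)).erase b) = T := by grind
      refine ⟨a, by grind, by grind, hab, ?_⟩
      rw [h1, h2]; exact hP
    · have hbT : b ∈ T := by grind
      have hba : b ≠ a := by grind
      rcases ih b hbT with h | ⟨v, hv, hvT, hr, h⟩
      · left
        exact h.ext' a b' (by grind) (by grind) hab (by grind) (by grind)
      · right
        have hva : v ≠ a := by grind
        have hvb : v ≠ b' := by grind
        refine ⟨v, by grind, by grind, hr, h.ext' a b' (by grind) (by grind) hab (by grind) ?_⟩
        ext x; simp only [Finset.mem_insert, Finset.mem_erase]; grind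

open scoped Classical in
theorem PP.gm_aux {α : Type*} {r : α → α → Prop} (n : ℕ) : ∀ {V T : Finset α}, V.card = n →
    PP r V T → (∀ T', T' ⊂ T → ¬ PP r V T') →
    ∃ I ⊆ V, I.card = T.card ∧ ∀ a ∈ I, ∀ b ∈ I, a ≠ b → ¬ r a b := by
  induction n with
  | zero =>
    intro V T hV hP _
    have hV : V = ∅ := by simpa using hV
    subst hV
    have := hP.sub
    exact ⟨T, this, rfl, by grind⟩
  | succ n ih =>
    intro V T hV hP hmin
    have hsub := hP.sub
    by_cases hI : ∀ a ∈ T, ∀ b ∈ T, a ≠ b → ¬ r a b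
    · exact ⟨T, hsub, rfl, hI⟩
    push Not at hI
    obtain ⟨a, ha, b, hb, hab, hr⟩ := hI
    rcases hP.removal b hb with h | ⟨v, hv, hvT, hrv, h⟩
    · exfalso
      refine hmin (T.erase a) (Finset.erase_ssubset ha)
        (h.ext' a b (by grind) (by grind) hr (by grind) (by grind))
    · have key : ∀ T', T' ⊂ insert v (T.erase b) → ¬ PP r (V.erase b) T' := by
        intro T' hT' hP'
        have hs := hT'.1
        by_cases hvT' : v ∈ T'
        · obtain ⟨u, hu, huT'⟩ := Finset.exists_of_ssubset hT'
          refine hmin (insert b (T'.erase v)) ?_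
            (hP'.ext' v b (by grind) hvT' hrv (by grind) rfl)
          refine (Finset.ssubset_iff_of_subset ?_).2 ⟨u, ?_, ?_⟩
          · intro x hx; have := @hs x; grind
          · grind
          · grind
        · have hs2 : ∀ x ∈ T', x ∈ T ∧ x ≠ b := by
            intro x hx; have := hs hx; grind
          by_cases haT' : a ∈ T'
          · refine hmin (insert b (T'.erase a)) ?_
              (hP'.ext' a b (by grind) haT' hr (by grind) rfl)
            refine (Finset.ssubset_iff_of_subset ?_).2 ⟨a, ha, ?_⟩
            · intro x hx; have := hs2 x; grind
            · grind
          · refine hmin (insert b T') ?_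
              (hP'.new' b (by grind) (by grind) rfl)
            refine (Finset.ssubset_iff_of_subset ?_).2 ⟨a, ha, ?_⟩
            · intro x hx; have := hs2 x; grind
            · grind
      obtain ⟨I, hIV, hIc, hind⟩ := ih (V := V.erase b) (by
        rw [Finset.card_erase_of_mem (hsub hb)]; omega) h key
      refine ⟨I, fun x hx => Finset.mem_of_mem_erase (hIV hx), ?_, hind⟩
      rw [hIc, Finset.card_insert_of_notMem (by grind), Finset.card_erase_of_mem hb]
      have := Finset.card_pos.2 ⟨b, hb⟩
      omega

theorem PP.self {α : Type*} (r : α → α → Prop) (V : Finset α) : PP r V V := by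
  classical
  induction V using Finset.induction_on with
  | empty => exact PP.empty
  | insert a s ha ih => exact ih.new' a ha rfl rfl

theorem PP.gm {α : Type*} (r : α → α → Prop) (V : Finset α) : ∃ T, PP r V T ∧
    ∃ I ⊆ V, I.card = T.card ∧ ∀ a ∈ I, ∀ b ∈ I, a ≠ b → ¬ r a b := by
  classical
  obtain ⟨T, hT, hmin⟩ := Finset.exists_min_image (V.powerset.filter (fun T => PP r V T))
    Finset.card ⟨V, by simp [PP.self r V]⟩
  simp only [Finset.mem_filter, Finset.mem_powerset] at hT hmin
  refine ⟨T, hT.2, PP.gm_aux _ rfl hT.2 ?_⟩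
  intro T' hT' hP
  have := hmin T' ⟨hP.sub, hP⟩
  have := Finset.card_lt_card hT'
  omega

theorem PP.lists {α : Type*} {r : α → α → Prop} {V T : Finset α} (h : PP r V T) :
    ∃ p : α → List α, (∀ t ∈ T, ∃ l, p t = t :: l) ∧
      (∀ t ∈ T, (p t).Nodup ∧ (p t).IsChain (fun x y => r y x)) ∧
      (∀ x, x ∈ V ↔ ∃ t ∈ T, x ∈ p t) ∧
      (∀ t ∈ T, ∀ s ∈ T, ∀ x, x ∈ p t → x ∈ p s → t = s) := by
  classical
  induction h with
  | empty => exact ⟨fun _ => [], by simp⟩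
  | @new V T b hb hP ih =>
    obtain ⟨p, h1, h2, h3, h4⟩ := ih
    have hsub := hP.sub
    have hbT : ∀ t ∈ T, t ≠ b := fun t ht e => hb (e ▸ hsub ht)
    have hbp : ∀ t ∈ T, b ∉ p t := fun t ht h => hb ((h3 b).2 ⟨t, ht, h⟩)
    have hu : ∀ t ∈ T, Function.update p b [b] t = p t := fun t ht => by
      rw [Function.update_of_ne (hbT t ht)]
    have hub : Function.update p b [b] b = [b] := by simp
    refine ⟨Function.update p b [b], ?_, ?_, ?_, ?_⟩
    · intro t ht
      rcases Finset.mem_insert.1 ht with rfl | ht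
      · exact ⟨[], hub⟩
      · rw [hu t ht]; exact h1 t ht
    · intro t ht
      rcases Finset.mem_insert.1 ht with rfl | ht
      · rw [hub]; simp
      · rw [hu t ht]; exact h2 t ht
    · intro x
      rw [Finset.mem_insert, Finset.exists_mem_insert, hub, h3]
      have : (∃ t ∈ T, x ∈ Function.update p b [b] t) ↔ ∃ t ∈ T, x ∈ p t := by
        constructor
        · rintro ⟨t, ht, h⟩; exact ⟨t, ht, by rwa [hu t ht] at h⟩
        · rintro ⟨t, ht, h⟩; exact ⟨t, ht, by rwa [hu t ht]⟩
      rw [this]; simp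
    · intro t ht s hs x hxt hxs
      rcases Finset.mem_insert.1 ht with rfl | ht1 <;> rcases Finset.mem_insert.1 hs with rfl | hs1
      · rfl
      · rw [hub] at hxt; rw [hu s hs1] at hxs
        simp at hxt; subst hxt; exact absurd hxs (hbp s hs1)
      · rw [hub] at hxs; rw [hu t ht1] at hxt
        simp at hxs; subst hxs; exact absurd hxt (hbp t ht1)
      · rw [hu t ht1] at hxt; rw [hu s hs1] at hxs; exact h4 t ht1 s hs1 x hxt hxs
  | @ext V T a b hb ha hab hP ih =>
    obtain ⟨p, h1, h2, h3, h4⟩ := ih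
    have hsub := hP.sub
    have hbT : ∀ t ∈ T, t ≠ b := fun t ht e => hb (e ▸ hsub ht)
    have hbp : ∀ t ∈ T, b ∉ p t := fun t ht h => hb ((h3 b).2 ⟨t, ht, h⟩)
    have hu : ∀ t ∈ T, Function.update p b (b :: p a) t = p t := fun t ht => by
      rw [Function.update_of_ne (hbT t ht)]
    have hub : Function.update p b (b :: p a) b = b :: p a := by simp
    refine ⟨Function.update p b (b :: p a), ?_, ?_, ?_, ?_⟩
    · intro t ht
      rcases Finset.mem_insert.1 ht with rfl | ht
      · exact ⟨p a, hub⟩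
      · have ht := Finset.mem_of_mem_erase ht
        rw [hu t ht]; exact h1 t ht
    · intro t ht
      rcases Finset.mem_insert.1 ht with rfl | ht
      · rw [hub]
        obtain ⟨l, hl⟩ := h1 a ha
        refine ⟨List.nodup_cons.2 ⟨hbp a ha, (h2 a ha).1⟩, ?_⟩
        have := (h2 a ha).2
        rw [hl] at this ⊢
        exact List.isChain_cons_cons.2 ⟨hab, this⟩
      · have ht := Finset.mem_of_mem_erase ht
        rw [hu t ht]; exact h2 t ht
    · intro x
      rw [Finset.mem_insert, Finset.exists_mem_insert, hub, h3]
      constructor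
      · rintro (rfl | ⟨t, ht, h⟩)
        · left; simp
        · by_cases e : t = a
          · subst e; left; simp [h]
          · right; exact ⟨t, Finset.mem_erase.2 ⟨e, ht⟩, by rwa [hu t ht]⟩
      · rintro (h | ⟨t, ht, h⟩)
        · rcases List.mem_cons.1 h with h | h
          · left; exact h
          · right; exact ⟨a, ha, h⟩
        · have ht := Finset.mem_of_mem_erase ht
          right; exact ⟨t, ht, by rwa [hu t ht] at h⟩
    · have aux : ∀ s ∈ T.erase a, ∀ x, x ∈ b :: p a → x ∈ p s → False := by
        intro s hs x hx hxs
        have hs' := Finset.mem_of_mem_erase hs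
        rcases List.mem_cons.1 hx with h | h
        · exact hbp s hs' (h ▸ hxs)
        · exact Finset.ne_of_mem_erase hs (h4 s hs' a ha x hxs h)
      intro t ht s hs x hxt hxs
      rcases Finset.mem_insert.1 ht with rfl | ht1 <;> rcases Finset.mem_insert.1 hs with rfl | hs1
      · rfl
      · rw [hub] at hxt; rw [hu s (Finset.mem_of_mem_erase hs1)] at hxs
        exact (aux s hs1 x hxt hxs).elim
      · rw [hub] at hxs; rw [hu t (Finset.mem_of_mem_erase ht1)] at hxt
        exact (aux t ht1 x hxs hxt).elim
      · rw [hu t (Finset.mem_of_mem_erase ht1)] at hxt; rw [hu s (Finset.mem_of_mem_erase hs1)] at hxs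
        exact h4 t (Finset.mem_of_mem_erase ht1) s (Finset.mem_of_mem_erase hs1) x hxt hxs

open SimpleGraph SimpleGraph.TripartiteFromTriangles in
theorem tri_count {α β γ : Type*} [Fintype α] [Fintype β] [Fintype γ] (t : Finset (α × β × γ))
    (h1 : ExplicitDisjoint t) (h2 : NoAccidental t) (ε : ℝ)
    (h : ε * ((Fintype.card α + Fintype.card β + Fintype.card γ : ℕ) : ℝ) ^ 2 ≤ t.card) :
    triangleRemovalBound ε * ((Fintype.card α + Fintype.card β + Fintype.card γ : ℕ) : ℝ) ^ 3
      ≤ t.card := by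
  classical
  have h₁ := (farFromTriangleFree t (ε := ε) (by push_cast at h ⊢; exact h)).le_card_cliqueFinset
  rw [card_triangles] at h₁
  simpa [add_assoc] using h₁

/-- `M` is an induced matching of `H` between `X` and `Y`. -/
def IndM {α : Type*} (X Y : Finset α) (H : α → α → Prop) (M : Finset (α × α)) : Prop :=
  (∀ p ∈ M, p.1 ∈ X ∧ p.2 ∈ Y ∧ H p.1 p.2) ∧ ∀ p ∈ M, ∀ q ∈ M, H p.1 q.2 → p = q

set_option maxHeartbeats 1000000 in
open scoped Classical in
theorem ind_family {α : Type*} (ε : ℝ) (hε : 0 < ε) : ∃ n0 : ℕ, ∀ n ≥ n0, ∀ (X Y : Finset α)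
    (H : α → α → Prop), X.card ≤ n → Y.card ≤ n → ∀ F : Finset (Finset (α × α)),
    (∀ M ∈ F, IndM X Y H M ∧ ε * n ≤ M.card) → (∀ M ∈ F, ∀ M' ∈ F, ∀ p, p ∈ M → p ∈ M' → M = M') →
    ((F.biUnion id).card : ℝ) ≤ ε * n ^ 2 := by
  set C : ℝ := 2 + 1 / ε with hC
  have hCpos : 2 < C := by rw [hC]; have : 0 < 1 / ε := by positivity
                           linarith
  set ε1 : ℝ := min 1 (ε / C ^ 2) with hε1
  have hepos : 0 < ε1 := by rw [hε1]; apply lt_min one_pos; positivity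
  have hele : ε1 ≤ 1 := min_le_left _ _
  set δ := SimpleGraph.triangleRemovalBound ε1 with hδ
  have hδpos : 0 < δ := SimpleGraph.triangleRemovalBound_pos hepos
  refine ⟨⌈1 / (ε * δ ^ 2)⌉₊ + 1, ?_⟩
  intro n hn X Y H hX hY F hF hdis
  by_contra! hlt
  set D := F.biUnion id with hD
  have hn1 : (1 : ℝ) ≤ n := by exact_mod_cast (by omega : 1 ≤ n)
  have hnb : 1 / (ε * δ ^ 2) < n := by
    refine (Nat.le_ceil _).trans_lt ?_
    exact_mod_cast hn
  have hDsub : D ⊆ X ×ˢ Y := by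
    intro p hp
    simp only [hD, Finset.mem_biUnion, id] at hp
    obtain ⟨M, hM, hp⟩ := hp
    have := (hF M hM).1.1 p hp
    simp [this.1, this.2.1]
  have hDXY : D.card ≤ X.card * Y.card := by
    simpa using Finset.card_le_card hDsub
  have hDn : (D.card : ℝ) ≤ n ^ 2 := by
    have : D.card ≤ n * n := hDXY.trans (Nat.mul_le_mul hX hY)
    rw [sq]; exact_mod_cast this
  have hsum : D.card = ∑ M ∈ F, M.card := by
    rw [hD, Finset.card_biUnion]
    · rfl
    · intro M hM M' hM' hne
      rw [Function.onFun, Finset.disjoint_left]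
      intro p hp hp'
      exact hne (hdis M hM M' hM' p hp hp')
  have hFc : (F.card : ℝ) ≤ n / ε := by
    have h1 : (F.card : ℝ) * (ε * n) ≤ D.card := by
      rw [hsum]; push_cast
      rw [← nsmul_eq_mul]
      exact Finset.card_nsmul_le_sum _ _ _ (fun M hM => (hF M hM).2)
    rw [le_div_iff₀ hε]
    have h2 : (F.card : ℝ) * ε * n ≤ n * n := by nlinarith
    exact le_of_mul_le_mul_right h2 (by linarith)
  let t : Finset (X × Y × F) := Finset.univ.filter (fun z => (z.1.1, z.2.1.1) ∈ z.2.2.1)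
  have ht : ∀ a b c, (a, b, c) ∈ t ↔ (a.1, b.1) ∈ c.1 := by intro a b c; simp [t]
  have hin : ∀ (c : F) (a a' b b'), (a, b') ∈ c.1 → (a', b) ∈ c.1 → H a b → a = a' ∧ b = b' := by
    intro c a a' b b' h1 h2 h3
    have := (hF c.1 c.2).1.2 _ h1 _ h2 h3
    simp at this
    exact ⟨this.1, this.2.symm⟩
  have hH : ∀ (c : F) a b, (a, b) ∈ c.1 → H a b := by
    intro c a b h; exact ((hF c.1 c.2).1.1 _ h).2.2
  have e1 : SimpleGraph.TripartiteFromTriangles.ExplicitDisjoint t := by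
    constructor
    · intro a b c a' h h'
      rw [ht] at h h'
      exact Subtype.ext (hin c _ _ _ _ h h' (hH c _ _ h)).1
    · intro a b c b' h h'
      rw [ht] at h h'
      exact Subtype.ext (hin c _ _ _ _ h' h (hH c _ _ h)).2
    · intro a b c c' h h'
      rw [ht] at h h'
      exact Subtype.ext (hdis _ c.2 _ c'.2 _ h h')
  have e2 : SimpleGraph.TripartiteFromTriangles.NoAccidental t := by
    constructor
    intro a a' b b' c c' h h' h''
    rw [ht] at h h' h''
    left
    exact Subtype.ext (hin c _ _ _ _ h' h (hH c' _ _ h'')).1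
  have htc : t.card = D.card := by
    apply Finset.card_bij (fun z _ => (z.1.1, z.2.1.1))
    · rintro ⟨a, b, c⟩ h
      rw [ht] at h
      simp only [hD, Finset.mem_biUnion]
      exact ⟨c.1, c.2, h⟩
    · rintro ⟨a, b, c⟩ h ⟨a', b', c'⟩ h' e
      rw [ht] at h h'
      simp only [Prod.mk.injEq] at e
      have e1 := Subtype.ext e.1
      have e2 := Subtype.ext e.2
      subst e1 e2
      have := Subtype.ext (hdis _ c.2 _ c'.2 _ h h')
      rw [this]
    · intro p hp
      have h1 := Finset.mem_product.1 (hDsub hp)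
      simp only [hD, Finset.mem_biUnion] at hp
      obtain ⟨M, hM, hp⟩ := hp
      exact ⟨(⟨p.1, h1.1⟩, ⟨p.2, h1.2⟩, ⟨M, hM⟩), by rw [ht]; exact hp, rfl⟩
  have key := tri_count t e1 e2 ε1
  simp only [Fintype.card_coe] at key
  rw [htc] at key
  set N : ℝ := ((X.card + Y.card + F.card : ℕ) : ℝ) with hN
  have hNle : N ≤ C * n := by
    rw [hN, hC]; push_cast
    have : (X.card : ℝ) ≤ n := by exact_mod_cast hX
    have : (Y.card : ℝ) ≤ n := by exact_mod_cast hY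
    have : n / ε = 1 / ε * n := by ring
    linarith
  have hN0 : 0 ≤ N := by rw [hN]; positivity
  have hDN : (D.card : ℝ) ≤ N ^ 2 := by
    have : D.card ≤ (X.card + Y.card + F.card) * (X.card + Y.card + F.card) :=
      hDXY.trans (Nat.mul_le_mul (by omega) (by omega))
    rw [sq, hN]; exact_mod_cast this
  have key2 := key (by
    have h1 : ε1 ≤ ε / C ^ 2 := min_le_right _ _
    have h2 : N ^ 2 ≤ (C * n) ^ 2 := by gcongr
    calc ε1 * N ^ 2 ≤ ε / C ^ 2 * (C * n) ^ 2 := by gcongr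
      _ = ε * n ^ 2 := by
          have hCne : C ^ 2 ≠ 0 := by positivity
          rw [mul_pow, div_mul_eq_mul_div, mul_left_comm, mul_div_cancel_left₀ _ hCne]
      _ ≤ _ := hlt.le)
  have hNpos : 0 < N := by
    by_contra! h
    have : N = 0 := le_antisymm h hN0
    rw [this] at hDN
    have : 0 < ε * (n : ℝ) ^ 2 := by positivity
    norm_num at hDN
    rw [hDN] at hlt
    simp at hlt
    linarith
  have h3 : δ * N ≤ 1 := by
    have : δ * N * N ^ 2 ≤ 1 * N ^ 2 := by
      calc δ * N * N ^ 2 = δ * N ^ 3 := by ring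
        _ ≤ _ := key2
        _ ≤ _ := by linarith
    exact le_of_mul_le_mul_right this (by positivity)
  have h4 : ε * n ^ 2 * δ ^ 2 < 1 := by
    calc ε * n ^ 2 * δ ^ 2 < N ^ 2 * δ ^ 2 := by
          apply mul_lt_mul_of_pos_right (hlt.trans_le hDN); positivity
      _ = (δ * N) ^ 2 := by ring
      _ ≤ 1 := by apply pow_le_one₀ (by positivity) h3
  rw [div_lt_iff₀ (by positivity)] at hnb
  have h5 : 0 < ε * δ ^ 2 := by positivity
  nlinarith

open scoped Classical in
theorem ind_delete {α : Type*} (ε : ℝ) (hε : 0 < ε) : ∃ n0 : ℕ, ∀ n ≥ n0, ∀ (X Y : Finset α)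
    (H : α → α → Prop), X.card ≤ n → Y.card ≤ n → ∃ D : Finset (α × α),
    (D.card : ℝ) ≤ ε * n ^ 2 ∧ ∀ M, IndM X Y H M → Disjoint M D → (M.card : ℝ) ≤ ε * n := by
  obtain ⟨n0, h0⟩ := ind_family (α := α) ε hε
  refine ⟨n0 + 1, ?_⟩
  intro n hn X Y H hX hY
  let P : Finset (Finset (α × α)) → Prop := fun F =>
    (∀ M ∈ F, IndM X Y H M ∧ ε * n ≤ M.card) ∧ (∀ M ∈ F, ∀ M' ∈ F, ∀ p, p ∈ M → p ∈ M' → M = M')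
  obtain ⟨F, hF, hmax⟩ := Finset.exists_max_image
    ((X ×ˢ Y).powerset.powerset.filter P) Finset.card ⟨∅, by simp [P]⟩
  simp only [Finset.mem_filter, Finset.mem_powerset] at hF hmax
  refine ⟨F.biUnion id, h0 n (by omega) X Y H hX hY F hF.2.1 hF.2.2, ?_⟩
  intro M hM hd
  by_contra! hc
  have hMpos : 0 < M.card := by
    have : (0 : ℝ) ≤ ε * n := by positivity
    have := this.trans_lt hc
    exact_mod_cast this
  obtain ⟨p0, hp0⟩ := Finset.card_pos.1 hMpos
  have hnot : ∀ M' ∈ F, ∀ p ∈ M, p ∉ M' := by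
    intro M' hM' p hp hp'
    exact Finset.disjoint_left.1 hd hp (Finset.mem_biUnion.2 ⟨M', hM', hp'⟩)
  have hMF : M ∉ F := fun h => hnot M h p0 hp0 hp0
  have := hmax (insert M F) ⟨?_, ?_, ?_⟩
  · rw [Finset.card_insert_of_notMem hMF] at this
    omega
  · intro M' hM'
    rcases Finset.mem_insert.1 hM' with rfl | h
    · rw [Finset.mem_powerset]
      intro p hp
      have := hM.1 p hp
      simp [this.1, this.2.1]
    · exact hF.1 h
  · intro M' hM'
    rcases Finset.mem_insert.1 hM' with rfl | h
    · exact ⟨hM, hc.le⟩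
    · exact hF.2.1 _ h
  · intro M1 hM1 M2 hM2 p hp1 hp2
    rcases Finset.mem_insert.1 hM1 with rfl | h1 <;> rcases Finset.mem_insert.1 hM2 with rfl | h2
    · rfl
    · exact absurd hp2 (hnot _ h2 p hp1)
    · exact absurd hp1 (hnot _ h1 p hp2)
    · exact hF.2.2 _ h1 _ h2 p hp1 hp2

/-- The vertex list of an alternating path given by a (reversed) list of matching edges. -/
def blk {α : Type*} : List (α × α) → List α
  | [] => []
  | t :: l => t.1 :: l.flatMap (fun s => [s.2, s.1])

theorem mem_blk {α : Type*} {v : α} : ∀ {l : List (α × α)}, v ∈ blk l → ∃ s ∈ l, v = s.1 ∨ v = s.2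
  | [], h => by simp [blk] at h
  | t :: l, h => by
    simp [blk] at h
    grind

theorem blk_chain {α : Type*} {H : α → α → Prop} (hs : ∀ x y, H x y → H y x) :
    ∀ (l : List (α × α)) (t : α × α), (∀ s ∈ t :: l, H s.1 s.2) →
    (t :: l).IsChain (fun x y => H y.2 x.1) → (blk (t :: l)).IsChain H := by
  intro l
  induction l with
  | nil => intro t _ _; simp [blk]
  | cons s l ih =>
    intro t h1 h2
    have h3 := ih s (fun z hz => h1 z (List.mem_cons_of_mem _ hz)) (List.isChain_cons_cons.1 h2).2
    have h4 := (List.isChain_cons_cons.1 h2).1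
    simp only [blk, List.flatMap_cons, List.cons_append, List.nil_append] at h3 ⊢
    refine List.isChain_cons_cons.2 ⟨hs _ _ h4, List.isChain_cons_cons.2 ⟨hs _ _ ?_, h3⟩⟩
    exact h1 s (by simp)

theorem blk_last {α : Type*} : ∀ (l : List (α × α)) (t : α × α),
    ∃ i, ∃ s ∈ t :: l, blk (t :: l) = i ++ [s.1] := by
  intro l
  induction l with
  | nil => intro t; exact ⟨[], t, by simp, by simp [blk]⟩
  | cons s l ih =>
    intro t
    obtain ⟨i, u, hu, h⟩ := ih s
    refine ⟨t.1 :: s.2 :: i, u, List.mem_cons_of_mem _ hu, ?_⟩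
    simp only [blk, List.flatMap_cons, List.cons_append, List.nil_append] at h ⊢
    rw [h]

theorem blk_nodup {α : Type*} {M : Finset (α × α)}
    (h1 : ∀ p ∈ M, ∀ q ∈ M, p.1 = q.1 → p = q) (h2 : ∀ p ∈ M, ∀ q ∈ M, p.2 = q.2 → p = q)
    (h3 : ∀ p ∈ M, ∀ q ∈ M, p.1 ≠ q.2) :
    ∀ (l : List (α × α)) (t : α × α), (∀ s ∈ t :: l, s ∈ M) → (t :: l).Nodup →
      (blk (t :: l)).Nodup := by
  intro l
  induction l with
  | nil => intro t _ _; simp [blk]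
  | cons s l ih =>
    intro t hM hn
    have h4 := ih s (fun z hz => hM z (List.mem_cons_of_mem _ hz)) (List.nodup_cons.1 hn).2
    have hs : s.2 ∉ blk (s :: l) := by
      intro h
      simp only [blk, List.mem_cons, List.mem_flatMap] at h
      rcases h with h | ⟨u, hu, h⟩
      · exact h3 s (hM s (by simp)) s (hM s (by simp)) h.symm
      · simp only [List.not_mem_nil, or_false] at h
        rcases h with h | h
        · have := h2 s (hM s (by simp)) u (hM u (by simp [hu])) h
          subst this
          simp [hu] at hn
        · exact h3 u (hM u (by simp [hu])) s (hM s (by simp)) h.symm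
    have ht : t.1 ∉ blk (s :: l) := by
      intro h
      obtain ⟨u, hu, h⟩ := mem_blk h
      rcases h with h | h
      · have := h1 t (hM t (by simp)) u (hM u (List.mem_cons_of_mem _ hu)) h
        subst this
        exact (List.nodup_cons.1 hn).1 hu
      · exact h3 t (hM t (by simp)) u (hM u (List.mem_cons_of_mem _ hu)) h
    have hts : t.1 ≠ s.2 := h3 t (hM t (by simp)) s (hM s (by simp))
    have e : blk (t :: s :: l) = t.1 :: s.2 :: blk (s :: l) := by simp [blk]
    rw [e]
    simp only [List.nodup_cons, List.mem_cons, not_or]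
    exact ⟨⟨hts, ht⟩, hs, h4⟩

open scoped Classical in
theorem dense_konig {α : Type*} (ε : ℝ) (hε : 0 < ε) : ∃ n0 : ℕ, ∀ n ≥ n0, ∀ (X Y : Finset α)
    (H : α → α → Prop), (∀ x y, H x y → H y x) → Disjoint X Y → X.card ≤ n → Y.card ≤ n →
    ∃ (Y1 : Finset α) (B : Finset (List α)) (C : Finset α), Y1 ⊆ Y ∧
      (∀ b ∈ B, b.IsChain H ∧ b.Nodup ∧ (∃ h t, b = h :: t ∧ h ∈ X) ∧
        (∃ t h, b = t ++ [h] ∧ h ∈ X) ∧ ∀ v ∈ b, v ∈ X ∨ v ∈ Y) ∧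
      (∀ b ∈ B, ∀ b' ∈ B, ∀ v, v ∈ b → v ∈ b' → b = b') ∧
      (∀ y ∈ Y1, ∃ b ∈ B, y ∈ b) ∧
      (C.card : ℝ) ≤ Y1.card + ε * n ∧
      (((X ×ˢ Y).filter (fun p => H p.1 p.2 ∧ p.1 ∉ C ∧ p.2 ∉ C)).card : ℝ) ≤ ε * n ^ 2 := by
  obtain ⟨n0, h0⟩ := ind_delete (α := α) ε hε
  refine ⟨n0, ?_⟩
  intro n hn X Y H hsymm hXY hX hY
  obtain ⟨D, hDc, hD⟩ := h0 n hn X Y H hX hY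
  obtain ⟨M, hM, hM1, hM2, C, hC1, hC2, hCc, hcov⟩ :=
    konig_aux X Y (fun x y => H x y ∧ (x, y) ∉ D)
  obtain ⟨T, hPP, I, hIM, hIc, hI⟩ := PP.gm (fun t s : α × α => H t.2 s.1) M
  have hTM := hPP.sub
  have hTc : (T.card : ℝ) ≤ ε * n := by
    rw [← hIc]
    apply hD I
    · refine ⟨fun p hp => ?_, fun p hp q hq h => ?_⟩
      · have := hM p (hIM hp); exact ⟨this.1, this.2.1, this.2.2.1⟩
      · by_contra hne
        exact hI q hq p hp (Ne.symm hne) (hsymm _ _ h)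
    · rw [Finset.disjoint_left]
      intro p hp hpD
      exact (hM p (hIM hp)).2.2.2 hpD
  obtain ⟨p, hp1, hp2, hp3, hp4⟩ := hPP.lists
  have hpM : ∀ t ∈ T, ∀ s ∈ p t, s ∈ M := fun t ht s hs => (hp3 s).2 ⟨t, ht, hs⟩
  have hM3 : ∀ p ∈ M, ∀ q ∈ M, p.1 ≠ q.2 := by
    intro p hp q hq e
    exact Finset.disjoint_left.1 hXY (hM p hp).1 (e ▸ (hM q hq).2.1)
  refine ⟨(M \ T).image Prod.snd, T.image (fun t => blk (p t)), C.1 ∪ C.2, ?_, ?_, ?_, ?_, ?_, ?_⟩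
  · intro y hy
    simp only [Finset.mem_image, Finset.mem_sdiff] at hy
    obtain ⟨q, ⟨hq, _⟩, rfl⟩ := hy
    exact (hM q hq).2.1
  · intro b hb
    obtain ⟨t, ht, rfl⟩ := Finset.mem_image.1 hb
    obtain ⟨l, hl⟩ := hp1 t ht
    have hm := hpM t ht
    obtain ⟨hnd, hch⟩ := hp2 t ht
    refine ⟨?_, ?_, ?_, ?_, ?_⟩
    · rw [hl] at hch hm ⊢
      exact blk_chain hsymm l t (fun s hs => (hM s (hm s hs)).2.2.1) hch
    · rw [hl] at hnd hm ⊢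
      exact blk_nodup hM1 hM2 hM3 l t hm hnd
    · rw [hl]; exact ⟨t.1, _, rfl, (hM t (hTM ht)).1⟩
    · rw [hl] at hm ⊢
      obtain ⟨i, s, hs, h⟩ := blk_last l t
      exact ⟨i, s.1, h, (hM s (hm s hs)).1⟩
    · intro v hv
      obtain ⟨s, hs, h⟩ := mem_blk hv
      rcases h with rfl | rfl
      · left; exact (hM s (hm s hs)).1
      · right; exact (hM s (hm s hs)).2.1
  · intro b hb b' hb' v hv hv'
    obtain ⟨t, ht, rfl⟩ := Finset.mem_image.1 hb
    obtain ⟨t', ht', rfl⟩ := Finset.mem_image.1 hb'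
    obtain ⟨s, hs, h⟩ := mem_blk hv
    obtain ⟨s', hs', h'⟩ := mem_blk hv'
    have hsM := hpM t ht s hs
    have hsM' := hpM t' ht' s' hs'
    have : s = s' := by
      rcases h with h | h <;> rcases h' with h' | h'
      · exact hM1 s hsM s' hsM' (h.symm.trans h')
      · exact absurd (h.symm.trans h') (hM3 s hsM s' hsM')
      · exact absurd (h'.symm.trans h) (hM3 s' hsM' s hsM)
      · exact hM2 s hsM s' hsM' (h.symm.trans h')
    subst this
    rw [hp4 t ht t' ht' s hs hs']
  · intro y hy
    simp only [Finset.mem_image, Finset.mem_sdiff] at hy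
    obtain ⟨q, ⟨hq, hqT⟩, rfl⟩ := hy
    obtain ⟨t, ht, hqt⟩ := (hp3 q).1 hq
    refine ⟨blk (p t), Finset.mem_image_of_mem _ ht, ?_⟩
    obtain ⟨l, hl⟩ := hp1 t ht
    rw [hl] at hqt ⊢
    rcases List.mem_cons.1 hqt with rfl | h
    · exact absurd ht hqT
    · simp only [blk, List.mem_cons, List.mem_flatMap]
      right; exact ⟨q, h, by simp⟩
  · rw [Finset.card_image_of_injOn]
    · have h1 := Finset.card_sdiff_add_card_eq_card hTM
      have h2 := Finset.card_union_le C.1 C.2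
      have h3 : (C.1 ∪ C.2).card ≤ (M \ T).card + T.card := by omega
      have h4 : ((C.1 ∪ C.2).card : ℝ) ≤ (M \ T).card + T.card := by exact_mod_cast h3
      linarith
    · intro a ha b hb e
      simp only [Finset.coe_sdiff, Set.mem_sdiff, Finset.mem_coe] at ha hb
      exact hM2 a ha.1 b hb.1 e
  · refine le_trans ?_ hDc
    norm_cast
    apply Finset.card_le_card
    intro q hq
    simp only [Finset.mem_filter, Finset.mem_product, Finset.mem_union, not_or] at hq
    by_contra hqD
    have := hcov q.1 hq.1.1 q.2 hq.1.2 ⟨hq.2.1, hqD⟩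
    tauto

open scoped Classical in
theorem long_path {α : Type*} (R : α → α → Prop) (hs : ∀ x y, R x y → R y x)
    (L : ℕ) (hL : 1 ≤ L) (m : ℕ) : ∀ Y : Finset α, Y.card = m →
    (∀ l : List α, l.Nodup → l.IsChain R → (∀ v ∈ l, v ∈ Y) → l.length ≠ L) →
    ((Y ×ˢ Y).filter (fun p => R p.1 p.2)).card ≤ 2 * L * m := by
  induction m with
  | zero =>
    intro Y hY _
    have : Y = ∅ := by simpa using hY
    subst this; simp
  | succ m ih =>
    intro Y hY hno
    by_cases hdeg : ∃ y ∈ Y, (Y.filter (fun z => R y z)).card < L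
    · obtain ⟨y, hy, hd⟩ := hdeg
      have h1 := ih (Y.erase y) (by rw [Finset.card_erase_of_mem hy]; omega)
        (fun l h1 h2 h3 => hno l h1 h2 (fun v hv => Finset.mem_of_mem_erase (h3 v hv)))
      have hsub : (Y ×ˢ Y).filter (fun p => R p.1 p.2) ⊆
          (((Y.erase y) ×ˢ (Y.erase y)).filter (fun p => R p.1 p.2)) ∪
          ((Y.filter (fun z => R y z)).image (fun z => (y, z)) ∪
          (Y.filter (fun z => R y z)).image (fun z => (z, y))) := by
        rintro ⟨a, b⟩ h
        simp only [Finset.mem_filter, Finset.mem_product] at h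
        by_cases ha : a = y
        · subst ha
          simp [h.1.2, h.2]
        · by_cases hb : b = y
          · subst hb
            simp [h.1.1, hs _ _ h.2]
          · simp [ha, hb, h]
      have h2 := Finset.card_le_card hsub
      have h3 := Finset.card_union_le (((Y.erase y) ×ˢ (Y.erase y)).filter (fun p => R p.1 p.2))
        ((Y.filter (fun z => R y z)).image (fun z => (y, z)) ∪
          (Y.filter (fun z => R y z)).image (fun z => (z, y)))
      have h4 := Finset.card_union_le ((Y.filter (fun z => R y z)).image (fun z => (y, z)))
          ((Y.filter (fun z => R y z)).image (fun z => (z, y)))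
      have h5 := Finset.card_image_le (s := Y.filter (fun z => R y z)) (f := fun z => (y, z))
      have h6 := Finset.card_image_le (s := Y.filter (fun z => R y z)) (f := fun z => (z, y))
      have : 2 * L * (m + 1) = 2 * L * m + 2 * L := by ring
      omega
    · push Not at hdeg
      exfalso
      obtain ⟨y0, hy0⟩ := Finset.card_pos.1 (by omega : 0 < Y.card)
      have key : ∀ j < L, ∃ h t, (h :: t : List α).Nodup ∧ (h :: t).IsChain R ∧
          (∀ v ∈ h :: t, v ∈ Y) ∧ (h :: t).length = j + 1 := by
        intro j
        induction j with
        | zero => intro _; exact ⟨y0, [], by simp, by simp, by simpa using hy0, by simp⟩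
        | succ j ihj =>
          intro hj
          obtain ⟨h, t, h1, h2, h3, h4⟩ := ihj (by omega)
          have hd := hdeg h (h3 h (by simp))
          have : ∃ z ∈ Y.filter (fun z => R h z), z ∉ (h :: t).toFinset := by
            by_contra! hc
            have hc' : Y.filter (fun z => R h z) ⊆ (h :: t).toFinset := hc
            have := Finset.card_le_card hc'
            have := List.toFinset_card_le (h :: t)
            omega
          obtain ⟨z, hz, hzt⟩ := this
          rw [Finset.mem_filter] at hz
          rw [List.mem_toFinset] at hzt
          refine ⟨z, h :: t, List.nodup_cons.2 ⟨hzt, h1⟩,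
            List.isChain_cons_cons.2 ⟨hs _ _ hz.2, h2⟩, ?_, by simpa using h4⟩
          intro v hv
          rcases List.mem_cons.1 hv with rfl | hv
          · exact hz.1
          · exact h3 v hv
      obtain ⟨h, t, h1, h2, h3, h4⟩ := key (L - 1) (by omega)
      exact hno _ h1 h2 h3 (by omega)

/-- The window `{1, ..., n}`. -/
def win (n : ℕ) : Finset ℕ+ := (Finset.range n).map ⟨Nat.succPNat, Nat.succPNat_injective⟩

theorem mem_win {n : ℕ} {a : ℕ+} : a ∈ win n ↔ (a : ℕ) ≤ n := by
  simp only [win, Finset.mem_map, Finset.mem_range, Function.Embedding.coeFn_mk]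
  constructor
  · rintro ⟨b, hb, rfl⟩; simp; omega
  · intro h
    exact ⟨a.natPred, by have := a.pos; rw [PNat.natPred]; omega, by simp⟩

theorem card_win (n : ℕ) : (win n).card = n := by simp [win]

open scoped Classical in
/-- counting function -/
noncomputable def cnt (A : Set ℕ+) (n : ℕ) : ℕ := ((win n).filter (· ∈ A)).card

theorem card_dens (A : Set ℕ+) (n : ℕ) :
    Nat.card {a : ℕ+ // a ∈ A ∧ (a : ℕ) ≤ n} = cnt A n := by
  classical
  unfold cnt
  apply Nat.subtype_card
  intro x
  simp [mem_win, and_comm]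

theorem cnt_le (A : Set ℕ+) (n : ℕ) : cnt A n ≤ n := by
  classical
  unfold cnt
  refine (Finset.card_filter_le _ _).trans ?_
  rw [card_win]

theorem cnt_union (A B : Set ℕ+) (n : ℕ) : cnt (A ∪ B) n ≤ cnt A n + cnt B n := by
  classical
  unfold cnt
  refine le_trans (Finset.card_le_card ?_) (Finset.card_union_le _ _)
  intro x; simp; tauto

theorem cnt_mono {A B : Set ℕ+} (h : A ⊆ B) (n : ℕ) : cnt A n ≤ cnt B n := by
  classical
  unfold cnt
  refine Finset.card_le_card ?_
  intro x; simp; intro h1 h2; exact ⟨h1, h h2⟩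

theorem cnt_fin (F : Finset ℕ+) (n : ℕ) : cnt F n ≤ F.card := by
  classical
  unfold cnt
  refine Finset.card_le_card ?_
  intro x; simp

theorem dens_iff (A : Set ℕ+) (φ : ℝ) : φ ≤ upperDensity A ↔
    ∀ ε > 0, ∃ᶠ n in atTop, (φ - ε) * n ≤ cnt A n := by
  have hle1 : ∀ n : ℕ, ((cnt A n : ℝ) / n) ≤ 1 := by
    intro n
    apply div_le_one_of_le₀ _ (by positivity)
    exact_mod_cast cnt_le A n
  have hge0 : ∀ n : ℕ, 0 ≤ ((cnt A n : ℝ) / n) := fun n => by positivity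
  have hb : IsBoundedUnder (· ≤ ·) atTop (fun n : ℕ => (cnt A n : ℝ) / n) :=
    isBoundedUnder_of ⟨1, hle1⟩
  have hcb : IsCoboundedUnder (· ≤ ·) atTop (fun n : ℕ => (cnt A n : ℝ) / n) :=
    (isBoundedUnder_of ⟨0, hge0⟩ : IsBoundedUnder (· ≥ ·) atTop _).isCoboundedUnder_le
  unfold upperDensity
  simp only [card_dens]
  constructor
  · intro h ε hε
    have := frequently_lt_of_lt_limsup hcb (show φ - ε < _ by linarith)
    refine (this.and_eventually (eventually_gt_atTop 0)).mono ?_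
    rintro n ⟨h1, h2⟩
    have : (0 : ℝ) < n := by exact_mod_cast h2
    rw [lt_div_iff₀ this] at h1
    exact h1.le
  · intro h
    apply le_of_forall_pos_le_add
    intro ε hε
    have : φ - ε ≤ limsup (fun n : ℕ => (cnt A n : ℝ) / n) atTop := by
      apply le_limsup_of_frequently_le _ hb
      refine ((h ε hε).and_eventually (eventually_gt_atTop 0)).mono ?_
      rintro n ⟨h1, h2⟩
      have : (0 : ℝ) < n := by exact_mod_cast h2
      rw [le_div_iff₀ this]
      exact h1
    linarith

theorem dens_le_of_cnt {A : Set ℕ+} {φ ψ : ℝ} (h : φ ≤ upperDensity A)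
    (h2 : ∀ ε > 0, ∃ K : ℝ, ∀ n : ℕ, (cnt A n : ℝ) ≤ (ψ + ε) * n + K) : φ ≤ ψ := by
  by_contra! hlt
  set ε := (φ - ψ) / 4 with hε
  have hpos : 0 < ε := by rw [hε]; linarith
  have h3 := (dens_iff A φ).1 h ε hpos
  obtain ⟨K, hK⟩ := h2 ε hpos
  obtain ⟨N, hN⟩ := exists_nat_gt (K / ε)
  obtain ⟨n, h4, h6⟩ := (h3.and_eventually (eventually_ge_atTop (N + 1))).exists
  have h5 := hK n
  have h7 : (N : ℝ) + 1 ≤ n := by exact_mod_cast h6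
  rw [div_lt_iff₀ hpos] at hN
  have : φ = ψ + 4 * ε := by rw [hε]; ring
  have : (0 : ℝ) ≤ N := by positivity
  nlinarith

theorem dens_finite_diff {A B : Set ℕ+} (F : Finset ℕ+) (h : A ⊆ B ∪ F) {φ : ℝ}
    (hA : φ ≤ upperDensity A) : φ ≤ upperDensity B := by
  rw [dens_iff] at hA ⊢
  intro ε hε
  have h1 := hA (ε / 2) (by positivity)
  obtain ⟨N, hN⟩ := exists_nat_gt (F.card / (ε / 2))
  refine (h1.and_eventually (eventually_ge_atTop N)).mono ?_
  rintro n ⟨h2, h3⟩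
  have h4 : (N : ℝ) ≤ n := by exact_mod_cast h3
  rw [div_lt_iff₀ (by positivity)] at hN
  have h5 : cnt A n ≤ cnt B n + F.card :=
    (cnt_mono h n).trans ((cnt_union B F n).trans (Nat.add_le_add_left (cnt_fin F n) _))
  have h6 : (cnt A n : ℝ) ≤ cnt B n + F.card := by exact_mod_cast h5
  nlinarith

theorem dens_finite {A : Set ℕ+} (hA : A.Finite) {φ : ℝ} (h : φ ≤ upperDensity A) : φ ≤ 0 := by
  apply dens_le_of_cnt h
  intro ε hε
  refine ⟨hA.toFinset.card, fun n => ?_⟩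
  have := cnt_fin hA.toFinset n
  simp only [Set.Finite.coe_toFinset] at this
  have h1 : (cnt A n : ℝ) ≤ hA.toFinset.card := by exact_mod_cast this
  have : (0 : ℝ) ≤ (0 + ε) * n := by positivity
  linarith

/-- The bipartite hypothesis. -/
def BipHyp (m : ℕ) (φ : ℝ) : Prop := ∀ V W : Set ℕ+, V.Infinite → W.Infinite → Disjoint V W →
      V ∪ W = Set.univ → ∀ c : Sym2 ℕ+ → Fin m,
      ∃ (i : Fin m) (P : Set ℕ+), IsMonoPath (bipAdj V W) c i P ∧ φ ≤ upperDensity P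

theorem bip_inf {k : ℕ} {Adj : ℕ+ → ℕ+ → Prop} {c : Sym2 ℕ+ → Fin k} {i : Fin k} {P : Set ℕ+}
    {φ : ℝ} (hφ : 0 < φ) (h : IsMonoPath Adj c i P) (hd : φ ≤ upperDensity P) :
    ∃ f : ℕ → ℕ+, Function.Injective f ∧
    (∀ j : ℕ, Adj (f j) (f (j + 1)) ∧ c s(f j, f (j + 1)) = i) ∧ P = Set.range f := by
  rcases h with ⟨n, f, _, _, rfl⟩ | h
  · exact absurd (dens_finite (Set.finite_range f) hd) (not_le.2 hφ)
  · exact h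

theorem phi_le {m : ℕ} (hm : 0 < m) {φ : ℝ} (hφ : 0 < φ) (h : BipHyp m φ) : φ ≤ 1 / m := by
  classical
  let V : Set ℕ+ := {v | ∃ a : ℕ+, v = a * a}
  have hVinf : V.Infinite := by
    apply Set.infinite_of_injective_forall_mem (f := fun a : ℕ+ => a * a)
    · intro a b hab
      simp only at hab
      have : (a : ℕ) * a = b * b := by exact_mod_cast congrArg PNat.val hab
      exact PNat.eq (Nat.mul_self_inj.1 this)
    · intro a; exact ⟨a, rfl⟩
  have hWinf : Vᶜ.Infinite := by
    apply Set.infinite_of_injective_forall_mem (f := fun a : ℕ+ => a * a + 1)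
    · intro a b hab
      simp only at hab
      have : (a : ℕ) * a + 1 = b * b + 1 := by exact_mod_cast congrArg PNat.val hab
      exact PNat.eq (Nat.mul_self_inj.1 (by omega))
    · rintro a ⟨b, hb⟩
      have h1 : (a : ℕ) * a + 1 = b * b := by exact_mod_cast congrArg PNat.val hb
      have h2 : (a : ℕ) < b := by nlinarith
      have h3 : 0 < (a : ℕ) := a.pos
      nlinarith
  let g : ℕ+ → ℕ+ → Fin m := fun x y =>
    if x ∈ V ∧ y ∉ V then ⟨y % m, Nat.mod_lt _ hm⟩ else
    if y ∈ V ∧ x ∉ V then ⟨x % m, Nat.mod_lt _ hm⟩ else ⟨0, hm⟩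
  have hg : ∀ x y, g x y = g y x := by
    intro x y; simp only [g]; split_ifs <;> first | rfl | tauto
  obtain ⟨i, P, hP, hd⟩ := h V Vᶜ hVinf hWinf disjoint_compl_right (by simp) (Sym2.lift ⟨g, hg⟩)
  obtain ⟨f, hf, hfe, rfl⟩ := bip_inf hφ hP hd
  have hsub : Set.range f ⊆ V ∪ {w : ℕ+ | (w : ℕ) % m = i.1} := by
    rintro _ ⟨j, rfl⟩
    by_cases hj : f j ∈ V
    · left; exact hj
    right
    obtain ⟨h1, h2⟩ := hfe j
    have h3 : f (j + 1) ∈ V := by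
      rcases h1 with h1 | h1
      · exact absurd h1.1 hj
      · exact h1.2
    simp only [Sym2.lift_mk, g, hj, h3, not_true, not_false_iff, and_self, if_false, if_true] at h2
    simp only [Set.mem_ofPred_eq, ← h2]
  apply dens_le_of_cnt hd
  intro ε hε
  refine ⟨1 / ε + 1, fun n => ?_⟩
  have h1 : cnt (Set.range f) n ≤ cnt V n + cnt {w : ℕ+ | (w : ℕ) % m = i.1} n :=
    (cnt_mono hsub n).trans (cnt_union _ _ n)
  have h2 : cnt V n ≤ Nat.sqrt n := by
    unfold cnt
    have : (win n).filter (· ∈ V) ⊆ (win (Nat.sqrt n)).image (fun a => a * a) := by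
      intro x hx
      simp only [Finset.mem_filter, mem_win] at hx
      obtain ⟨hx, a, rfl⟩ := hx
      refine Finset.mem_image.2 ⟨a, ?_, rfl⟩
      rw [mem_win, Nat.le_sqrt]
      exact_mod_cast hx
    refine (Finset.card_le_card this).trans (Finset.card_image_le.trans ?_)
    rw [card_win]
  have h3 : cnt {w : ℕ+ | (w : ℕ) % m = i.1} n ≤ n / m + 1 := by
    unfold cnt
    rw [← Finset.card_range (n / m + 1)]
    apply Finset.card_le_card_of_injOn (fun w : ℕ+ => (w : ℕ) / m)
    · intro w hw
      simp only [Finset.coe_filter, Set.mem_ofPred_eq, mem_win] at hw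
      simp only [Finset.coe_range, Set.mem_Iio]
      exact Nat.lt_succ_of_le (Nat.div_le_div_right hw.1)
    · intro w hw w' hw' e
      simp only [Finset.coe_filter, Set.mem_ofPred_eq, mem_win] at hw hw' e
      apply PNat.eq
      rw [← Nat.div_add_mod (w : ℕ) m, ← Nat.div_add_mod (w' : ℕ) m, e, hw.2, hw'.2]
  have h4 : (cnt (Set.range f) n : ℝ) ≤ Nat.sqrt n + ((n / m : ℕ) + 1) := by
    exact_mod_cast h1.trans (Nat.add_le_add h2 h3)
  have h5 : ((n / m : ℕ) : ℝ) ≤ 1 / m * n := by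
    have := @Nat.cast_div_le ℝ _ _ _ n m
    rw [one_div_mul_eq_div]; exact this
  have h6 : ((Nat.sqrt n : ℕ) : ℝ) * Nat.sqrt n ≤ n := by exact_mod_cast Nat.sqrt_le n
  have h7 : ((Nat.sqrt n : ℕ) : ℝ) ≤ ε * n + 1 / ε := by
    set s : ℝ := ((Nat.sqrt n : ℕ) : ℝ)
    have : s ≤ ε * (s * s) + 1 / ε := by
      have h8 : 0 ≤ (ε * s - 1) ^ 2 := sq_nonneg _
      have h9 : 0 ≤ ε * s := by positivity
      have : ε * s ≤ ε * (ε * (s * s) + 1 / ε) := by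
        rw [mul_add, mul_one_div_cancel hε.ne']; nlinarith
      exact le_of_mul_le_mul_left this hε
    nlinarith
  nlinarith

theorem caseA {m : ℕ} (hm : 0 < m) {φ : ℝ} (hφ : 0 < φ) (h : BipHyp m φ)
    (c : Sym2 ℕ+ → Fin (m + 1)) (i0 : Fin (m + 1)) (S : Finset ℕ+) (V W : Set ℕ+)
    (hV : V.Infinite) (hW : W.Infinite) (hd : Disjoint V W) (hVW : V ∪ W = (S : Set ℕ+)ᶜ)
    (hno : ∀ v ∈ V, ∀ w ∈ W, c s(v, w) ≠ i0) :
    ∃ (i : Fin (m + 1)) (P : Set ℕ+), IsMonoPath completeAdj c i P ∧ φ ≤ upperDensity P := by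
  classical
  have : ∀ e, ∃ j : Fin m, c e ≠ i0 → i0.succAbove j = c e := by
    intro e
    by_cases he : c e = i0
    · exact ⟨⟨0, hm⟩, fun h => absurd he h⟩
    · obtain ⟨j, hj⟩ := Fin.exists_succAbove_eq he
      exact ⟨j, fun _ => hj⟩
  choose c' hc' using this
  have hVS : ∀ x, x ∈ V ∪ W ↔ x ∉ S := by intro x; rw [hVW]; simp
  obtain ⟨i, P, hP, hdens⟩ := h (V ∪ S) W (hV.mono Set.subset_union_left) hW (by
    rw [Set.disjoint_union_left]
    refine ⟨hd, Set.disjoint_left.2 fun x hx hxW => (hVS x).1 (Or.inr hxW) hx⟩) (by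
    ext x
    have := hVS x
    simp only [Set.mem_union, Finset.mem_coe, Set.mem_univ, iff_true] at this ⊢
    tauto) c'
  obtain ⟨f, hf, hfe, rfl⟩ := bip_inf hφ hP hdens
  have hfin : {j | f j ∈ S}.Finite := S.finite_toSet.preimage (hf.injOn)
  obtain ⟨J, hJ⟩ := hfin.bddAbove
  have hJ' : ∀ j, J + 1 ≤ j → f j ∉ S := by
    intro j hj hjS
    have : j ≤ J := hJ hjS
    omega
  refine ⟨i0.succAbove i, Set.range (fun j => f (j + (J + 1))), Or.inr ⟨_, ?_, ?_, rfl⟩, ?_⟩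
  · intro a b hab
    have := hf hab
    omega
  · intro j
    have e : j + 1 + (J + 1) = j + (J + 1) + 1 := by omega
    simp only [e]
    obtain ⟨h1, h2⟩ := hfe (j + (J + 1))
    have h3 := hJ' (j + (J + 1)) (by omega)
    have h4 := hJ' (j + (J + 1) + 1) (by omega)
    refine ⟨fun h => ?_, ?_⟩
    · have := hf h; omega
    · rw [← h2]
      symm
      apply hc'
      rcases h1 with ⟨h5, h6⟩ | ⟨h5, h6⟩
      · exact hno _ (h5.resolve_right h3) _ h6
      · rw [Sym2.eq_swap]
        exact hno _ (h6.resolve_right h4) _ h5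
  · refine dens_finite_diff ((Finset.range (J + 1)).image f) ?_ hdens
    rintro _ ⟨j, rfl⟩
    by_cases hj : j < J + 1
    · right; simp only [Finset.coe_image, Finset.coe_range]; exact ⟨j, hj, rfl⟩
    · left; exact ⟨j - (J + 1), by simp only; congr 1; omega⟩

/-- Edge relation of colour `i`. -/
def EE {K : ℕ} (c : Sym2 ℕ+ → Fin K) (i : Fin K) (x y : ℕ+) : Prop := x ≠ y ∧ c s(x, y) = i

theorem EE.symm {K : ℕ} {c : Sym2 ℕ+ → Fin K} {i : Fin K} {x y : ℕ+} (h : EE c i x y) :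
    EE c i y x := ⟨h.1.symm, by rw [Sym2.eq_swap]; exact h.2⟩

/-- Vertices of infinite degree in colour `i`. -/
def XS {K : ℕ} (c : Sym2 ℕ+ → Fin K) (i : Fin K) : Set ℕ+ := {v | {w | EE c i v w}.Infinite}

/-- A finite path (reversed) with an end of infinite degree. -/
def Vld {K : ℕ} (c : Sym2 ℕ+ → Fin K) (i : Fin K) (l : List ℕ+) : Prop :=
  l.Nodup ∧ l.IsChain (EE c i) ∧ ∃ e t, l = e :: t ∧ e ∈ XS c i

/-- A finite path with both ends of infinite degree. -/
def Blok {K : ℕ} (c : Sym2 ℕ+ → Fin K) (i : Fin K) (l : List ℕ+) : Prop :=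
  l.Nodup ∧ l.IsChain (EE c i) ∧ (∃ e t, l = e :: t ∧ e ∈ XS c i) ∧
    (∃ t e, l = t ++ [e] ∧ e ∈ XS c i)

/-- No colour can be disconnected by a finite set into two infinite pieces. -/
def CaseB {K : ℕ} (c : Sym2 ℕ+ → Fin K) : Prop := ∀ (i : Fin K) (S : Finset ℕ+) (V W : Set ℕ+),
  V.Infinite → W.Infinite → Disjoint V W → V ∪ W = (S : Set ℕ+)ᶜ → ∃ v ∈ V, ∃ w ∈ W, c s(v, w) = i

/-- The graph of colour `i` with `S` isolated. -/
def GS {K : ℕ} (c : Sym2 ℕ+ → Fin K) (i : Fin K) (S : Finset ℕ+) : SimpleGraph ℕ+ where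
  Adj x y := EE c i x y ∧ x ∉ S ∧ y ∉ S
  symm := ⟨fun _ _ h => ⟨h.1.symm, h.2.2, h.2.1⟩⟩
  loopless := ⟨fun _ h => h.1.1 rfl⟩

theorem GS_inf {K : ℕ} {c : Sym2 ℕ+ → Fin K} {i : Fin K} {S : Finset ℕ+} {e : ℕ+}
    (he : e ∈ XS c i) (heS : e ∉ S) : {w | (GS c i S).Reachable e w}.Infinite := by
  have h : {w | EE c i e w}.Infinite := he
  refine (h.sdiff S.finite_toSet).mono ?_
  rintro w ⟨hw, hwS⟩
  exact SimpleGraph.Adj.reachable ⟨hw, heS, hwS⟩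

theorem GS_walk {K : ℕ} {c : Sym2 ℕ+ → Fin K} {i : Fin K} {S : Finset ℕ+} {x y : ℕ+}
    (hx : x ∉ S) (p : (GS c i S).Walk x y) : ∀ v ∈ p.support, v ∉ S := by
  induction p with
  | nil => intro v hv; simp at hv; subst hv; exact hx
  | cons h q ih =>
    intro v hv
    simp only [SimpleGraph.Walk.support_cons, List.mem_cons] at hv
    rcases hv with rfl | hv
    · exact hx
    · exact ih h.2.2 v hv

theorem link {K : ℕ} {c : Sym2 ℕ+ → Fin K} (hB : CaseB c) (i : Fin K) (S : Finset ℕ+) (x e : ℕ+)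
    (hx : x ∈ XS c i) (he : e ∈ XS c i) (hne : x ≠ e) (hxS : x ∉ S) (heS : e ∉ S) :
    ∃ mid : List ℕ+, (x :: (mid ++ [e])).IsChain (EE c i) ∧ (x :: (mid ++ [e])).Nodup ∧
      ∀ v ∈ mid, v ∉ S := by
  have hr : (GS c i S).Reachable x e := by
    by_contra hnr
    have hVS : ∀ v, (GS c i S).Reachable x v → v ∉ S := by
      rintro v ⟨p⟩
      exact GS_walk hxS p v p.end_mem_support
    obtain ⟨v, hv, w, hw, hc⟩ := hB i S {w | (GS c i S).Reachable x w}
      ({w | w ∉ S} \ {w | (GS c i S).Reachable x w}) (GS_inf hx hxS)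
      ((GS_inf he heS).mono (by
        rintro w hw
        refine ⟨?_, fun h => hnr (SimpleGraph.Reachable.trans h (SimpleGraph.Reachable.symm hw))⟩
        obtain ⟨p⟩ := hw
        exact GS_walk heS p w p.end_mem_support))
      Set.disjoint_sdiff_right (by
        ext v
        have := hVS v
        simp only [Set.mem_union, Set.mem_ofPred_eq, Set.mem_sdiff, Set.mem_compl_iff,
          Finset.mem_coe]
        tauto)
    apply hw.2
    refine SimpleGraph.Reachable.trans hv (SimpleGraph.Adj.reachable ⟨⟨?_, hc⟩, hVS v hv, hw.1⟩)
    rintro rfl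
    exact hw.2 hv
  obtain ⟨p0⟩ := hr
  classical
  obtain ⟨p, hp⟩ := p0.toPath
  cases p with
  | nil => exact absurd rfl hne
  | cons h q =>
    have hS := GS_walk hxS (SimpleGraph.Walk.cons h q)
    have h1 := SimpleGraph.Walk.isChain_adj_support (SimpleGraph.Walk.cons h q)
    have h2 := hp.support_nodup
    rw [SimpleGraph.Walk.support_cons] at h1 h2 hS
    have h3 : q.support.dropLast ++ [e] = q.support := by
      conv_rhs => rw [← List.dropLast_append_getLast q.support_ne_nil]
      rw [SimpleGraph.Walk.getLast_support]
    refine ⟨q.support.dropLast, ?_, ?_, ?_⟩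
    · rw [h3]; exact h1.imp (fun _ _ h => h.1)
    · rw [h3]; exact h2
    · intro v hv
      exact hS v (List.mem_cons_of_mem _ (List.mem_of_mem_dropLast hv))

theorem add_block {K : ℕ} {c : Sym2 ℕ+ → Fin K} (hB : CaseB c) (i : Fin K) (l b : List ℕ+)
    (S : Finset ℕ+) (hl : Vld c i l) (hb : Blok c i b) (hd : ∀ v ∈ b, v ∉ l)
    (hS : ∀ v ∈ S, v ∉ l ∧ v ∉ b) :
    ∃ l', Vld c i l' ∧ l <:+ l' ∧ (∀ v ∈ b, v ∈ l') ∧ ∀ v ∈ S, v ∉ l' := by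
  classical
  obtain ⟨hln, hlc, e, t, rfl, he⟩ := hl
  obtain ⟨hbn, hbc, ⟨h, t', hh, hhX⟩, ⟨b', x, rfl, hx⟩⟩ := hb
  have hne : x ≠ e := by
    rintro rfl; exact hd x (by simp) (by simp)
  obtain ⟨mid, h1, h2, h3⟩ := link hB i (S ∪ t.toFinset ∪ b'.toFinset) x e hx he hne
    (by
      simp only [Finset.mem_union, List.mem_toFinset, not_or]
      refine ⟨⟨fun h => (hS x h).2 (by simp), fun h => hd x (by simp) (by simp [h])⟩, ?_⟩
      intro h
      rw [List.nodup_append] at hbn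
      exact hbn.2.2 x h x (by simp) rfl)
    (by
      simp only [Finset.mem_union, List.mem_toFinset, not_or]
      refine ⟨⟨fun h => (hS e h).1 (by simp), (List.nodup_cons.1 hln).1⟩, ?_⟩
      intro h
      exact hd e (by simp [h]) (by simp))
  simp only [Finset.mem_union, List.mem_toFinset, not_or] at h3
  refine ⟨b' ++ [x] ++ (mid ++ (e :: t)), ⟨?_, ?_, ?_⟩, ?_, ?_, ?_⟩
  · simp only [List.nodup_append, List.nodup_cons, List.mem_cons, List.mem_append] at *
    grind
  · have e1 : (b' ++ [x] ++ (mid ++ [e])).IsChain (EE c i) :=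
      List.IsChain.append_overlap hbc (by simpa using h1) (by simp)
    have e2 : ((b' ++ [x] ++ mid) ++ [e] ++ t).IsChain (EE c i) :=
      List.IsChain.append_overlap (by simpa using e1) (by simpa using hlc) (by simp)
    simpa using e2
  · rw [hh]; exact ⟨h, _, rfl, hhX⟩
  · exact ⟨b' ++ [x] ++ mid, by simp⟩
  · intro v hv; exact List.mem_append_left _ hv
  · intro v hv hv'
    have := hS v hv
    simp only [List.mem_append, List.mem_cons] at hv' this
    have := fun h => (h3 v h).1.1
    grind

theorem add_blocks {K : ℕ} {c : Sym2 ℕ+ → Fin K} (hB : CaseB c) (i : Fin K)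
    (B : Finset (List ℕ+)) : ∀ l, Vld c i l → (∀ b ∈ B, Blok c i b) →
    (∀ b ∈ B, ∀ b' ∈ B, ∀ v, v ∈ b → v ∈ b' → b = b') → (∀ b ∈ B, ∀ v ∈ b, v ∉ l) →
    ∃ l', Vld c i l' ∧ l <:+ l' ∧ ∀ b ∈ B, ∀ v ∈ b, v ∈ l' := by
  classical
  induction B using Finset.induction_on with
  | empty => intro l hl _ _ _; exact ⟨l, hl, List.suffix_rfl, by simp⟩
  | insert b B hbB ih =>
    intro l hl hbl hdis hd
    obtain ⟨l1, h1, h2, h3, h4⟩ := add_block hB i l b (B.biUnion List.toFinset) hl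
      (hbl b (by simp)) (hd b (by simp)) (by
        intro v hv
        simp only [Finset.mem_biUnion, List.mem_toFinset] at hv
        obtain ⟨b', hb', hv⟩ := hv
        refine ⟨hd b' (by simp [hb']) v hv, fun h => hbB ?_⟩
        rw [hdis b (by simp) b' (by simp [hb']) v h hv]
        exact hb')
    obtain ⟨l2, h5, h6, h7⟩ := ih l1 h1 (fun b' hb' => hbl b' (by simp [hb']))
      (fun b1 hb1 b2 hb2 => hdis b1 (by simp [hb1]) b2 (by simp [hb2]))
      (fun b' hb' v hv => h4 v (by
        simp only [Finset.mem_biUnion, List.mem_toFinset]; exact ⟨b', hb', hv⟩))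
    refine ⟨l2, h5, h2.trans h6, ?_⟩
    intro b' hb' v hv
    rcases Finset.mem_insert.1 hb' with rfl | hb'
    · exact h6.subset (h3 v hv)
    · exact h7 b' hb' v hv

/-- Blocks together with an arbitrary finite set of vertices of infinite degree. -/
theorem add_all {K : ℕ} {c : Sym2 ℕ+ → Fin K} (hB : CaseB c) (i : Fin K)
    (B : Finset (List ℕ+)) (A : Finset ℕ+) (hA : ∀ v ∈ A, v ∈ XS c i) (l : List ℕ+)
    (hl : Vld c i l) (hb : ∀ b ∈ B, Blok c i b)
    (hdis : ∀ b ∈ B, ∀ b' ∈ B, ∀ v, v ∈ b → v ∈ b' → b = b') (hd : ∀ b ∈ B, ∀ v ∈ b, v ∉ l) :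
    ∃ l', Vld c i l' ∧ l <:+ l' ∧ (∀ b ∈ B, ∀ v ∈ b, v ∈ l') ∧ ∀ v ∈ A, v ∈ l' := by
  classical
  obtain ⟨l1, h1, h2, h3⟩ := add_blocks hB i B l hl hb hdis hd
  obtain ⟨l2, h4, h5, h6⟩ := add_blocks hB i ((A.filter (· ∉ l1)).image (fun v => [v])) l1 h1
    (by
      intro b hb
      simp only [Finset.mem_image, Finset.mem_filter] at hb
      obtain ⟨v, ⟨hv, _⟩, rfl⟩ := hb
      exact ⟨by simp, by simp, ⟨v, [], rfl, hA v hv⟩, ⟨[], v, rfl, hA v hv⟩⟩)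
    (by
      intro b hb b' hb' v hv hv'
      simp only [Finset.mem_image, Finset.mem_filter] at hb hb'
      obtain ⟨u, _, rfl⟩ := hb
      obtain ⟨u', _, rfl⟩ := hb'
      simp at hv hv'
      rw [← hv, ← hv'])
    (by
      intro b hb v hv
      simp only [Finset.mem_image, Finset.mem_filter] at hb
      obtain ⟨u, ⟨_, hu⟩, rfl⟩ := hb
      simp at hv
      rw [hv]; exact hu)
  refine ⟨l2, h4, h2.trans h5, fun b hb v hv => h5.subset (h3 b hb v hv), ?_⟩
  intro v hv
  by_cases hvl : v ∈ l1
  · exact h5.subset hvl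
  · exact h6 [v] (Finset.mem_image.2 ⟨v, by simp [hv, hvl], rfl⟩) v (by simp)

theorem limit_path {K : ℕ} {c : Sym2 ℕ+ → Fin K} (i : Fin K) (s : ℕ → List ℕ+)
    (hv : ∀ j, Vld c i (s j)) (hs : ∀ j, s j <:+ s (j + 1))
    (hlen : ∀ j, (s j).length < (s (j + 1)).length) :
    ∃ P : Set ℕ+, IsMonoPath completeAdj c i P ∧ ∀ j, ∀ v ∈ s j, v ∈ P := by
  have hl : ∀ j, j < (s j).length := by
    intro j
    induction j with
    | zero => obtain ⟨_, _, e, t, h, _⟩ := hv 0; rw [h]; simp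
    | succ j ih => have := hlen j; omega
  set r : ℕ → List ℕ+ := fun j => (s j).reverse with hr
  have hrl : ∀ j, (r j).length = (s j).length := fun j => by simp [hr]
  have hpre : ∀ a b, a ≤ b → r a <+: r b := by
    intro a b hab
    induction b, hab using Nat.le_induction with
    | base => exact List.prefix_rfl
    | succ b _ ih => exact ih.trans (by simpa [r] using hs b)
  have hl' : ∀ j, j < (r j).length := fun j => by rw [hrl]; exact hl j
  let f : ℕ → ℕ+ := fun j => (r j)[j]'(hl' j)
  have hf : ∀ m j (h : j < (r m).length), (r m)[j] = f j := by
    intro m j h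
    rcases le_total m j with hmj | hmj
    · exact (hpre m j hmj).getElem h
    · exact ((hpre j m hmj).getElem (hl' j)).symm
  have hnd : ∀ j, (r j).Nodup := fun j => List.nodup_reverse.2 (hv j).1
  have hch : ∀ j, (r j).IsChain (EE c i) := fun j => by
    rw [hr]; simp only [List.isChain_reverse]
    exact (hv j).2.1.imp (fun _ _ h => h.symm)
  refine ⟨Set.range f, Or.inr ⟨f, ?_, ?_, rfl⟩, ?_⟩
  · intro a b hab
    have ha : a < (r (max a b)).length := lt_of_le_of_lt (le_max_left _ _) (hl' _)
    have hb : b < (r (max a b)).length := lt_of_le_of_lt (le_max_right _ _) (hl' _)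
    rw [← hf (max a b) a ha, ← hf (max a b) b hb] at hab
    exact (hnd _).getElem_inj_iff.1 hab
  · intro j
    have h1 : j + 1 < (r (j + 1)).length := hl' _
    have := (hch (j + 1)).getElem j h1
    rw [hf, hf] at this
    exact this
  · intro j v hvj
    have : v ∈ r j := by simpa [hr] using hvj
    obtain ⟨a, ha, h⟩ := List.getElem_of_mem this
    rw [hf] at h
    exact ⟨a, h⟩

theorem grow {K : ℕ} {c : Sym2 ℕ+ → Fin K} (i : Fin K) {φ : ℝ} (hφ : 0 < φ)
    (l0 : List ℕ+) (hl0 : Vld c i l0)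
    (hP : ∀ l, Vld c i l → ∀ N : ℕ, 0 < N → ∃ n ≥ N, ∃ l', Vld c i l' ∧ l <:+ l' ∧
      (φ - 1 / N) * n ≤ cnt {v | v ∈ l'} n) :
    ∃ P : Set ℕ+, IsMonoPath completeAdj c i P ∧ φ ≤ upperDensity P := by
  classical
  have step : ∀ (j : ℕ) (l : {l // Vld c i l}), ∃ l' : {l // Vld c i l}, l.1 <:+ l'.1 ∧
      l.1.length < l'.1.length ∧ ∃ n : ℕ, j + 1 ≤ n ∧
      (φ - 1 / (j + 1)) * n ≤ cnt {v | v ∈ l'.1} n := by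
    rintro j ⟨l, hl⟩
    set N : ℕ := max (j + 1) ⌈((l.length : ℝ) + 2) / φ⌉₊ with hN
    have hN1 : j + 1 ≤ N := le_max_left _ _
    have hN2 : ((l.length : ℝ) + 2) / φ ≤ N :=
      (Nat.le_ceil _).trans (Nat.cast_le.2 (le_max_right _ _))
    rw [div_le_iff₀ hφ] at hN2
    have hNpos : (0 : ℝ) < N := by exact_mod_cast (by omega : 0 < N)
    obtain ⟨n, hn, l', h1, h2, h3⟩ := hP l hl N (by omega)
    have hnN : (N : ℝ) ≤ n := by exact_mod_cast hn
    refine ⟨⟨l', h1⟩, h2, ?_, n, by omega, ?_⟩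
    · have h4 : cnt {v | v ∈ l'} n ≤ l'.length := by
        have e : {v | v ∈ l'} = (l'.toFinset : Set ℕ+) := by ext; simp
        rw [e]
        exact (cnt_fin _ n).trans (List.toFinset_card_le _)
      have h5 : (cnt {v | v ∈ l'} n : ℝ) ≤ l'.length := by exact_mod_cast h4
      have h6 : (0 : ℝ) ≤ φ - 1 / N := by
        rw [sub_nonneg, div_le_iff₀ hNpos]
        have : (0 : ℝ) ≤ l.length := by positivity
        linarith
      have h7 : (φ - 1 / N) * N ≤ (φ - 1 / N) * n := mul_le_mul_of_nonneg_left hnN h6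
      have h8 : (φ - 1 / N) * N = φ * N - 1 := by field_simp
      have h9 : (l.length : ℝ) < l'.length := by linarith
      exact_mod_cast h9
    · refine le_trans ?_ h3
      have : (1 : ℝ) / N ≤ 1 / (j + 1) := by
        apply one_div_le_one_div_of_le (by positivity)
        exact_mod_cast hN1
      gcongr
  choose nx h1 h2 h3 using step
  let s : ℕ → {l // Vld c i l} := fun j => Nat.rec ⟨l0, hl0⟩ (fun j l => nx j l) j
  have hs : ∀ j, s (j + 1) = nx j (s j) := fun j => rfl
  obtain ⟨P, hP, hsub⟩ := limit_path i (fun j => (s j).1) (fun j => (s j).2)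
    (fun j => by simp only [hs]; exact h1 j (s j)) (fun j => by simp only [hs]; exact h2 j (s j))
  refine ⟨P, hP, ?_⟩
  rw [dens_iff]
  intro ε hε
  rw [frequently_atTop]
  intro a
  obtain ⟨b, hb⟩ := exists_nat_one_div_lt hε
  set j := max a b with hj
  obtain ⟨n, hn, h4⟩ := h3 j (s j)
  refine ⟨n, by have := le_max_left a b; omega, ?_⟩
  rw [← hs] at h4
  have h5 : cnt {v | v ∈ (s (j + 1)).1} n ≤ cnt P n := cnt_mono (fun v hv => hsub (j + 1) v hv) n
  have h6 : (cnt {v | v ∈ (s (j + 1)).1} n : ℝ) ≤ cnt P n := by exact_mod_cast h5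
  refine le_trans ?_ (h4.trans h6)
  have h7 : (1 : ℝ) / (j + 1) ≤ 1 / (b + 1) := by
    apply one_div_le_one_div_of_le (by positivity)
    have : (b : ℝ) ≤ j := by exact_mod_cast le_max_right a b
    linarith
  have : φ - ε ≤ φ - 1 / (j + 1) := by linarith
  gcongr

theorem le_cnt {S : Finset ℕ+} {A : Set ℕ+} {n : ℕ} (h : ∀ v ∈ S, v ∈ win n ∧ v ∈ A) :
    S.card ≤ cnt A n := by
  classical
  unfold cnt
  refine Finset.card_le_card (fun v hv => ?_)
  simp only [Finset.mem_filter]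
  exact h v hv

theorem exists_max_card {β : Type*} (P : Finset β → Prop) (h0 : P ∅) (b : ℕ)
    (hb : ∀ s, P s → s.card ≤ b) : ∃ s, P s ∧ ∀ t, P t → t.card ≤ s.card := by
  classical
  have h1 : ∃ s, P s ∧ s.card = Nat.findGreatest (fun r => ∃ s, P s ∧ s.card = r) b :=
    Nat.findGreatest_spec (P := fun r => ∃ s, P s ∧ s.card = r) (Nat.zero_le b) ⟨∅, h0, rfl⟩
  obtain ⟨s, hs, hc⟩ := h1
  refine ⟨s, hs, fun t ht => ?_⟩
  rw [hc]
  exact Nat.le_findGreatest (hb t ht) ⟨t, ht, rfl⟩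

/-- A family of disjoint paths with `L` vertices inside `Y`. -/
def Fam {K : ℕ} (c : Sym2 ℕ+ → Fin K) (i : Fin K) (L : ℕ) (Y : Finset ℕ+)
    (Q : Finset (List ℕ+)) : Prop :=
  (∀ q ∈ Q, q.Nodup ∧ q.IsChain (EE c i) ∧ q.length = L ∧ ∀ v ∈ q, v ∈ Y) ∧
  ∀ q ∈ Q, ∀ q' ∈ Q, ∀ v, v ∈ q → v ∈ q' → q = q'

open scoped Classical in
theorem Fam.card_le {K : ℕ} {c : Sym2 ℕ+ → Fin K} {i : Fin K} {L : ℕ} {Y : Finset ℕ+}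
    {Q : Finset (List ℕ+)} (h : Fam c i L Y Q) : Q.card * L ≤ Y.card := by
  have h1 : (Q.biUnion List.toFinset).card = ∑ q ∈ Q, q.toFinset.card := by
    apply Finset.card_biUnion
    intro q hq q' hq' hne
    rw [Function.onFun, Finset.disjoint_left]
    intro v hv hv'
    rw [List.mem_toFinset] at hv hv'
    exact hne (h.2 q hq q' hq' v hv hv')
  have h2 : ∑ q ∈ Q, q.toFinset.card = Q.card * L := by
    rw [Finset.sum_const_nat]
    intro q hq
    rw [List.toFinset_card_of_nodup (h.1 q hq).1]
    exact (h.1 q hq).2.2.1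
  rw [← h2, ← h1]
  apply Finset.card_le_card
  intro v hv
  simp only [Finset.mem_biUnion, List.mem_toFinset] at hv
  obtain ⟨q, hq, hv⟩ := hv
  exact (h.1 q hq).2.2.2 v hv

open scoped Classical in
theorem Fam.exists_max {K : ℕ} (c : Sym2 ℕ+ → Fin K) (i : Fin K) (L : ℕ) (hL : 1 ≤ L)
    (Y : Finset ℕ+) : ∃ Q, Fam c i L Y Q ∧
      ∀ l : List ℕ+, l.Nodup → l.IsChain (EE c i) →
        (∀ v ∈ l, v ∈ Y \ Q.biUnion List.toFinset) → l.length ≠ L := by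
  obtain ⟨Q, hQ, hmax⟩ := exists_max_card (Fam c i L Y) ⟨by simp, by simp⟩ Y.card (by
    intro s hs
    have := hs.card_le
    nlinarith)
  refine ⟨Q, hQ, ?_⟩
  intro l hln hlc hlY hlL
  have hv : ∀ v ∈ l, v ∈ Y ∧ ∀ q ∈ Q, v ∉ q := by
    intro v hv
    have := hlY v hv
    simp only [Finset.mem_sdiff, Finset.mem_biUnion, List.mem_toFinset, not_exists, not_and] at this
    exact this
  have hlQ : l ∉ Q := by
    intro h
    obtain ⟨v, hvl⟩ := List.exists_mem_of_length_pos (by omega : 0 < l.length)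
    exact (hv v hvl).2 l h hvl
  have := hmax (insert l Q) ⟨?_, ?_⟩
  · rw [Finset.card_insert_of_notMem hlQ] at this; omega
  · intro q hq
    rcases Finset.mem_insert.1 hq with rfl | hq
    · exact ⟨hln, hlc, hlL, fun v h => (hv v h).1⟩
    · exact hQ.1 q hq
  · intro q hq q' hq' v hvq hvq'
    rcases Finset.mem_insert.1 hq with rfl | h1 <;> rcases Finset.mem_insert.1 hq' with rfl | h2
    · rfl
    · exact absurd hvq' ((hv v hvq).2 _ h2)
    · exact absurd hvq ((hv v hvq').2 _ h1)
    · exact hQ.2 q h1 q' h2 v hvq hvq'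

open scoped Classical in
theorem per_colour {K : ℕ} {c : Sym2 ℕ+ → Fin K} (hB : CaseB c) (i : Fin K) (l : List ℕ+)
    (hl : Vld c i l) (Z : Set ℕ+) (hZ : Z.Infinite) (hZX : Z ⊆ XS c i)
    (hZf : ∀ z ∈ Z, {w | ¬ EE c i z w}.Finite) (ε : ℝ) (hε : 0 < ε) :
    ∃ (F : Finset ℕ+) (N : ℕ), ∀ n ≥ N, ∀ W : Finset ℕ+, W ⊆ win n → Disjoint W F → ∀ β : ℝ,
      (∀ l', Vld c i l' → l <:+ l' → (cnt {v | v ∈ l'} n : ℝ) ≤ β) →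
      ∃ D : Finset ℕ+, ((W.filter (· ∈ XS c i)).card : ℝ) + D.card ≤ β + ε * n ∧
        ((((W \ D) ×ˢ (W \ D)).filter (fun p => p.2 ∉ XS c i ∧ EE c i p.1 p.2)).card : ℝ)
          ≤ 2 * ε * n ^ 2 := by
  obtain ⟨N1, hN1⟩ := dense_konig (α := ℕ+) ε hε
  set κ : ℕ := ⌈4 / ε⌉₊ with hκ
  have hZ' : (Z \ {v | v ∈ l}).Infinite := hZ.sdiff (List.finite_toSet l)
  let z : ℕ → ℕ+ := fun j => (hZ'.natEmbedding _ j : ℕ+)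
  have hzinj : Function.Injective z := fun a b h => (hZ'.natEmbedding _).injective (Subtype.ext h)
  have hzZ : ∀ j, z j ∈ Z := fun j => (hZ'.natEmbedding _ j).2.1
  have hzl : ∀ j, z j ∉ l := fun j => (hZ'.natEmbedding _ j).2.2
  let F : Finset ℕ+ := l.toFinset ∪
    (Finset.range (2 * κ)).biUnion (fun j => (hZf (z j) (hzZ j)).toFinset)
  have hF1 : ∀ v ∈ l, v ∈ F := by intro v hv; simp [F, hv]
  have hF2 : ∀ j < 2 * κ, ∀ w ∉ F, EE c i (z j) w := by
    intro j hj w hw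
    by_contra hne
    apply hw
    simp only [F, Finset.mem_union, Finset.mem_biUnion, Finset.mem_range, Set.Finite.mem_toFinset]
    right; exact ⟨j, hj, hne⟩
  have hF3 : ∀ j < 2 * κ, z j ∈ F := by
    intro j hj
    by_contra h
    exact (hF2 j hj _ h).1 rfl
  refine ⟨F, max N1 (⌈4 / ε⌉₊ + 1), ?_⟩
  intro n hn W hWn hWF β hβ
  have hnN1 : N1 ≤ n := (le_max_left _ _).trans hn
  have hn2 : ⌈4 / ε⌉₊ + 1 ≤ n := (le_max_right _ _).trans hn
  have hnpos : (0 : ℝ) < n := by exact_mod_cast (by omega : 0 < n)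
  have hn4 : 4 ≤ ε * n := by
    have h1 : 4 / ε ≤ n := (Nat.le_ceil _).trans (by exact_mod_cast (by omega : ⌈4 / ε⌉₊ ≤ n))
    rw [div_le_iff₀ hε] at h1; linarith
  have hWc : W.card ≤ n := by rw [← card_win n]; exact Finset.card_le_card hWn
  have hWF' : ∀ v ∈ W, v ∉ F := fun v hv => Finset.disjoint_left.1 hWF hv
  set L : ℕ := ⌈ε / 4 * n⌉₊ with hLdef
  have hL1 : 1 ≤ L := by
    rw [hLdef]; apply Nat.ceil_pos.2; positivity
  have hLge : ε / 4 * n ≤ L := Nat.le_ceil _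
  have hLle : (L : ℝ) ≤ ε / 4 * n + 1 := (Nat.ceil_lt_add_one (by positivity)).le
  let X := W.filter (· ∈ XS c i)
  let Y0 := W.filter (· ∉ XS c i)
  obtain ⟨Q, hQ, hQmax⟩ := Fam.exists_max c i L hL1 Y0
  set QU := Q.biUnion List.toFinset with hQU
  have hmemQU : ∀ v, v ∈ QU ↔ ∃ q ∈ Q, v ∈ q := by intro v; simp [hQU]
  have hQUY : QU ⊆ Y0 := by
    intro v hv
    obtain ⟨q, hq, hv⟩ := (hmemQU v).1 hv
    exact (hQ.1 q hq).2.2.2 v hv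
  have hQc : Q.card ≤ κ := by
    have h1 := hQ.card_le
    have h2 : Y0.card ≤ n := (Finset.card_filter_le _ _).trans hWc
    have h3 : (Q.card : ℝ) * L ≤ n := by exact_mod_cast h1.trans h2
    have h4 : (Q.card : ℝ) * (ε / 4 * n) ≤ n :=
      (mul_le_mul_of_nonneg_left hLge (by positivity)).trans h3
    have h5 : (Q.card : ℝ) * (ε / 4) ≤ 1 := by
      have : (Q.card : ℝ) * (ε / 4) * n ≤ 1 * n := by linarith
      exact le_of_mul_le_mul_right this hnpos
    have h6 : (Q.card : ℝ) ≤ 4 / ε := by rw [le_div_iff₀ hε]; linarith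
    have h7 := h6.trans (Nat.le_ceil _)
    exact_mod_cast h7
  set Y := Y0 \ QU with hY
  have hXY : Disjoint X Y := by
    rw [Finset.disjoint_left]
    intro v hv hv'
    simp only [X, Y, Y0, Finset.mem_sdiff, Finset.mem_filter] at hv hv'
    exact hv'.1.2 hv.2
  obtain ⟨Y1, B, C, hY1, hBb, hBd, hY1B, hCc, hpairs⟩ := hN1 n hnN1 X Y (EE c i)
    (fun _ _ h => h.symm) hXY ((Finset.card_filter_le _ _).trans hWc)
    ((Finset.card_le_card Finset.sdiff_subset).trans ((Finset.card_filter_le _ _).trans hWc))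
  -- bad blocks
  let idx : List ℕ+ → ℕ := fun q => Q.toList.idxOf q
  have hidx : ∀ q ∈ Q, idx q < κ := by
    intro q hq
    have : idx q < Q.toList.length := List.idxOf_lt_length_iff.2 (Finset.mem_toList.2 hq)
    rw [Finset.length_toList] at this
    omega
  have hidxinj : ∀ q ∈ Q, ∀ q' ∈ Q, idx q = idx q' → q = q' := by
    intro q hq q' hq' h
    exact (List.idxOf_inj (Finset.mem_toList.2 hq)).1 h
  let bad : List ℕ+ → List ℕ+ := fun q => z (2 * idx q) :: (q ++ [z (2 * idx q + 1)])
  have hbadmem : ∀ q v, v ∈ bad q ↔ v = z (2 * idx q) ∨ v ∈ q ∨ v = z (2 * idx q + 1) := by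
    intro q v; simp [bad]
  have hqW : ∀ q ∈ Q, ∀ v ∈ q, v ∈ W ∧ v ∉ XS c i := by
    intro q hq v hv
    have := (hQ.1 q hq).2.2.2 v hv
    simpa [Y0] using this
  have hzF1 : ∀ q ∈ Q, z (2 * idx q) ∈ F ∧ z (2 * idx q + 1) ∈ F := by
    intro q hq
    have := hidx q hq
    exact ⟨hF3 _ (by omega), hF3 _ (by omega)⟩
  have hbadBlok : ∀ q ∈ Q, Blok c i (bad q) := by
    intro q hq
    have hi := hidx q hq
    have hz := hzF1 q hq
    have hzq : ∀ x ∈ F, x ∉ q := fun x hx h => hWF' x (hqW q hq x h).1 hx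
    refine ⟨?_, ?_, ⟨_, _, rfl, hZX (hzZ _)⟩, ⟨z (2 * idx q) :: q, z (2 * idx q + 1), rfl, hZX (hzZ _)⟩⟩
    · have hne : z (2 * idx q) ≠ z (2 * idx q + 1) := fun h => by
        have := hzinj h; omega
      have h1 := hzq _ hz.1
      have h2 := hzq _ hz.2
      have h3 := (hQ.1 q hq).1
      simp only [bad, List.nodup_cons, List.nodup_append, List.mem_append, List.mem_cons,
        List.not_mem_nil, or_false, not_or]
      refine ⟨⟨h1, hne⟩, h3, by simp, ?_⟩
      rintro a ha b rfl rfl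
      exact h2 ha
    · have h3 := (hQ.1 q hq).2.1
      have hqne : q ≠ [] := by
        intro h
        have := (hQ.1 q hq).2.2.1
        rw [h] at this; simp at this; omega
      have hE : ∀ j < 2 * κ, ∀ v ∈ q, EE c i (z j) v := fun j hj v hv =>
        hF2 j hj v (hWF' v (hqW q hq v hv).1)
      have e1 : (q ++ [z (2 * idx q + 1)]).IsChain (EE c i) := by
        rw [List.isChain_append]
        refine ⟨h3, by simp, ?_⟩
        intro x hx y hy
        simp at hy
        subst hy
        exact (hE _ (by omega) x (List.mem_of_mem_getLast? hx)).symm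
      simp only [bad]
      rw [List.isChain_cons]
      refine ⟨?_, e1⟩
      intro y hy
      rw [List.head?_append_of_ne_nil _ hqne] at hy
      exact hE _ (by omega) y (List.mem_of_mem_head? hy)
  have hXW : ∀ v, v ∈ X ∨ v ∈ Y → v ∈ W ∧ (v ∉ XS c i → v ∉ QU) := by
    intro v hv
    simp only [X, Y, Y0, Finset.mem_sdiff, Finset.mem_filter] at hv
    tauto
  have hbadgood : ∀ q ∈ Q, ∀ b ∈ B, ∀ v, v ∈ bad q → v ∈ b → False := by
    intro q hq b hb v hv hvb
    have h1 := hXW v ((hBb b hb).2.2.2.2 v hvb)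
    rcases (hbadmem q v).1 hv with rfl | h | rfl
    · exact hWF' _ h1.1 (hzF1 q hq).1
    · exact h1.2 (hqW q hq v h).2 ((hmemQU v).2 ⟨q, hq, h⟩)
    · exact hWF' _ h1.1 (hzF1 q hq).2
  have hbadbad : ∀ q ∈ Q, ∀ q' ∈ Q, ∀ v, v ∈ bad q → v ∈ bad q' → q = q' := by
    intro q hq q' hq' v hv hv'
    have hno : ∀ p ∈ Q, ∀ x ∈ F, x ∉ p := fun p hp x hx h => hWF' x (hqW p hp x h).1 hx
    rcases (hbadmem q v).1 hv with h | h | h <;> rcases (hbadmem q' v).1 hv' with h' | h' | h'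
    · have := hzinj (h.symm.trans h'); exact hidxinj q hq q' hq' (by omega)
    · exact absurd h' (hno q' hq' v (h ▸ (hzF1 q hq).1))
    · have := hzinj (h.symm.trans h'); omega
    · exact absurd h (hno q hq v (h' ▸ (hzF1 q' hq').1))
    · exact hQ.2 q hq q' hq' v h h'
    · exact absurd h (hno q hq v (h' ▸ (hzF1 q' hq').2))
    · have := hzinj (h.symm.trans h'); omega
    · exact absurd h' (hno q' hq' v (h ▸ (hzF1 q hq).2))
    · have := hzinj (h.symm.trans h'); exact hidxinj q hq q' hq' (by omega)
  obtain ⟨l', hl', hsuf, hall, hA⟩ := add_all hB i (Q.image bad ∪ B) X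
    (fun v hv => (Finset.mem_filter.1 hv).2) l hl
    (by
      intro b hb
      rcases Finset.mem_union.1 hb with hb | hb
      · obtain ⟨q, hq, rfl⟩ := Finset.mem_image.1 hb
        exact hbadBlok q hq
      · obtain ⟨h1, h2, ⟨h, t, h3, h4⟩, ⟨t', h', h5, h6⟩, _⟩ := hBb b hb
        exact ⟨h2, h1, ⟨h, t, h3, (Finset.mem_filter.1 h4).2⟩,
          ⟨t', h', h5, (Finset.mem_filter.1 h6).2⟩⟩)
    (by
      intro b hb b' hb' v hv hv'
      rcases Finset.mem_union.1 hb with hb | hb <;> rcases Finset.mem_union.1 hb' with hb' | hb'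
      · obtain ⟨q, hq, rfl⟩ := Finset.mem_image.1 hb
        obtain ⟨q', hq', rfl⟩ := Finset.mem_image.1 hb'
        rw [hbadbad q hq q' hq' v hv hv']
      · obtain ⟨q, hq, rfl⟩ := Finset.mem_image.1 hb
        exact (hbadgood q hq b' hb' v hv hv').elim
      · obtain ⟨q, hq, rfl⟩ := Finset.mem_image.1 hb'
        exact (hbadgood q hq b hb v hv' hv).elim
      · exact hBd b hb b' hb' v hv hv')
    (by
      intro b hb v hv hvl
      have hW : ∀ v ∈ W, v ∉ l := fun v hv h => hWF' v hv (hF1 v h)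
      rcases Finset.mem_union.1 hb with hb | hb
      · obtain ⟨q, hq, rfl⟩ := Finset.mem_image.1 hb
        rcases (hbadmem q v).1 hv with rfl | h | rfl
        · exact hzl _ hvl
        · exact hW v (hqW q hq v h).1 hvl
        · exact hzl _ hvl
      · exact hW v (hXW v ((hBb b hb).2.2.2.2 v hv)).1 hvl)
  have hcount : X.card + QU.card + Y1.card ≤ cnt {v | v ∈ l'} n := by
    have d1 : Disjoint X QU := by
      rw [Finset.disjoint_left]
      intro v hv hv'
      exact (Finset.mem_filter.1 (hQUY hv')).2 (Finset.mem_filter.1 hv).2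
    have d2 : Disjoint (X ∪ QU) Y1 := by
      rw [Finset.disjoint_left]
      intro v hv hv'
      rcases Finset.mem_union.1 hv with h | h
      · exact Finset.disjoint_left.1 hXY h (hY1 hv')
      · exact (Finset.mem_sdiff.1 (hY1 hv')).2 h
    rw [← Finset.card_union_of_disjoint d1, ← Finset.card_union_of_disjoint d2]
    apply le_cnt
    intro v hv
    have hvW : v ∈ W := by
      simp only [Finset.mem_union] at hv
      rcases hv with (h | h) | h
      · exact (Finset.mem_filter.1 h).1
      · exact (Finset.mem_filter.1 (hQUY h)).1
      · exact (hXW v (Or.inr (hY1 h))).1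
    refine ⟨hWn hvW, ?_⟩
    change v ∈ l'
    simp only [Finset.mem_union] at hv
    rcases hv with (h | h) | h
    · exact hA v h
    · obtain ⟨q, hq, hvq⟩ := (hmemQU v).1 h
      exact hall (bad q) (Finset.mem_union_left _ (Finset.mem_image_of_mem _ hq)) v
        ((hbadmem q v).2 (Or.inr (Or.inl hvq)))
    · obtain ⟨b, hb, hvb⟩ := hY1B v h
      exact hall b (Finset.mem_union_right _ hb) v hvb
  have hcount' : (X.card : ℝ) + QU.card + Y1.card ≤ β := by
    refine le_trans ?_ (hβ l' hl' hsuf)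
    exact_mod_cast hcount
  refine ⟨QU ∪ C, ?_, ?_⟩
  · have h1 : ((QU ∪ C).card : ℝ) ≤ QU.card + C.card := by
      exact_mod_cast Finset.card_union_le QU C
    change (X.card : ℝ) + _ ≤ _
    linarith
  · have hlong := long_path (EE c i) (fun _ _ h => h.symm) L hL1 Y.card Y rfl hQmax
    have hYc : Y.card ≤ n :=
      (Finset.card_le_card Finset.sdiff_subset).trans ((Finset.card_filter_le _ _).trans hWc)
    have hsub : ((W \ (QU ∪ C)) ×ˢ (W \ (QU ∪ C))).filter
          (fun p => p.2 ∉ XS c i ∧ EE c i p.1 p.2) ⊆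
        ((X ×ˢ Y).filter (fun p => EE c i p.1 p.2 ∧ p.1 ∉ C ∧ p.2 ∉ C)) ∪
        ((Y ×ˢ Y).filter (fun p => EE c i p.1 p.2)) := by
      rintro ⟨x, y⟩ h
      simp only [Finset.mem_filter, Finset.mem_product, Finset.mem_sdiff, Finset.mem_union,
        X, Y, Y0] at h ⊢
      tauto
    have h1 := (Finset.card_le_card hsub).trans (Finset.card_union_le _ _)
    have h2 : (((Y ×ˢ Y).filter (fun p => EE c i p.1 p.2)).card : ℝ) ≤ 2 * L * n := by
      have := hlong.trans (Nat.mul_le_mul_left (2 * L) hYc)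
      exact_mod_cast this
    have h3 : (2 : ℝ) * L * n ≤ ε * n ^ 2 := by nlinarith
    have h4 := (Nat.cast_le (α := ℝ)).2 h1
    push_cast at h4
    have hpairs' : (((X ×ˢ Y).filter (fun p => EE c i p.1 p.2 ∧ p.1 ∉ C ∧ p.2 ∉ C)).card : ℝ)
        ≤ ε * n ^ 2 := by convert hpairs
    refine le_trans h4 ?_
    linarith


theorem unif_bound {K : ℕ} {c : Sym2 ℕ+ → Fin K} {φ : ℝ} (hφ : 0 < φ)
    (hno : ¬ ∃ (i : Fin K) (P : Set ℕ+), IsMonoPath completeAdj c i P ∧ φ ≤ upperDensity P) :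
    ∃ ε > 0, ε ≤ φ ∧ ∃ N0 : ℕ, ∀ i, (XS c i).Nonempty → ∃ l, Vld c i l ∧ ∀ n ≥ N0, ∀ l',
      Vld c i l' → l <:+ l' → (cnt {v | v ∈ l'} n : ℝ) ≤ (φ - ε) * n := by
  classical
  have key : ∀ i, ∃ N : ℕ, 0 < N ∧ ((XS c i).Nonempty → ∃ l, Vld c i l ∧ ∀ n ≥ N, ∀ l',
      Vld c i l' → l <:+ l' → (cnt {v | v ∈ l'} n : ℝ) ≤ (φ - 1 / N) * n) := by
    intro i
    by_cases hX : (XS c i).Nonempty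
    · obtain ⟨x, hx⟩ := hX
      have hx0 : Vld c i [x] := ⟨by simp, by simp, x, [], rfl, hx⟩
      have hg := grow (c := c) i hφ [x] hx0
      by_contra hcon
      push Not at hcon
      apply hno
      refine ⟨i, hg ?_⟩
      intro l hl N hN
      obtain ⟨n, hn, l', h1, h2, h3⟩ := (hcon N hN).2 l hl
      exact ⟨n, hn, l', h1, h2, h3.le⟩
    · exact ⟨1, one_pos, fun h => absurd h hX⟩
  choose N hN hN' using key
  set N0 : ℕ := (∑ i, N i) + ⌈1 / φ⌉₊ + 1 with hN0
  have hN0pos : (0 : ℝ) < N0 := by positivity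
  refine ⟨1 / N0, by positivity, ?_, N0, ?_⟩
  · rw [div_le_iff₀ hN0pos]
    have h1 : 1 / φ ≤ (⌈1 / φ⌉₊ : ℝ) := Nat.le_ceil _
    have h2 : (⌈1 / φ⌉₊ : ℝ) ≤ N0 := by exact_mod_cast (by omega : ⌈1 / φ⌉₊ ≤ N0)
    have h3 := h1.trans h2
    rw [div_le_iff₀ hφ] at h3
    linarith
  · intro i hi
    obtain ⟨l, hl, h⟩ := hN' i hi
    have hle : N i ≤ N0 := by
      have : N i ≤ ∑ i, N i := Finset.single_le_sum (fun _ _ => Nat.zero_le _) (Finset.mem_univ i)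
      omega
    refine ⟨l, hl, fun n hn l' h1 h2 => (h n (hle.trans hn) l' h1 h2).trans ?_⟩
    have h3 : (1 : ℝ) / N0 ≤ 1 / N i := by
      apply one_div_le_one_div_of_le
      · exact_mod_cast hN i
      · exact_mod_cast hle
    have : (0 : ℝ) ≤ n := by positivity
    nlinarith

open scoped Classical in
theorem two_classes {K : ℕ} (W : Finset ℕ+) (X : Fin K → Set ℕ+) (D : Fin K → Finset ℕ+)
    (φ ε ε' n f : ℝ) (hn : 0 < n) (hε : 0 < ε) (hε' : ε' ≤ ε / 4) (hK : 3 ≤ K)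
    (hφ : (K - 1) * φ ≤ 1)
    (hcov : ∀ v, ∃ i, v ∈ X i)
    (hX : ∀ i, ((W.filter (· ∈ X i)).card : ℝ) + (D i).card ≤ (φ - ε + ε') * n)
    (hW : n ≤ W.card + f) (hf : 2 * f ≤ ε * n) :
    ∃ a b, a ≠ b ∧
      ε / K * n ≤ (W.filter (fun v => v ∈ X a ∧ (∀ j ≠ a, v ∉ X j) ∧ ∀ j, v ∉ D j)).card ∧
      ε / K * n ≤ (W.filter (fun v => v ∈ X b ∧ (∀ j ≠ b, v ∉ X j) ∧ ∀ j, v ∉ D j)).card := by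
  set R : Fin K → Finset ℕ+ :=
    fun a => W.filter (fun v => v ∈ X a ∧ (∀ j ≠ a, v ∉ X j) ∧ ∀ j, v ∉ D j) with hR
  have hKr : (3 : ℝ) ≤ K := by exact_mod_cast hK
  have hpt : ∀ v ∈ W, 2 ≤ (∑ i, if v ∈ X i then 1 else 0) + (∑ i, if v ∈ D i then 1 else 0)
      + (∑ i, if v ∈ R i then 1 else 0) := by
    intro v hv
    have one : ∀ (p : Fin K → Prop) [DecidablePred p] (i : Fin K), p i → 1 ≤ ∑ i, if p i then 1 else 0 := by
      intro p _ i hi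
      have := Finset.single_le_sum (f := fun i => if p i then 1 else 0)
        (fun _ _ => Nat.zero_le _) (Finset.mem_univ i)
      simpa [hi] using this
    obtain ⟨i, hi⟩ := hcov v
    have h1 := one (fun i => v ∈ X i) i hi
    by_cases hD : ∃ j, v ∈ D j
    · obtain ⟨j, hj⟩ := hD
      have h2 := one (fun i => v ∈ D i) j hj
      omega
    by_cases hX2 : ∃ j, j ≠ i ∧ v ∈ X j
    · obtain ⟨j, hj, hj'⟩ := hX2
      have h2 : 2 ≤ ∑ i, if v ∈ X i then 1 else 0 := by
        rw [← Finset.card_filter, ← Finset.card_pair hj]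
        apply Finset.card_le_card
        intro x hx
        simp only [Finset.mem_insert, Finset.mem_singleton] at hx
        rcases hx with rfl | rfl <;> simp [*]
      omega
    · have h2 := one (fun i => v ∈ R i) i (by
        push Not at hD hX2
        exact Finset.mem_filter.2 ⟨hv, hi, hX2, hD⟩)
      omega
  have hsum : 2 * W.card ≤ (∑ i, (W.filter (· ∈ X i)).card) + (∑ i, (D i).card)
      + ∑ i, (R i).card := by
    have h1 := Finset.sum_le_sum hpt
    rw [Finset.sum_const, smul_eq_mul, Finset.sum_add_distrib, Finset.sum_add_distrib,
      Finset.sum_comm (s := W), Finset.sum_comm (s := W), Finset.sum_comm (s := W)] at h1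
    simp only [← Finset.card_filter] at h1
    have h2 : ∑ i, (W.filter (· ∈ D i)).card ≤ ∑ i, (D i).card :=
      Finset.sum_le_sum (fun i _ => Finset.card_le_card (fun v hv => (Finset.mem_filter.1 hv).2))
    have h3 : ∑ i, (W.filter (· ∈ R i)).card ≤ ∑ i, (R i).card :=
      Finset.sum_le_sum (fun i _ => Finset.card_le_card (fun v hv => (Finset.mem_filter.1 hv).2))
    omega
  have hsumR : (2 : ℝ) * W.card ≤ (∑ i, (((W.filter (· ∈ X i)).card : ℝ) + (D i).card))
      + ∑ i, ((R i).card : ℝ) := by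
    rw [Finset.sum_add_distrib]
    exact_mod_cast hsum
  have hXs : (∑ i, (((W.filter (· ∈ X i)).card : ℝ) + (D i).card)) ≤ K * ((φ - ε + ε') * n) := by
    refine (Finset.sum_le_sum (fun i _ => hX i)).trans ?_
    simp
  have hRle : ∀ i, ((R i).card : ℝ) ≤ φ * n := by
    intro i
    have h1 : (R i).card ≤ (W.filter (· ∈ X i)).card := by
      apply Finset.card_le_card
      intro v hv
      have := Finset.mem_filter.1 hv
      exact Finset.mem_filter.2 ⟨this.1, this.2.1⟩
    have h2 : ((R i).card : ℝ) ≤ (W.filter (· ∈ X i)).card := by exact_mod_cast h1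
    have h3 := hX i
    have h4 : (0 : ℝ) ≤ (D i).card := by positivity
    have h5 : (ε' - ε) * n ≤ 0 := by nlinarith
    linarith
  have hbig : (φ + ε) * n ≤ ∑ i, ((R i).card : ℝ) := by
    have h1 : (K : ℝ) * ((φ - ε + ε') * n) ≤ (K * φ - 9 / 4 * ε) * n := by
      rw [← mul_assoc]
      apply mul_le_mul_of_nonneg_right _ hn.le
      nlinarith
    have h2 : (K : ℝ) * φ ≤ 2 - φ := by
      by_cases h0 : 0 ≤ φ
      · nlinarith
      · nlinarith
    have h3 : (K : ℝ) * φ * n ≤ (2 - φ) * n := mul_le_mul_of_nonneg_right h2 hn.le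
    nlinarith
  by_contra hcon
  push Not at hcon
  have hKpos : 0 < K := by omega
  obtain ⟨a, ha⟩ : ∃ a, ∀ b ≠ a, ((R b).card : ℝ) ≤ ε / K * n := by
    by_cases h : ∃ a, ε / K * n ≤ (R a).card
    · obtain ⟨a, ha⟩ := h
      exact ⟨a, fun b hb => (hcon a b hb.symm ha).le⟩
    · push Not at h
      exact ⟨⟨0, hKpos⟩, fun b _ => (h b).le⟩
  have h1 : ∑ i, ((R i).card : ℝ) ≤ φ * n + (K - 1) * (ε / K * n) := by
    rw [← Finset.add_sum_erase _ _ (Finset.mem_univ a)]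
    refine add_le_add (hRle a) ?_
    refine (Finset.sum_le_sum (fun i hi => ha i (Finset.ne_of_mem_erase hi))).trans ?_
    rw [Finset.sum_const, Finset.card_erase_of_mem (Finset.mem_univ a)]
    simp [Nat.cast_sub (show 1 ≤ K by omega)]
  have h2 : (K : ℝ) * (ε / K * n) = ε * n := by
    have : (K : ℝ) ≠ 0 := by positivity
    field_simp
  have h3 : 0 < ε / K * n := by positivity
  nlinarith

theorem caseB_final {m : ℕ} (hm : 2 ≤ m) {φ : ℝ} (hφ : 0 < φ) (hφm : φ ≤ 1 / m)
    (c : Sym2 ℕ+ → Fin (m + 1)) (hB : CaseB c) :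
    ∃ (i : Fin (m + 1)) (P : Set ℕ+), IsMonoPath completeAdj c i P ∧ φ ≤ upperDensity P := by
  classical
  by_contra hno
  obtain ⟨ε, hε, hεφ, N0, hN0⟩ := unif_bound hφ hno
  have hmpos : (0 : ℝ) < m := by exact_mod_cast (by omega : 0 < m)
  have hmφ : m * φ ≤ 1 := by
    rw [le_div_iff₀ hmpos] at hφm; linarith
  have hXcnt : ∀ i, ∀ n ≥ N0, (cnt (XS c i) n : ℝ) ≤ (φ - ε) * n := by
    intro i n hn
    by_cases hX : (XS c i).Nonempty
    · obtain ⟨l, hl, h⟩ := hN0 i hX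
      obtain ⟨l', h1, h2, _, h3⟩ := add_all hB i ∅ ((win n).filter (· ∈ XS c i))
        (fun v hv => (Finset.mem_filter.1 hv).2) l hl (by simp) (by simp) (by simp)
      refine le_trans ?_ (h n hn l' h1 h2)
      have : cnt (XS c i) n ≤ cnt {v | v ∈ l'} n := by
        have h4 : cnt (XS c i) n = ((win n).filter (· ∈ XS c i)).card := by
          unfold cnt; congr
        rw [h4]
        apply le_cnt
        intro v hv
        exact ⟨(Finset.mem_filter.1 hv).1, h3 v hv⟩
      exact_mod_cast this
    · have h0 : cnt (XS c i) n = 0 := by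
        rw [Set.not_nonempty_iff_eq_empty.1 hX]
        simp [cnt]
      rw [h0]
      have : 0 ≤ (φ - ε) := by linarith
      push_cast
      positivity
  have hcov : ∀ v, ∃ i, v ∈ XS c i := by
    intro v
    by_contra hcon
    push Not at hcon
    have hfin : (⋃ i, {w | EE c i v w}).Finite :=
      Set.finite_iUnion (fun i => Set.not_infinite.1 (hcon i))
    apply Set.infinite_univ (α := ℕ+)
    refine ((Set.finite_singleton v).union hfin).subset ?_
    intro w _
    by_cases hw : w = v
    · left; exact hw
    · right; exact Set.mem_iUnion.2 ⟨c s(v, w), fun h => hw h.symm, rfl⟩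
  let Z : Fin (m + 1) → Set ℕ+ := fun i => {v | v ∈ XS c i ∧ ∀ j ≠ i, v ∉ XS c j}
  have hZf : ∀ i, ∀ z ∈ Z i, {w | ¬ EE c i z w}.Finite := by
    intro i z hz
    have hfin : (⋃ j : {j // j ≠ i}, {w | EE c j.1 z w}).Finite :=
      Set.finite_iUnion (fun j => Set.not_infinite.1 (hz.2 j.1 j.2))
    refine ((Set.finite_singleton z).union hfin).subset ?_
    intro w hw
    by_cases hwz : w = z
    · left; exact hwz
    · right
      refine Set.mem_iUnion.2 ⟨⟨c s(z, w), ?_⟩, fun h => hwz h.symm, rfl⟩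
      intro h
      exact hw ⟨fun h => hwz h.symm, h⟩
  have hZinf : ∀ i, (Z i).Infinite := by
    intro i hfin
    have hbd : ∀ n ≥ N0, (n : ℝ) ≤ hfin.toFinset.card + m * ((φ - ε) * n) := by
      intro n hn
      have hsub : win n ⊆ hfin.toFinset ∪
          (Finset.univ.erase i).biUnion (fun j => (win n).filter (· ∈ XS c j)) := by
        intro v hv
        by_cases h : ∃ j, j ≠ i ∧ v ∈ XS c j
        · obtain ⟨j, hj, hvj⟩ := h
          refine Finset.mem_union_right _ (Finset.mem_biUnion.2 ⟨j, ?_, ?_⟩)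
          · simp [hj]
          · exact Finset.mem_filter.2 ⟨hv, hvj⟩
        · push Not at h
          obtain ⟨j, hj⟩ := hcov v
          have hji : j = i := by
            by_contra hne; exact h j hne hj
          subst hji
          apply Finset.mem_union_left
          rw [Set.Finite.mem_toFinset]
          exact ⟨hj, h⟩
      have h1 := (Finset.card_le_card hsub).trans (Finset.card_union_le _ _)
      have h2 := h1.trans (Nat.add_le_add_left Finset.card_biUnion_le _)
      rw [card_win] at h2
      have h3 := (Nat.cast_le (α := ℝ)).2 h2
      push_cast at h3
      refine h3.trans (add_le_add le_rfl ?_)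
      have h4 : ∀ j ∈ Finset.univ.erase i, (((win n).filter (· ∈ XS c j)).card : ℝ)
          ≤ (φ - ε) * n := by
        intro j _
        have := hXcnt j n hn
        unfold cnt at this
        convert this
      refine (Finset.sum_le_sum h4).trans ?_
      rw [Finset.sum_const, Finset.card_erase_of_mem (Finset.mem_univ i)]
      simp
    obtain ⟨n, hn⟩ := exists_nat_gt ((hfin.toFinset.card : ℝ) / (m * ε))
    have h1 := hbd (max n N0) (le_max_right _ _)
    have h2 : (n : ℝ) ≤ (max n N0 : ℕ) := by exact_mod_cast le_max_left _ _
    have h3 := hn.trans_le h2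
    rw [div_lt_iff₀ (by positivity)] at h3
    have h4 : (0 : ℝ) ≤ (max n N0 : ℕ) := by positivity
    have h5 := mul_le_mul_of_nonneg_right hmφ h4
    nlinarith
  set k : ℝ := ((m + 1 : ℕ) : ℝ) with hk
  have hkm : k = m + 1 := by rw [hk]; push_cast; ring
  have hkpos : 0 < k := by rw [hkm]; positivity
  set δ : ℝ := (ε / k) ^ 2 / (4 * (k + 1)) with hδ
  have hδpos : 0 < δ := by positivity
  set ε' : ℝ := min (ε / 4) δ with hε'
  have hε'pos : 0 < ε' := lt_min (by positivity) hδpos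
  have hper : ∀ i, ∃ (F : Finset ℕ+) (N : ℕ), ∀ n ≥ N, ∀ W : Finset ℕ+, W ⊆ win n →
      Disjoint W F →
      ∃ D : Finset ℕ+, ((W.filter (· ∈ XS c i)).card : ℝ) + D.card ≤ (φ - ε) * n + ε' * n ∧
        ((((W \ D) ×ˢ (W \ D)).filter (fun p => p.2 ∉ XS c i ∧ EE c i p.1 p.2)).card : ℝ)
          ≤ 2 * ε' * n ^ 2 := by
    intro i
    obtain ⟨z, hz⟩ := (hZinf i).nonempty
    obtain ⟨l, hl, h⟩ := hN0 i ⟨z, hz.1⟩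
    obtain ⟨F, N, hF⟩ := per_colour hB i l hl (Z i) (hZinf i) (fun z hz => hz.1) (hZf i) ε' hε'pos
    refine ⟨F, max N N0, fun n hn W hW hWF => ?_⟩
    obtain ⟨D, h1, h2⟩ := hF n ((le_max_left _ _).trans hn) W hW hWF ((φ - ε) * n)
      (fun l' a b => h n ((le_max_right _ _).trans hn) l' a b)
    refine ⟨D, ?_, ?_⟩
    · convert h1
    · convert h2
  choose F N hF using hper
  set FF : Finset ℕ+ := Finset.univ.biUnion F with hFF
  obtain ⟨n1, hn1⟩ := exists_nat_gt (2 * (FF.card : ℝ) / ε)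
  set n : ℕ := n1 + (∑ i, N i) + 1 with hn
  have hnpos : (0 : ℝ) < n := by rw [hn]; positivity
  have hf : 2 * (FF.card : ℝ) ≤ ε * n := by
    have h1 : (n1 : ℝ) ≤ n := by exact_mod_cast (by omega : n1 ≤ n)
    have h2 := hn1.trans_le h1
    rw [div_lt_iff₀ hε] at h2
    linarith
  have hNn : ∀ i, N i ≤ n := by
    intro i
    have : N i ≤ ∑ i, N i := Finset.single_le_sum (fun _ _ => Nat.zero_le _) (Finset.mem_univ i)
    omega
  set W : Finset ℕ+ := win n \ FF with hW
  have hWF : ∀ i, Disjoint W (F i) := by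
    intro i
    rw [Finset.disjoint_left]
    intro v hv hv'
    exact (Finset.mem_sdiff.1 hv).2 (Finset.mem_biUnion.2 ⟨i, Finset.mem_univ i, hv'⟩)
  have hDex := fun i => hF i n (hNn i) W Finset.sdiff_subset (hWF i)
  choose D hD1 hD2 using hDex
  have hWc : (n : ℝ) ≤ W.card + FF.card := by
    have h1 : win n ⊆ W ∪ FF := by
      intro v hv
      by_cases h : v ∈ FF
      · exact Finset.mem_union_right _ h
      · exact Finset.mem_union_left _ (Finset.mem_sdiff.2 ⟨hv, h⟩)
    have h2 := (Finset.card_le_card h1).trans (Finset.card_union_le _ _)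
    rw [card_win] at h2
    exact_mod_cast h2
  obtain ⟨a, b, hab, hA, hBc⟩ := two_classes W (fun i => XS c i) D φ ε ε' n FF.card hnpos hε
    (min_le_left _ _) (by omega) (by push_cast; linarith) hcov
    (fun i => by have := hD1 i; rw [add_mul]; convert this) hWc hf
  set A := W.filter (fun v => v ∈ XS c a ∧ (∀ j ≠ a, v ∉ XS c j) ∧ ∀ j, v ∉ D j) with hAdef
  set B := W.filter (fun v => v ∈ XS c b ∧ (∀ j ≠ b, v ∉ XS c j) ∧ ∀ j, v ∉ D j) with hBdef
  let T : Fin (m + 1) → Finset (ℕ+ × ℕ+) := fun i =>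
    ((W \ D i) ×ˢ (W \ D i)).filter (fun p => p.2 ∉ XS c i ∧ EE c i p.1 p.2)
  have hTc : ∀ i, ((T i).card : ℝ) ≤ 2 * ε' * n ^ 2 := fun i => by
    have := hD2 i
    convert this
  have hsub : A ×ˢ B ⊆ Finset.univ.biUnion T ∪ (T b).image Prod.swap := by
    rintro ⟨x, y⟩ hxy
    obtain ⟨hx, hy⟩ := Finset.mem_product.1 hxy
    obtain ⟨hxW, hxa, hxn, hxD⟩ := Finset.mem_filter.1 hx
    obtain ⟨hyW, hyb, hyn, hyD⟩ := Finset.mem_filter.1 hy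
    simp only at hxW hxa hxn hxD hyW hyb hyn hyD
    have hne : x ≠ y := by
      rintro rfl
      exact hxn b hab.symm hyb
    by_cases hi : c s(x, y) = b
    · apply Finset.mem_union_right
      refine Finset.mem_image.2 ⟨(y, x), ?_, rfl⟩
      refine Finset.mem_filter.2 ⟨Finset.mem_product.2 ⟨Finset.mem_sdiff.2 ⟨hyW, hyD b⟩,
        Finset.mem_sdiff.2 ⟨hxW, hxD b⟩⟩, hxn b hab.symm, ?_⟩
      exact EE.symm ⟨hne, hi⟩
    · apply Finset.mem_union_left
      refine Finset.mem_biUnion.2 ⟨c s(x, y), Finset.mem_univ _, ?_⟩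
      exact Finset.mem_filter.2 ⟨Finset.mem_product.2 ⟨Finset.mem_sdiff.2 ⟨hxW, hxD _⟩,
        Finset.mem_sdiff.2 ⟨hyW, hyD _⟩⟩, hyn _ hi, hne, rfl⟩
  have h1 := (Finset.card_le_card hsub).trans (Finset.card_union_le _ _)
  have h2 := h1.trans (Nat.add_le_add Finset.card_biUnion_le Finset.card_image_le)
  rw [Finset.card_product] at h2
  have h3 := (Nat.cast_le (α := ℝ)).2 h2
  push_cast at h3
  have h4 : ∑ i, ((T i).card : ℝ) ≤ k * (2 * ε' * n ^ 2) := by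
    refine (Finset.sum_le_sum (fun i _ => hTc i)).trans ?_
    simp [hk]
  have h5 : (ε / k * n) * (ε / k * n) ≤ (A.card : ℝ) * B.card :=
    mul_le_mul hA hBc (by positivity) (by positivity)
  have h6 : (ε / k * n) * (ε / k * n) ≤ (k + 1) * (2 * ε' * n ^ 2) := by
    have := hTc b
    linarith
  have h7 : (k + 1) * (2 * ε' * n ^ 2) ≤ (k + 1) * (2 * δ * n ^ 2) := by
    gcongr
    exact min_le_right _ _
  have h8 : (k + 1) * (2 * δ * n ^ 2) = (ε / k * n) * (ε / k * n) / 2 := by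
    rw [hδ]
    have : k + 1 ≠ 0 := by positivity
    field_simp
    ring
  have h9 : 0 < (ε / k * n) * (ε / k * n) := by positivity
  linarith


/-- If every `(k-1)`-edge-coloured `K_{V,W}` contains a monochromatic path of
upper density at least `φ`, then every `k`-edge-coloured `K_ℕ` contains a
monochromatic path of upper density at least `φ`. -/
theorem stmt_6 (k : ℕ) (hk : 3 ≤ k) (φ : ℝ)
    (hbip : ∀ V W : Set ℕ+, V.Infinite → W.Infinite → Disjoint V W →
      V ∪ W = Set.univ → ∀ c : Sym2 ℕ+ → Fin (k - 1),
      ∃ (i : Fin (k - 1)) (P : Set ℕ+),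
        IsMonoPath (bipAdj V W) c i P ∧ φ ≤ upperDensity P)
    (c : Sym2 ℕ+ → Fin k) :
    ∃ (i : Fin k) (P : Set ℕ+),
      IsMonoPath completeAdj c i P ∧ φ ≤ upperDensity P := by
  obtain ⟨m, rfl⟩ : ∃ m, k = m + 1 := ⟨k - 1, by omega⟩
  by_cases hφ : 0 < φ
  · have hb : BipHyp m φ := hbip
    by_cases hB : CaseB c
    · exact caseB_final (by omega) hφ (phi_le (by omega) hφ hb) c hB
    · unfold CaseB at hB
      push Not at hB
      obtain ⟨i, S, V, W, hV, hW, hd, hVW, hno⟩ := hB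
      exact caseA (by omega) hφ hb c i S V W hV hW hd hVW hno
  · refine ⟨⟨0, by omega⟩, ∅, Or.inl ⟨0, Fin.elim0, fun a => a.elim0, fun j h => by omega, ?_⟩, ?_⟩
    · ext x; simp
    · rw [dens_iff]
      intro ε hε
      apply Filter.Eventually.frequently
      filter_upwards with n
      have h1 : (0 : ℝ) ≤ n := by positivity
      have h2 : (0 : ℝ) ≤ cnt ∅ n := by positivity
      push Not at hφ
      nlinarith
end
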